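/- Let (R, m) be a Cohen-Macaulay commutative Noetherian local ring and let M be a d-dimensional non-zero finitely generated R-module of finite Gorenstein projective dimension. Then the following are equivalent: (i) M is Cohen-Macaulay; (ii) Gfd_R(H^d_m(M)) = Gpd_R(M) + d; (iii) Gpd_R(H^d_m(M)) = Gpd_R(M) + d. -/

import Mathlib

/-!
Definitions needed to state results of "On flat and Gorenstein flat dimensions of
local cohomology modules" by M.R. Zargar and H. Zakeri.
-/

open CategoryTheory IsLocalRing

universe u

namespace Paper

variable (R : Type u) [CommRing R]

/-! ## Resolution/coresolution dimensions with respect to a class of modules -/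

/-- `ResDimLE R P n M` : `M` admits a resolution `0 → Xₙ → ⋯ → X₀ → M → 0`
with each `Xᵢ` in the class `P`. -/
def ResDimLE (P : ModuleCat.{u} R → Prop) : ℕ → ModuleCat.{u} R → Prop
  | 0, M => P M
  | n + 1, M => ResDimLE P n M ∨
      ∃ (X : ModuleCat.{u} R) (f : X →ₗ[R] M), P X ∧ Function.Surjective f ∧
        ResDimLE P n (ModuleCat.of R (LinearMap.ker f))

/-- `CoresDimLE R P n M` : `M` admits a coresolution `0 → M → X₀ → ⋯ → Xₙ → 0`
with each `Xᵢ` in the class `P`. -/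
def CoresDimLE (P : ModuleCat.{u} R → Prop) : ℕ → ModuleCat.{u} R → Prop
  | 0, M => P M
  | n + 1, M => CoresDimLE P n M ∨
      ∃ (X : ModuleCat.{u} R) (f : M →ₗ[R] X), P X ∧ Function.Injective f ∧
        CoresDimLE P n (ModuleCat.of R (X ⧸ LinearMap.range f))

/-- The resolution dimension of `M` with respect to the class `P`, as an
extended natural number (`⊤` if there is no finite resolution). -/
noncomputable def ResDim (P : ModuleCat.{u} R → Prop) (M : ModuleCat.{u} R) : ℕ∞ :=
  sInf {n : ℕ∞ | ∃ k : ℕ, (k : ℕ∞) = n ∧ ResDimLE R P k M}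

/-- The coresolution dimension of `M` with respect to the class `P`. -/
noncomputable def CoresDim (P : ModuleCat.{u} R → Prop) (M : ModuleCat.{u} R) : ℕ∞ :=
  sInf {n : ℕ∞ | ∃ k : ℕ, (k : ℕ∞) = n ∧ CoresDimLE R P k M}

/-- Flat dimension `fd_R M`. -/
noncomputable def flatDim (M : Type u) [AddCommGroup M] [Module R M] : ℕ∞ :=
  ResDim R (fun N => Module.Flat R N) (ModuleCat.of R M)

/-- Projective dimension `pd_R M`. -/
noncomputable def projDim (M : Type u) [AddCommGroup M] [Module R M] : ℕ∞ :=
  ResDim R (fun N => Module.Projective R N) (ModuleCat.of R M)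

/-- Injective dimension `id_R M`. -/
noncomputable def injDim (M : Type u) [AddCommGroup M] [Module R M] : ℕ∞ :=
  CoresDim R (fun N => Module.Injective R N) (ModuleCat.of R M)

/-! ## Local cohomology -/

/-- The local cohomology module `H^i_𝔞(M)`, as an object of `ModuleCat R`. -/
noncomputable def lcoh (𝔞 : Ideal R) (i : ℕ) (M : Type u) [AddCommGroup M] [Module R M] :
    ModuleCat.{u} R :=
  (localCohomology 𝔞 i).obj (ModuleCat.of R M)

/-- `M` is relative Cohen-Macaulay with respect to `𝔞` with `ht_M 𝔞 = n`, i.e. the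
`n`-th local cohomology of `M` with respect to `𝔞` is the only non-vanishing one. -/
def IsRelCM (𝔞 : Ideal R) (n : ℕ) (M : Type u) [AddCommGroup M] [Module R M] : Prop :=
  (∀ i : ℕ, i ≠ n → Subsingleton (lcoh R 𝔞 i M)) ∧ ¬ Subsingleton (lcoh R 𝔞 n M)

/-! ## Depth, dimension, Cohen-Macaulay -/

/-- The depth of a module over a local ring: the supremum of the lengths of
`M`-regular sequences contained in the maximal ideal. -/
noncomputable def depth [IsLocalRing R] (M : Type u) [AddCommGroup M] [Module R M] : ℕ∞ :=
  sSup {n : ℕ∞ | ∃ rs : List R, (rs.length : ℕ∞) = n ∧ (∀ x ∈ rs, x ∈ maximalIdeal R) ∧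
    RingTheory.Sequence.IsRegular M rs}

/-- The (Krull) dimension of a module: the Krull dimension of `R` modulo
the annihilator of `M` (`⊥` for the zero module). -/
noncomputable def moduleDim (M : Type u) [AddCommGroup M] [Module R M] : WithBot ℕ∞ :=
  ringKrullDim (R ⧸ Module.annihilator R M)

/-- A finitely generated module over a local ring is Cohen-Macaulay
if its depth equals its dimension. -/
def IsCohenMacaulayModule [IsLocalRing R] (M : Type u) [AddCommGroup M] [Module R M] : Prop :=
  (depth R M : WithBot ℕ∞) = moduleDim R M

/-- A local ring is Cohen-Macaulay if it is so as a module over itself. -/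
def IsCohenMacaulayRing [IsLocalRing R] : Prop := IsCohenMacaulayModule R R

/-- A local ring is Gorenstein if it has finite injective dimension over itself. -/
def IsGorensteinRing : Prop := injDim R R ≠ ⊤

/-! ## Ext, Tor, semidualizing modules -/

/-- `Ext^i_R(A, B)`. -/
noncomputable def ext (i : ℕ) (A B : Type u) [AddCommGroup A] [Module R A]
    [AddCommGroup B] [Module R B] : ModuleCat.{u} R :=
  ((Ext R (ModuleCat.{u} R) i).obj (Opposite.op (ModuleCat.of R A))).obj (ModuleCat.of R B)

/-- `Tor^R_p(A, B)` indexed by `p : ℤ`, with the convention that it vanishes in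
negative degrees. -/
noncomputable def tor (p : ℤ) (A B : Type u) [AddCommGroup A] [Module R A]
    [AddCommGroup B] [Module R B] : ModuleCat.{u} R :=
  if 0 ≤ p then ((Tor (ModuleCat.{u} R) p.toNat).obj (ModuleCat.of R A)).obj (ModuleCat.of R B)
  else ModuleCat.of R PUnit

/-- A finitely generated module `C` is semidualizing if the natural map
`R → Hom_R(C, C)` is bijective and `Ext^i_R(C, C) = 0` for all `i ≥ 1`. -/
def IsSemidualizing (C : Type u) [AddCommGroup C] [Module R C] : Prop :=
  Module.Finite R C ∧
  Function.Bijective (fun r : R => (r • LinearMap.id : C →ₗ[R] C)) ∧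
  ∀ i : ℕ, 1 ≤ i → Subsingleton (ext R i C C)

/-! ## Gorenstein homological classes -/

/-- `N` is Gorenstein injective: it is the kernel of the `0`-th differential of some
exact complex `Y` of injective modules which stays exact under `Hom(I, -)` for every
injective module `I`. (The complex is written cohomologically.) -/
def IsGorensteinInjective (N : Type u) [AddCommGroup N] [Module R N] : Prop :=
  ∃ (Y : ℤ → ModuleCat.{u} R) (d : ∀ i : ℤ, Y i →ₗ[R] Y (i + 1)),
    (∀ i, Module.Injective R (Y i)) ∧
    (∀ i, Function.Exact (d i) (d (i + 1))) ∧
    (∀ (I : ModuleCat.{u} R), Module.Injective R I →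
      ∀ (i : ℤ) (g : I →ₗ[R] Y (i + 1)), (d (i + 1)).comp g = 0 →
        ∃ h : I →ₗ[R] Y i, (d i).comp h = g) ∧
    ∃ ι : N →ₗ[R] Y 0, Function.Injective ι ∧ Function.Exact ι (d 0)

/-- `N` is Gorenstein projective: it is the cokernel of a differential of some
exact complex `X` of projective modules which stays exact under `Hom(-, P)` for
every projective module `P`. -/
def IsGorensteinProjective (N : Type u) [AddCommGroup N] [Module R N] : Prop :=
  ∃ (X : ℤ → ModuleCat.{u} R) (d : ∀ i : ℤ, X i →ₗ[R] X (i + 1)),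
    (∀ i, Module.Projective R (X i)) ∧
    (∀ i, Function.Exact (d i) (d (i + 1))) ∧
    (∀ (P : ModuleCat.{u} R), Module.Projective R P →
      ∀ (i : ℤ) (g : X (i + 1) →ₗ[R] P), g.comp (d i) = 0 →
        ∃ h : X (i + 1 + 1) →ₗ[R] P, h.comp (d (i + 1)) = g) ∧
    ∃ π : X 0 →ₗ[R] N, Function.Surjective π ∧ Function.Exact (d (-1)) π

/-- `N` is Gorenstein flat: it is the cokernel of a differential of some exact
complex `Z` of flat modules which stays exact under `- ⊗ I` for every injective
module `I`. -/
def IsGorensteinFlat (N : Type u) [AddCommGroup N] [Module R N] : Prop :=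
  ∃ (Z : ℤ → ModuleCat.{u} R) (d : ∀ i : ℤ, Z i →ₗ[R] Z (i + 1)),
    (∀ i, Module.Flat R (Z i)) ∧
    (∀ i, Function.Exact (d i) (d (i + 1))) ∧
    (∀ (I : ModuleCat.{u} R), Module.Injective R I →
      ∀ i : ℤ, Function.Exact (LinearMap.rTensor (R := R) I (d i))
        (LinearMap.rTensor (R := R) I (d (i + 1)))) ∧
    ∃ π : Z 0 →ₗ[R] N, Function.Surjective π ∧ Function.Exact (d (-1)) π

/-- Gorenstein injective dimension `Gid_R M`. -/
noncomputable def GinjDim (M : Type u) [AddCommGroup M] [Module R M] : ℕ∞ :=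
  CoresDim R (fun N => IsGorensteinInjective R N) (ModuleCat.of R M)

/-- Gorenstein projective dimension `Gpd_R M`. -/
noncomputable def GprojDim (M : Type u) [AddCommGroup M] [Module R M] : ℕ∞ :=
  ResDim R (fun N => IsGorensteinProjective R N) (ModuleCat.of R M)

/-- Gorenstein flat dimension `Gfd_R M`. -/
noncomputable def GflatDim (M : Type u) [AddCommGroup M] [Module R M] : ℕ∞ :=
  ResDim R (fun N => IsGorensteinFlat R N) (ModuleCat.of R M)

/-! ## `C`-injective, `C`-projective, `C`-flat modules and the `G_C`-classes -/

/-- `N` is `C`-injective if `N ≅ Hom_R(C, I)` for some injective module `I`. -/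
def IsCInjective (C : Type u) [AddCommGroup C] [Module R C]
    (N : Type u) [AddCommGroup N] [Module R N] : Prop :=
  ∃ I : ModuleCat.{u} R, Module.Injective R I ∧ Nonempty (N ≃ₗ[R] (C →ₗ[R] I))

/-- `N` is `C`-projective if `N ≅ C ⊗_R P` for some projective module `P`. -/
def IsCProjective (C : Type u) [AddCommGroup C] [Module R C]
    (N : Type u) [AddCommGroup N] [Module R N] : Prop :=
  ∃ P : ModuleCat.{u} R, Module.Projective R P ∧ Nonempty (N ≃ₗ[R] TensorProduct R C P)

/-- `N` is `C`-flat if `N ≅ C ⊗_R F` for some flat module `F`. -/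
def IsCFlat (C : Type u) [AddCommGroup C] [Module R C]
    (N : Type u) [AddCommGroup N] [Module R N] : Prop :=
  ∃ F : ModuleCat.{u} R, Module.Flat R F ∧ Nonempty (N ≃ₗ[R] TensorProduct R C F)

/-- `C`-injective dimension `cid_R M`. -/
noncomputable def cInjDim (C : Type u) [AddCommGroup C] [Module R C]
    (M : Type u) [AddCommGroup M] [Module R M] : ℕ∞ :=
  CoresDim R (fun N => IsCInjective R C N) (ModuleCat.of R M)

/-- `C`-projective dimension `cpd_R M`. -/
noncomputable def cProjDim (C : Type u) [AddCommGroup C] [Module R C]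
    (M : Type u) [AddCommGroup M] [Module R M] : ℕ∞ :=
  ResDim R (fun N => IsCProjective R C N) (ModuleCat.of R M)

/-- `N` is `G_C`-injective: `N` is the kernel of the `0`-th differential of an exact
complex `Y` (a complete `I_C I`-coresolution) with `Y i` injective in degrees belonging
to the coresolution part and `C`-injective elsewhere, such that `Hom(I', Y)` is exact
for every `C`-injective module `I'`. -/
def IsGCInjective (C : Type u) [AddCommGroup C] [Module R C]
    (N : Type u) [AddCommGroup N] [Module R N] : Prop :=
  ∃ (Y : ℤ → ModuleCat.{u} R) (d : ∀ i : ℤ, Y i →ₗ[R] Y (i + 1)),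
    (∀ i : ℤ, 0 ≤ i → Module.Injective R (Y i)) ∧
    (∀ i : ℤ, i < 0 → IsCInjective R C (Y i)) ∧
    (∀ i, Function.Exact (d i) (d (i + 1))) ∧
    (∀ (I : ModuleCat.{u} R), IsCInjective R C I →
      ∀ (i : ℤ) (g : I →ₗ[R] Y (i + 1)), (d (i + 1)).comp g = 0 →
        ∃ h : I →ₗ[R] Y i, (d i).comp h = g) ∧
    ∃ ι : N →ₗ[R] Y 0, Function.Injective ι ∧ Function.Exact ι (d 0)

/-- `N` is `G_C`-projective: the cokernel of the degree `0` differential of a complete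
`P_C P`-resolution. -/
def IsGCProjective (C : Type u) [AddCommGroup C] [Module R C]
    (N : Type u) [AddCommGroup N] [Module R N] : Prop :=
  ∃ (X : ℤ → ModuleCat.{u} R) (d : ∀ i : ℤ, X i →ₗ[R] X (i + 1)),
    (∀ i : ℤ, i ≤ 0 → Module.Projective R (X i)) ∧
    (∀ i : ℤ, 0 < i → IsCProjective R C (X i)) ∧
    (∀ i, Function.Exact (d i) (d (i + 1))) ∧
    (∀ (Q : ModuleCat.{u} R), IsCProjective R C Q →
      ∀ (i : ℤ) (g : X (i + 1) →ₗ[R] Q), g.comp (d i) = 0 →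
        ∃ h : X (i + 1 + 1) →ₗ[R] Q, h.comp (d (i + 1)) = g) ∧
    ∃ π : X 0 →ₗ[R] N, Function.Surjective π ∧ Function.Exact (d (-1)) π

/-- `N` is `G_C`-flat: the cokernel of the degree `0` differential of a complete
`F_C F`-resolution. -/
def IsGCFlat (C : Type u) [AddCommGroup C] [Module R C]
    (N : Type u) [AddCommGroup N] [Module R N] : Prop :=
  ∃ (Z : ℤ → ModuleCat.{u} R) (d : ∀ i : ℤ, Z i →ₗ[R] Z (i + 1)),
    (∀ i : ℤ, i ≤ 0 → Module.Flat R (Z i)) ∧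
    (∀ i : ℤ, 0 < i → IsCFlat R C (Z i)) ∧
    (∀ i, Function.Exact (d i) (d (i + 1))) ∧
    (∀ (J : ModuleCat.{u} R), IsCInjective R C J →
      ∀ i : ℤ, Function.Exact (LinearMap.rTensor (R := R) J (d i))
        (LinearMap.rTensor (R := R) J (d (i + 1)))) ∧
    ∃ π : Z 0 →ₗ[R] N, Function.Surjective π ∧ Function.Exact (d (-1)) π

/-- `G_C`-injective dimension `Gid_C M`. -/
noncomputable def GCinjDim (C : Type u) [AddCommGroup C] [Module R C]
    (M : Type u) [AddCommGroup M] [Module R M] : ℕ∞ :=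
  CoresDim R (fun N => IsGCInjective R C N) (ModuleCat.of R M)

/-- `G_C`-projective dimension `G_C-pd_R M`. -/
noncomputable def GCprojDim (C : Type u) [AddCommGroup C] [Module R C]
    (M : Type u) [AddCommGroup M] [Module R M] : ℕ∞ :=
  ResDim R (fun N => IsGCProjective R C N) (ModuleCat.of R M)

/-- `G_C`-flat dimension `G_C-fd_R M`. -/
noncomputable def GCflatDim (C : Type u) [AddCommGroup C] [Module R C]
    (M : Type u) [AddCommGroup M] [Module R M] : ℕ∞ :=
  ResDim R (fun N => IsGCFlat R C N) (ModuleCat.of R M)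

end Paper

set_option linter.all false



namespace GGo

/-! ### Short exact sequences and Ext in module language -/

variable {R : Type u} [CommRing R]

/-- short exactness of a pair of linear maps -/
structure SE {A B C : ModuleCat.{u} R} (f : A →ₗ[R] B) (g : B →ₗ[R] C) : Prop where
  inj : Function.Injective f
  ex : Function.Exact f g
  surj : Function.Surjective g

abbrev EX (X Y : ModuleCat.{u} R) (n : ℕ) := Abelian.Ext X Y n

/-- vanishing of Ext -/
def V (X Y : ModuleCat.{u} R) (n : ℕ) : Prop := ∀ e : EX X Y n, e = 0

noncomputable def pre {X X' : ModuleCat.{u} R} (f : X' →ₗ[R] X) {Y : ModuleCat.{u} R} {n : ℕ} :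
    EX X Y n →ₗ[R] EX X' Y n where
  toFun e := (Abelian.Ext.mk₀ (ModuleCat.ofHom f)).comp e (zero_add n)
  map_add' := by intros; simp
  map_smul' := by intros; simp

noncomputable def post {Y Y' : ModuleCat.{u} R} (f : Y →ₗ[R] Y') {X : ModuleCat.{u} R} {n : ℕ} :
    EX X Y n →ₗ[R] EX X Y' n where
  toFun e := e.comp (Abelian.Ext.mk₀ (ModuleCat.ofHom f)) (add_zero n)
  map_add' := by intros; simp
  map_smul' := by intros; simp

section
variable {A B C : ModuleCat.{u} R} {f : A →ₗ[R] B} {g : B →ₗ[R] C}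

/-- the associated short complex -/
def SE.sc (h : SE f g) : ShortComplex (ModuleCat.{u} R) :=
  ShortComplex.mk (ModuleCat.ofHom f) (ModuleCat.ofHom g) (by
    ext x; exact (h.ex _).2 ⟨x, rfl⟩)

lemma SE.se (h : SE f g) : h.sc.ShortExact := by
  have : Mono h.sc.f := (ModuleCat.mono_iff_injective _).2 h.inj
  have : Epi h.sc.g := (ModuleCat.epi_iff_surjective _).2 h.surj
  exact ShortComplex.ShortExact.mk
    ((ShortComplex.ShortExact.moduleCat_exact_iff_function_exact _).2 h.ex)

/-- the extension class -/
noncomputable def SE.cls (h : SE f g) : EX C A 1 := h.se.extClass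

/-- contravariant connecting map -/
noncomputable def SE.d (h : SE f g) {Y : ModuleCat.{u} R} {n : ℕ} :
    EX A Y n →ₗ[R] EX C Y (n + 1) where
  toFun e := Abelian.Ext.comp h.cls e (add_comm 1 n)
  map_add' := by intros; simp
  map_smul' := by intros; simp

/-- covariant connecting map -/
noncomputable def SE.cd (h : SE f g) {X : ModuleCat.{u} R} {n : ℕ} :
    EX X C n →ₗ[R] EX X A (n + 1) where
  toFun e := Abelian.Ext.comp e h.cls rfl
  map_add' := by intros; simp
  map_smul' := by intros; simp

lemma SE.ctr1 (h : SE f g) {Y : ModuleCat.{u} R} {n : ℕ} (e : EX A Y n) (he : h.d e = 0) :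
    ∃ b : EX B Y n, pre f b = e :=
  Abelian.Ext.contravariant_sequence_exact₁ h.se Y e (add_comm 1 n) he

lemma SE.ctr2 (h : SE f g) {Y : ModuleCat.{u} R} {n : ℕ} (e : EX B Y n) (he : pre f e = 0) :
    ∃ b : EX C Y n, pre g b = e :=
  Abelian.Ext.contravariant_sequence_exact₂ h.se Y e he

lemma SE.ctr3 (h : SE f g) {Y : ModuleCat.{u} R} {n : ℕ} (e : EX C Y (n + 1)) (he : pre g e = 0) :
    ∃ b : EX A Y n, h.d b = e :=
  Abelian.Ext.contravariant_sequence_exact₃ h.se Y e he (add_comm 1 n)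

lemma SE.cov1 (h : SE f g) {X : ModuleCat.{u} R} {n : ℕ} (e : EX X A (n + 1)) (he : post f e = 0) :
    ∃ b : EX X C n, h.cd b = e :=
  Abelian.Ext.covariant_sequence_exact₁ X h.se e he rfl

lemma SE.cov2 (h : SE f g) {X : ModuleCat.{u} R} {n : ℕ} (e : EX X B n) (he : post g e = 0) :
    ∃ b : EX X A n, post f b = e :=
  Abelian.Ext.covariant_sequence_exact₂ X h.se e he

lemma SE.cov3 (h : SE f g) {X : ModuleCat.{u} R} {n : ℕ} (e : EX X C n) (he : h.cd e = 0) :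
    ∃ b : EX X B n, post g b = e :=
  Abelian.Ext.covariant_sequence_exact₃ X h.se e rfl he

lemma SE.d_pre (h : SE f g) {Y : ModuleCat.{u} R} {n : ℕ} (e : EX B Y n) :
    h.d (pre f e) = 0 :=
  h.se.extClass_comp_assoc (h := add_comm 1 n) _

lemma SE.pre_d (h : SE f g) {Y : ModuleCat.{u} R} {n : ℕ} (e : EX A Y n) :
    pre g (h.d e) = 0 :=
  h.se.comp_extClass_assoc _ (add_comm 1 n)

lemma pre_post {X X' Y Y' : ModuleCat.{u} R} {n : ℕ} (a : X' →ₗ[R] X) (b : Y →ₗ[R] Y')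
    (e : EX X Y n) : pre a (post b e) = post b (pre a e) := by
  simp only [pre, post, LinearMap.coe_mk, AddHom.coe_mk]
  rw [Abelian.Ext.comp_assoc_of_third_deg_zero]

lemma SE.d_post (h : SE f g) {Y Y' : ModuleCat.{u} R} {n : ℕ} (a : Y →ₗ[R] Y') (e : EX A Y n) :
    h.d (post a e) = post a (h.d e) := by
  simp only [SE.d, post, LinearMap.coe_mk, AddHom.coe_mk]
  rw [Abelian.Ext.comp_assoc_of_third_deg_zero]

lemma SE.pre_cd (h : SE f g) {X X' : ModuleCat.{u} R} {n : ℕ} (a : X' →ₗ[R] X) (e : EX X C n) :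
    pre a (h.cd e) = h.cd (pre a e) := by
  simp only [SE.cd, pre, LinearMap.coe_mk, AddHom.coe_mk]
  rw [Abelian.Ext.comp_assoc _ _ _ (zero_add n) rfl (by omega)]

lemma SE.cd_post (h : SE f g) {X : ModuleCat.{u} R} {n : ℕ} (e : EX X B n) :
    h.cd (post g e) = 0 := by
  simp only [SE.cd, post, LinearMap.coe_mk, AddHom.coe_mk]
  rw [Abelian.Ext.comp_assoc_of_second_deg_zero]
  have : Abelian.Ext.comp (Abelian.Ext.mk₀ (ModuleCat.ofHom g)) h.cls (zero_add 1) = 0 :=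
    h.se.comp_extClass
  rw [this, Abelian.Ext.comp_zero]

lemma SE.post_cd (h : SE f g) {X : ModuleCat.{u} R} {n : ℕ} (e : EX X C n) :
    post f (h.cd e) = 0 := by
  simp only [SE.cd, post, LinearMap.coe_mk, AddHom.coe_mk]
  rw [Abelian.Ext.comp_assoc_of_third_deg_zero]
  have : Abelian.Ext.comp h.cls (Abelian.Ext.mk₀ (ModuleCat.ofHom f)) (add_zero 1) = 0 :=
    h.se.extClass_comp
  rw [this, Abelian.Ext.comp_zero]

lemma pre_comp {X X' X'' Y : ModuleCat.{u} R} {n : ℕ} (a : X' →ₗ[R] X) (b : X'' →ₗ[R] X')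
    (e : EX X Y n) : pre (a ∘ₗ b) e = pre b (pre a e) := by
  simp only [pre, LinearMap.coe_mk, AddHom.coe_mk]
  rw [Abelian.Ext.mk₀_comp_mk₀_assoc]; rfl

lemma post_comp {X Y Y' Y'' : ModuleCat.{u} R} {n : ℕ} (a : Y →ₗ[R] Y') (b : Y' →ₗ[R] Y'')
    (e : EX X Y n) : post (b ∘ₗ a) e = post b (post a e) := by
  simp only [post, LinearMap.coe_mk, AddHom.coe_mk]
  rw [Abelian.Ext.comp_assoc_of_third_deg_zero, Abelian.Ext.mk₀_comp_mk₀]; rfl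

lemma pre_id {X Y : ModuleCat.{u} R} {n : ℕ} (e : EX X Y n) : pre LinearMap.id e = e := by
  simp only [pre, LinearMap.coe_mk, AddHom.coe_mk]
  exact Abelian.Ext.mk₀_id_comp e

lemma post_id {X Y : ModuleCat.{u} R} {n : ℕ} (e : EX X Y n) : post LinearMap.id e = e := by
  simp only [post, LinearMap.coe_mk, AddHom.coe_mk]
  exact Abelian.Ext.comp_mk₀_id e

lemma pre_add {X X' Y : ModuleCat.{u} R} {n : ℕ} (a b : X' →ₗ[R] X) (e : EX X Y n) :
    pre (a + b) e = pre a e + pre b e := by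
  simp only [pre, LinearMap.coe_mk, AddHom.coe_mk]
  rw [← Abelian.Ext.add_comp, ← Abelian.Ext.mk₀_add]; rfl

lemma post_add {X Y Y' : ModuleCat.{u} R} {n : ℕ} (a b : Y →ₗ[R] Y') (e : EX X Y n) :
    post (a + b) e = post a e + post b e := by
  simp only [post, LinearMap.coe_mk, AddHom.coe_mk]
  rw [← Abelian.Ext.comp_add, ← Abelian.Ext.mk₀_add]; rfl

lemma pre_smul {X X' Y : ModuleCat.{u} R} {n : ℕ} (r : R) (a : X' →ₗ[R] X) (e : EX X Y n) :
    pre (r • a) e = r • pre a e := by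
  simp only [pre, LinearMap.coe_mk, AddHom.coe_mk]
  rw [← Abelian.Ext.smul_comp, ← Abelian.Ext.mk₀_smul]; rfl

lemma post_smul {X Y Y' : ModuleCat.{u} R} {n : ℕ} (r : R) (a : Y →ₗ[R] Y') (e : EX X Y n) :
    post (r • a) e = r • post a e := by
  simp only [post, LinearMap.coe_mk, AddHom.coe_mk]
  rw [← Abelian.Ext.comp_smul, ← Abelian.Ext.mk₀_smul]; rfl

lemma pre_zero {X X' Y : ModuleCat.{u} R} {n : ℕ} (e : EX X Y n) :
    pre (0 : X' →ₗ[R] X) e = 0 := by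
  have := pre_smul (0 : R) (0 : X' →ₗ[R] X) e
  simpa using this

lemma post_zero {X Y Y' : ModuleCat.{u} R} {n : ℕ} (e : EX X Y n) :
    post (0 : Y →ₗ[R] Y') e = 0 := by
  have := post_smul (0 : R) (0 : Y →ₗ[R] Y') e
  simpa using this

/-- degree zero -/
noncomputable def m0 {X Y : ModuleCat.{u} R} : (X →ₗ[R] Y) ≃ₗ[R] EX X Y 0 :=
  (ModuleCat.homLinearEquiv (S := R)).symm ≪≫ₗ (Abelian.Ext.linearEquiv₀ (R := R)).symm

lemma m0_eq {X Y : ModuleCat.{u} R} (f : X →ₗ[R] Y) :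
    m0 f = Abelian.Ext.mk₀ (ModuleCat.ofHom f) := by
  simp [m0]; rfl

lemma pre_m0 {X X' Y : ModuleCat.{u} R} (a : X' →ₗ[R] X) (b : X →ₗ[R] Y) :
    pre a (m0 b) = m0 (b ∘ₗ a) := by
  simp only [pre, m0_eq, LinearMap.coe_mk, AddHom.coe_mk]
  rw [Abelian.Ext.mk₀_comp_mk₀]; rfl

lemma post_m0 {X Y Y' : ModuleCat.{u} R} (a : Y →ₗ[R] Y') (b : X →ₗ[R] Y) :
    post a (m0 b) = m0 (a ∘ₗ b) := by
  simp only [post, m0_eq, LinearMap.coe_mk, AddHom.coe_mk]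
  rw [Abelian.Ext.mk₀_comp_mk₀]; rfl

end

end GGo


namespace GGo
variable {R : Type u} [CommRing R]

section vanish
variable {A B C X Y : ModuleCat.{u} R} {f : A →ₗ[R] B} {g : B →ₗ[R] C} {n : ℕ}

lemma SE.V_mid (h : SE f g) (h1 : V A Y n) (h2 : V C Y n) : V B Y n := fun e => by
  obtain ⟨c, rfl⟩ := h.ctr2 e (h1 _)
  rw [h2 c, map_zero]

lemma SE.V_left (h : SE f g) (h1 : V B Y n) (h2 : V C Y (n + 1)) : V A Y n := fun e => by
  obtain ⟨c, rfl⟩ := h.ctr1 e (h2 _)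
  rw [h1 c, map_zero]

lemma SE.V_right (h : SE f g) (h1 : V A Y n) (h2 : V B Y (n + 1)) : V C Y (n + 1) := fun e => by
  obtain ⟨c, rfl⟩ := h.ctr3 e (h2 _)
  rw [h1 c, map_zero]

lemma SE.cV_mid (h : SE f g) (h1 : V X A n) (h2 : V X C n) : V X B n := fun e => by
  obtain ⟨c, rfl⟩ := h.cov2 e (h2 _)
  rw [h1 c, map_zero]

lemma SE.cV_left (h : SE f g) (h1 : V X C n) (h2 : V X B (n + 1)) : V X A (n + 1) := fun e => by
  obtain ⟨c, rfl⟩ := h.cov1 e (h2 _)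
  rw [h1 c, map_zero]

lemma SE.cV_right (h : SE f g) (h1 : V X B n) (h2 : V X A (n + 1)) : V X C n := fun e => by
  obtain ⟨c, rfl⟩ := h.cov3 e (h2 _)
  rw [h1 c, map_zero]

lemma V_proj [hX : Module.Projective R X] : V X Y (n + 1) := fun e => by
  have : CategoryTheory.Projective X := (IsProjective.iff_projective _).1 hX
  exact Abelian.Ext.eq_zero_of_projective e

lemma inj_cat [hY : Module.Injective R Y] : CategoryTheory.Injective Y := by
  have := Module.injective_object_of_injective_module R Y
  exact this

lemma V_inj [hY : Module.Injective R Y] : V X Y (n + 1) := fun e => by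
  have : CategoryTheory.Injective Y := inj_cat
  exact Abelian.Ext.eq_zero_of_injective e

lemma V_zero_iff : V X Y 0 ↔ ∀ a : X →ₗ[R] Y, a = 0 := by
  constructor
  · intro h a
    have := h (m0 a)
    simpa using this
  · intro h e
    obtain ⟨a, rfl⟩ := m0.surjective e
    rw [h a, map_zero]

lemma V_retract {X' : ModuleCat.{u} R} (s : X' →ₗ[R] X) (r : X →ₗ[R] X') (h : r ∘ₗ s = LinearMap.id)
    (hV : V X Y n) : V X' Y n := fun e => by
  rw [← pre_id e, ← h, pre_comp, hV (pre r e), map_zero]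

lemma cV_retract {Y' : ModuleCat.{u} R} (s : Y' →ₗ[R] Y) (r : Y →ₗ[R] Y') (h : r ∘ₗ s = LinearMap.id)
    (hV : V X Y n) : V X Y' n := fun e => by
  rw [← post_id e, ← h, post_comp, hV (post s e), map_zero]

lemma V_iso {X' : ModuleCat.{u} R} (s : X' ≃ₗ[R] X) (hV : V X Y n) : V X' Y n :=
  V_retract s.toLinearMap s.symm.toLinearMap (by ext; simp) hV

lemma cV_iso {Y' : ModuleCat.{u} R} (s : Y' ≃ₗ[R] Y) (hV : V X Y n) : V X Y' n :=
  cV_retract s.toLinearMap s.symm.toLinearMap (by ext; simp) hV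

lemma SE.extend (h : SE f g) (hV : V C Y 1) (a : A →ₗ[R] Y) : ∃ b : B →ₗ[R] Y, b ∘ₗ f = a := by
  obtain ⟨b, hb⟩ := h.ctr1 (m0 a) (hV _)
  obtain ⟨b, rfl⟩ := m0.surjective b
  rw [pre_m0] at hb
  exact ⟨b, m0.injective hb⟩

lemma SE.lift (h : SE f g) (hV : V X A 1) (a : X →ₗ[R] C) : ∃ b : X →ₗ[R] B, g ∘ₗ b = a := by
  obtain ⟨b, hb⟩ := h.cov3 (m0 a) (hV _)
  obtain ⟨b, rfl⟩ := m0.surjective b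
  rw [post_m0] at hb
  exact ⟨b, m0.injective hb⟩

/-- converse : if every map extends and the middle term has no Ext, then Ext¹ vanishes -/
lemma SE.V_of_extend (h : SE f g) (hB : V B Y 1)
    (hx : ∀ a : A →ₗ[R] Y, ∃ b : B →ₗ[R] Y, b ∘ₗ f = a) : V C Y 1 := fun e => by
  obtain ⟨c, rfl⟩ := h.ctr3 e (hB _)
  obtain ⟨a, rfl⟩ := m0.surjective c
  obtain ⟨b, rfl⟩ := hx a
  rw [← pre_m0, h.d_pre]

end vanish

section constr
variable {A B C A' A'' B' D X Y : ModuleCat.{u} R}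

lemma SE.ofSurj (g : B →ₗ[R] C) (hg : Function.Surjective g) :
    SE (A := ModuleCat.of R (LinearMap.ker g)) (LinearMap.ker g).subtype g :=
  ⟨Subtype.val_injective, by intro x; simp, hg⟩

lemma SE.ofInj (f : A →ₗ[R] B) (hf : Function.Injective f) :
    SE (C := ModuleCat.of R (B ⧸ LinearMap.range f)) f (LinearMap.range f).mkQ :=
  ⟨hf, by intro x; simp, Submodule.mkQ_surjective _⟩

lemma SE.ofSub (N : Submodule R B) :
    SE (A := ModuleCat.of R N) (C := ModuleCat.of R (B ⧸ N)) N.subtype N.mkQ :=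
  ⟨Subtype.val_injective, by intro x; simp, Submodule.mkQ_surjective _⟩

lemma SE.gf {f : A →ₗ[R] B} {g : B →ₗ[R] C} (h : SE f g) (a : A) : g (f a) = 0 :=
  (h.ex _).2 ⟨a, rfl⟩

lemma SE.gfc {f : A →ₗ[R] B} {g : B →ₗ[R] C} (h : SE f g) : g ∘ₗ f = 0 := by
  ext a; exact h.gf a

lemma exists_proj (X : ModuleCat.{u} R) : ∃ (K P : ModuleCat.{u} R) (f : K →ₗ[R] P) (g : P →ₗ[R] X),
    Module.Projective R P ∧ SE f g :=
  ⟨_, ModuleCat.of R (X →₀ R), _, Finsupp.linearCombination R (id : X → X),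
    (inferInstance : Module.Projective R (X →₀ R)), SE.ofSurj _ (Finsupp.linearCombination_id_surjective R X)⟩

lemma exists_inj (X : ModuleCat.{u} R) : ∃ (I C : ModuleCat.{u} R) (f : X →ₗ[R] I) (g : I →ₗ[R] C),
    Module.Injective R I ∧ SE f g := by
  let f := CategoryTheory.Injective.ι X
  have hf : Function.Injective f.hom := (ModuleCat.mono_iff_injective f).1 inferInstance
  refine ⟨CategoryTheory.Injective.under X, _, f.hom, _, ?_, SE.ofInj _ hf⟩
  have hh := CategoryTheory.Injective.injective_under X
  generalize CategoryTheory.Injective.under X = I at hh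
  have : CategoryTheory.Injective (ModuleCat.of R I) := hh
  exact Module.injective_module_of_injective_object R I

/-- zero module -/
abbrev Z0 : ModuleCat.{u} R := ModuleCat.of R PUnit.{u+1}

lemma SE.ofIso (e : A ≃ₗ[R] B) : SE (C := Z0) e.toLinearMap (0 : B →ₗ[R] PUnit.{u+1}) :=
  ⟨e.injective, by intro x; simp, fun x => ⟨0, rfl⟩⟩

lemma SE.ofIso' (e : A ≃ₗ[R] B) : SE (A := Z0) (0 : PUnit.{u+1} →ₗ[R] A) e.toLinearMap :=
  ⟨fun x y _ => rfl, by intro x; simp; exact eq_comm, e.surjective⟩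

lemma SE.prod : SE (A := X) (B := ModuleCat.of R (X × Y)) (C := Y)
    (LinearMap.inl R X Y) (LinearMap.snd R X Y) :=
  ⟨LinearMap.inl_injective, by rintro ⟨a, b⟩; simp [eq_comm], LinearMap.snd_surjective⟩

lemma SE.prod' : SE (A := Y) (B := ModuleCat.of R (X × Y)) (C := X)
    (LinearMap.inr R X Y) (LinearMap.fst R X Y) :=
  ⟨LinearMap.inr_injective, by rintro ⟨a, b⟩; simp [eq_comm], LinearMap.fst_surjective⟩

/-- a split sequence can be reversed -/
lemma SE.rev {f : A →ₗ[R] B} {g : B →ₗ[R] C} (h : SE f g) (s : C →ₗ[R] B)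
    (hs : g ∘ₗ s = LinearMap.id) : ∃ r : B →ₗ[R] A, SE s r := by
  have hs' : ∀ c, g (s c) = c := fun c => LinearMap.congr_fun hs c
  let t : B →ₗ[R] B := LinearMap.id - s ∘ₗ g
  have ht : ∀ b, t b ∈ LinearMap.range f := fun b => by
    have : g (t b) = 0 := by simp [t, hs']
    exact (h.ex _).1 this
  let e := LinearEquiv.ofInjective f h.inj
  let r : B →ₗ[R] A := e.symm.toLinearMap ∘ₗ t.codRestrict _ ht
  have hr : ∀ b, f (r b) = t b := fun b => by
    have := e.apply_symm_apply (t.codRestrict _ ht b)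
    exact congrArg Subtype.val this
  refine ⟨r, fun x y hxy => by rw [← hs' x, ← hs' y, hxy], ?_, ?_⟩
  · intro b
    constructor
    · intro hb
      have h1 := hr b
      rw [hb, map_zero] at h1
      refine ⟨g b, ?_⟩
      simp [t] at h1
      exact (sub_eq_zero.1 h1.symm).symm
    · rintro ⟨c, rfl⟩
      apply h.inj
      rw [hr, map_zero]
      simp [t, hs']
  · intro a
    refine ⟨f a, h.inj ?_⟩
    rw [hr]
    simp [t, h.gf]

lemma SE.S1 {f : A →ₗ[R] B} {g : B →ₗ[R] C} {i : B →ₗ[R] X} {p : X →ₗ[R] D}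
    (h : SE f g) (h' : SE i p) : ∃ (C' : ModuleCat.{u} R) (a : X →ₗ[R] C') (b : C →ₗ[R] C')
      (c : C' →ₗ[R] D), SE (i ∘ₗ f) a ∧ SE b c ∧ c ∘ₗ a = p ∧ b ∘ₗ g = a ∘ₗ i := by
  have hq := SE.ofInj (i ∘ₗ f) (h'.inj.comp h.inj)
  let a : X →ₗ[R] _ := (LinearMap.range (i ∘ₗ f)).mkQ
  have h0 : ∀ x, a (i (f x)) = 0 := fun x => hq.gf x
  obtain ⟨b, hb⟩ : ∃ b : C →ₗ[R] (X ⧸ (LinearMap.range (i ∘ₗ f))), b ∘ₗ g = a ∘ₗ i := by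
    let e := h.ex.linearEquivOfSurjective h.surj
    refine ⟨((LinearMap.range f).liftQ (a ∘ₗ i) (by rintro _ ⟨x, rfl⟩; simpa using h0 x)) ∘ₗ
      e.symm.toLinearMap, ?_⟩
    ext x
    have : e.symm (g x) = (LinearMap.range f).mkQ x := by
      rw [LinearEquiv.symm_apply_eq]; rfl
    simp [this]
  have hb' : ∀ x, b (g x) = a (i x) := fun x => LinearMap.congr_fun hb x
  let c := (LinearMap.range (i ∘ₗ f)).liftQ p (by rintro _ ⟨x, rfl⟩; simpa using h'.gf (f x))
  have hc : ∀ x, c (a x) = p x := fun x => by simp [c, a]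
  have hs : Function.Surjective a := Submodule.mkQ_surjective _
  refine ⟨ModuleCat.of R (X ⧸ (LinearMap.range (i ∘ₗ f))), a, b, c, hq, ⟨?_, ?_, ?_⟩,
    LinearMap.ext hc, hb⟩
  · rw [injective_iff_map_eq_zero]
    intro y hy
    obtain ⟨y, rfl⟩ := h.surj y
    rw [hb'] at hy
    obtain ⟨z, hz⟩ := (hq.ex _).1 hy
    have : f z = y := h'.inj hz
    rw [← this, h.gf]
  · intro y
    obtain ⟨x, rfl⟩ := hs y
    rw [hc]
    constructor
    · intro hx
      obtain ⟨z, rfl⟩ := (h'.ex _).1 hx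
      exact ⟨g z, hb' z⟩
    · rintro ⟨w, hw⟩
      obtain ⟨w, rfl⟩ := h.surj w
      rw [hb'] at hw
      rw [← hc, ← hw, hc, h'.gf]
  · intro d
    obtain ⟨x, rfl⟩ := h'.surj d
    exact ⟨a x, hc x⟩

lemma SE.S1' {k : A →ₗ[R] X} {p : X →ₗ[R] B} {j : A' →ₗ[R] B} {q : B →ₗ[R] C}
    (h : SE k p) (h' : SE j q) : ∃ (X' : ModuleCat.{u} R) (a : X' →ₗ[R] X) (b : A →ₗ[R] X')
      (c : X' →ₗ[R] A'), SE a (q ∘ₗ p) ∧ SE b c ∧ a ∘ₗ b = k ∧ j ∘ₗ c = p ∘ₗ a := by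
  have hq := SE.ofSurj (q ∘ₗ p) (h'.surj.comp h.surj)
  let e := LinearEquiv.ofInjective j h'.inj
  let b : A →ₗ[R] LinearMap.ker (q ∘ₗ p) := k.codRestrict _ (fun x => by simp [h.gf])
  let c : LinearMap.ker (q ∘ₗ p) →ₗ[R] A' := e.symm.toLinearMap ∘ₗ
    (p ∘ₗ (LinearMap.ker (q ∘ₗ p)).subtype).codRestrict (LinearMap.range j)
      (fun x => (h'.ex _).1 x.2)
  have hc : ∀ x, j (c x) = p x.1 := fun x => by
    have := e.apply_symm_apply ((p ∘ₗ (LinearMap.ker (q ∘ₗ p)).subtype).codRestrict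
      (LinearMap.range j) (fun x => (h'.ex _).1 x.2) x)
    exact congrArg Subtype.val this
  refine ⟨ModuleCat.of R (LinearMap.ker (q ∘ₗ p)), (LinearMap.ker (q ∘ₗ p)).subtype, b, c, hq,
    ⟨?_, ?_, ?_⟩, rfl, LinearMap.ext hc⟩
  · intro x y hxy
    exact h.inj (congrArg Subtype.val hxy)
  · intro x
    constructor
    · intro hx
      have h1 := hc x
      rw [hx, map_zero] at h1
      obtain ⟨z, hz⟩ := (h.ex _).1 h1.symm
      exact ⟨z, Subtype.ext hz⟩
    · rintro ⟨z, rfl⟩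
      apply h'.inj
      rw [hc, map_zero]
      exact h.gf z
  · intro y
    obtain ⟨x, hx⟩ := h.surj (j y)
    refine ⟨⟨x, ?_⟩, h'.inj ?_⟩
    · simp [hx, h'.gf]
    · rw [hc]; exact hx

/-- pullback -/
lemma SE.S3 {f : A →ₗ[R] B} {g : B →ₗ[R] C} {f' : A' →ₗ[R] B'} {g' : B' →ₗ[R] C}
    (h : SE f g) (h' : SE f' g') : ∃ (P : ModuleCat.{u} R) (a : A →ₗ[R] P) (b : P →ₗ[R] B')
      (a' : A' →ₗ[R] P) (b' : P →ₗ[R] B), SE a b ∧ SE a' b' ∧ b' ∘ₗ a = f ∧ b ∘ₗ a' = f' ∧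
        g ∘ₗ b' = g' ∘ₗ b := by
  let S : Submodule R (B × B') := LinearMap.ker (g ∘ₗ LinearMap.fst R B B' - g' ∘ₗ LinearMap.snd R B B')
  have hS : ∀ x, x ∈ S ↔ g x.1 = g' x.2 := fun x => by simp [S, sub_eq_zero]
  let b : S →ₗ[R] B' := LinearMap.snd R B B' ∘ₗ S.subtype
  let b' : S →ₗ[R] B := LinearMap.fst R B B' ∘ₗ S.subtype
  let a : A →ₗ[R] S := (LinearMap.inl R B B' ∘ₗ f).codRestrict _ (fun x => by simp [hS, h.gf])
  let a' : A' →ₗ[R] S := (LinearMap.inr R B B' ∘ₗ f').codRestrict _ (fun x => by simp [hS, h'.gf])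
  refine ⟨ModuleCat.of R S, a, b, a', b', ⟨?_, ?_, ?_⟩, ⟨?_, ?_, ?_⟩, rfl, rfl, ?_⟩
  · intro x y hxy
    exact h.inj (congrArg (fun z => z.1.1) hxy)
  · rintro ⟨⟨x, y⟩, hxy⟩
    constructor
    · intro hy
      have hy : y = 0 := hy
      subst hy
      rw [hS] at hxy
      obtain ⟨z, hz⟩ := (h.ex x).1 (by simpa using hxy)
      exact ⟨z, Subtype.ext (Prod.ext hz rfl)⟩
    · rintro ⟨z, hz⟩
      rw [← hz]; rfl
  · intro y
    obtain ⟨x, hx⟩ := h.surj (g' y)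
    exact ⟨⟨(x, y), (hS _).2 hx⟩, rfl⟩
  · intro x y hxy
    exact h'.inj (congrArg (fun z => z.1.2) hxy)
  · rintro ⟨⟨y, x⟩, hxy⟩
    constructor
    · intro hy
      have hy : y = 0 := hy
      subst hy
      rw [hS] at hxy
      obtain ⟨z, hz⟩ := (h'.ex x).1 (by simpa using hxy.symm)
      exact ⟨z, Subtype.ext (Prod.ext rfl hz)⟩
    · rintro ⟨z, hz⟩
      rw [← hz]; rfl
  · intro y
    obtain ⟨x, hx⟩ := h'.surj (g y)
    exact ⟨⟨(y, x), (hS _).2 hx.symm⟩, rfl⟩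
  · ext x
    exact (hS x.1).1 x.2

/-- pushout -/
lemma SE.S4 {f : A →ₗ[R] B} {g : B →ₗ[R] C} {i : A →ₗ[R] A'} {p : A' →ₗ[R] A''}
    (h : SE f g) (h' : SE i p) : ∃ (P : ModuleCat.{u} R) (a : A' →ₗ[R] P) (b : P →ₗ[R] C)
      (a' : B →ₗ[R] P) (b' : P →ₗ[R] A''), SE a b ∧ SE a' b' ∧ b ∘ₗ a' = g ∧ b' ∘ₗ a = p ∧
        a ∘ₗ i = a' ∘ₗ f := by
  let S : Submodule R (A' × B) := LinearMap.range (LinearMap.prod i (-f))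
  have hS : ∀ x, x ∈ S ↔ ∃ z, i z = x.1 ∧ - f z = x.2 := fun x => by
    simp [S, Prod.ext_iff]
  let a : A' →ₗ[R] ((A' × B) ⧸ S) := S.mkQ ∘ₗ LinearMap.inl R A' B
  let a' : B →ₗ[R] ((A' × B) ⧸ S) := S.mkQ ∘ₗ LinearMap.inr R A' B
  let b : ((A' × B) ⧸ S) →ₗ[R] C := S.liftQ (g ∘ₗ LinearMap.snd R A' B) (by
    rintro _ ⟨z, rfl⟩; simp [h.gf])
  let b' : ((A' × B) ⧸ S) →ₗ[R] A'' := S.liftQ (p ∘ₗ LinearMap.fst R A' B) (by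
    rintro _ ⟨z, rfl⟩; simp [h'.gf])
  have hq : ∀ x, S.mkQ x = 0 ↔ x ∈ S := fun x => by simp
  have hab : ∀ x y, S.mkQ (x, y) = a x + a' y := fun x y => by
    simp only [a, a', LinearMap.comp_apply, ← map_add]; simp
  have hsq : ∀ z, a (i z) = a' (f z) := fun z => by
    rw [← sub_eq_zero]
    simp only [a, a', LinearMap.comp_apply, ← map_sub]
    rw [hq, hS]; exact ⟨z, by simp⟩
  have hb : ∀ x y, b (a x + a' y) = g y := fun x y => by rw [← hab]; simp [b]
  have hb' : ∀ x y, b' (a x + a' y) = p x := fun x y => by rw [← hab]; simp [b']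
  have hsurj : ∀ w, ∃ x y, w = a x + a' y := fun w => by
    obtain ⟨⟨x, y⟩, rfl⟩ := S.mkQ_surjective w
    exact ⟨x, y, hab x y⟩
  refine ⟨ModuleCat.of R _, a, b, a', b', ⟨?_, ?_, ?_⟩, ⟨?_, ?_, ?_⟩, ?_, ?_, LinearMap.ext hsq⟩
  · rw [injective_iff_map_eq_zero]
    intro x hx
    obtain ⟨z, h1, h2⟩ := (hS _).1 ((hq _).1 hx)
    have : f z = 0 := by simpa using h2
    have hz : z = 0 := h.inj (by simpa using this)
    subst hz
    simpa using h1.symm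
  · intro w
    obtain ⟨x, y, rfl⟩ := hsurj w
    rw [hb]
    constructor
    · intro hy
      obtain ⟨z, rfl⟩ := (h.ex _).1 hy
      exact ⟨x + i z, by rw [map_add, hsq]⟩
    · rintro ⟨v, hv⟩
      rw [← hb x y, ← hv]
      simpa using hb v 0
  · intro c
    obtain ⟨y, rfl⟩ := h.surj c
    exact ⟨a' y, by simpa using hb 0 y⟩
  · rw [injective_iff_map_eq_zero]
    intro x hx
    obtain ⟨z, h1, h2⟩ := (hS _).1 ((hq _).1 hx)
    have hz : z = 0 := h'.inj (by simpa using h1)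
    subst hz
    simpa using h2.symm
  · intro w
    obtain ⟨x, y, rfl⟩ := hsurj w
    rw [hb']
    constructor
    · intro hy
      obtain ⟨z, rfl⟩ := (h'.ex _).1 hy
      exact ⟨f z + y, by rw [map_add, hsq]⟩
    · rintro ⟨v, hv⟩
      rw [← hb' x y, ← hv]
      simpa using hb' 0 v
  · intro c
    obtain ⟨y, rfl⟩ := h'.surj c
    exact ⟨a y, by simpa using hb' y 0⟩
  · ext y; simpa using hb 0 y
  · ext x; simpa using hb' x 0

/-- horseshoe for embeddings -/
lemma SE.S2 {f : A →ₗ[R] X} {g : X →ₗ[R] B} (h : SE f g) {W1 W2 : ModuleCat.{u} R}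
    {i : A →ₗ[R] W1} {p : W1 →ₗ[R] A'} (h1 : SE i p) {j : B →ₗ[R] W2} {q : W2 →ₗ[R] B'}
    (h2 : SE j q) (al : X →ₗ[R] W1) (hal : al ∘ₗ f = i) :
    ∃ (C : ModuleCat.{u} R) (s : X →ₗ[R] (W1 × W2)) (t : (W1 × W2) →ₗ[R] C) (b : A' →ₗ[R] C)
      (c : C →ₗ[R] B'), SE (B := ModuleCat.of R (W1 × W2)) s t ∧ SE b c := by
  obtain ⟨P, a, b, a', b', e1, e2, h3, h4, h5⟩ := h.S4 h1
  -- the map P → W1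
  have hal' : ∀ x, al (f x) = i x := fun x => LinearMap.congr_fun hal x
  have h5' : ∀ x, a (i x) = a' (f x) := fun x => LinearMap.congr_fun h5 x
  have h3' : ∀ x, b (a' x) = g x := fun x => LinearMap.congr_fun h3 x
  have h4' : ∀ x, b' (a x) = p x := fun x => LinearMap.congr_fun h4 x
  -- X → W1 × B, with the same cokernel as a'
  let s : X →ₗ[R] (W1 × B) := al.prod g
  let t : (W1 × B) →ₗ[R] (W1 × W2) := LinearMap.prodMap LinearMap.id j
  -- cokernel map, built from the quotient
  have hs : Function.Injective s := by
    rw [injective_iff_map_eq_zero]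
    intro x hx
    have hx1 : al x = 0 := congrArg Prod.fst hx
    have hx2 : g x = 0 := congrArg Prod.snd hx
    obtain ⟨z, rfl⟩ := (h.ex _).1 hx2
    rw [hal'] at hx1
    rw [h1.inj (hx1.trans (map_zero _).symm), map_zero]
  have hsplit : ∃ v : B →ₗ[R] P, b ∘ₗ v = LinearMap.id ∧ ∀ x, v (g x) = a' x - a (al x) := by
    obtain ⟨v, hv⟩ : ∃ v : B →ₗ[R] P, v ∘ₗ g = a' - a ∘ₗ al := by
      let e := h.ex.linearEquivOfSurjective h.surj
      refine ⟨((LinearMap.range f).liftQ (a' - a ∘ₗ al) (by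
        rintro _ ⟨x, rfl⟩; simp [hal', h5'])) ∘ₗ e.symm.toLinearMap, ?_⟩
      ext x
      have : e.symm (g x) = (LinearMap.range f).mkQ x := by
        rw [LinearEquiv.symm_apply_eq]; rfl
      simp [this]
    refine ⟨v, ?_, fun x => LinearMap.congr_fun hv x⟩
    ext x
    obtain ⟨x, rfl⟩ := h.surj x
    have := LinearMap.congr_fun hv x
    simp at this
    simp [this, h3', e1.gf]
  obtain ⟨v, hv1, hv2⟩ := hsplit
  have hsx : SE (B := ModuleCat.of R (W1 × B)) s ((b' ∘ₗ a).coprod (b' ∘ₗ v)) := by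
    refine ⟨hs, ?_, ?_⟩
    · rintro ⟨w, y⟩
      obtain ⟨x, rfl⟩ := h.surj y
      have hh : ((b' ∘ₗ a).coprod (b' ∘ₗ v)) (w, g x) = p (w - al x) := by
        simp [hv2, e2.gf, h4', sub_eq_add_neg]
      rw [hh]
      constructor
      · intro hx
        obtain ⟨z, hz⟩ := (h1.ex _).1 hx
        refine ⟨x + f z, Prod.ext ?_ ?_⟩
        · simp [s, hal', hz]
        · simp [s, h.gf]
      · rintro ⟨z, hz⟩
        have hz1 : al z = w := congrArg Prod.fst hz
        have hz2 : g z = g x := congrArg Prod.snd hz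
        obtain ⟨y, hy⟩ := (h.ex (z - x)).1 (by simp [hz2])
        have : w - al x = i y := by rw [← hz1, ← map_sub, ← hy, hal']
        rw [this, h1.gf]
    · intro y
      obtain ⟨w, rfl⟩ := h1.surj y
      exact ⟨(w, 0), by simp [h4']⟩
  have hst : SE (A := ModuleCat.of R (W1 × B)) (B := ModuleCat.of R (W1 × W2)) t
      (q ∘ₗ LinearMap.snd R W1 W2) := by
    refine ⟨?_, ?_, ?_⟩
    · rintro ⟨x, y⟩ ⟨x', y'⟩ hh
      have := congrArg Prod.fst hh
      have h' := congrArg Prod.snd hh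
      exact Prod.ext this (h2.inj h')
    · rintro ⟨x, y⟩
      constructor
      · intro hy
        obtain ⟨z, rfl⟩ := (h2.ex _).1 hy
        exact ⟨(x, z), rfl⟩
      · rintro ⟨⟨w, z⟩, hz⟩
        have : j z = y := congrArg Prod.snd hz
        simp [← this, h2.gf]
    · intro y
      obtain ⟨w, rfl⟩ := h2.surj y
      exact ⟨(0, w), rfl⟩
  obtain ⟨C', a1, b1, c1, k1, k2, _⟩ := hsx.S1 hst
  exact ⟨C', _, a1, b1, c1, k1, k2⟩

end constr

end GGo


namespace GGo
variable {R : Type u} [CommRing R]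

/-- data for a relative Gorenstein theory -/
structure GD (R : Type u) [CommRing R] where
  F : ModuleCat.{u} R → Prop
  W : ModuleCat.{u} R → Prop
  W_F : ∀ {X}, W X → F X
  W_prod : ∀ {X Y : ModuleCat.{u} R}, W X → W Y → W (ModuleCat.of R (X × Y))
  F_proj : ∀ {X : ModuleCat.{u} R}, Module.Projective R X → F X
  F_flat : ∀ {X : ModuleCat.{u} R}, F X → Module.Flat R X
  F_embed : ∀ {X : ModuleCat.{u} R}, F X → ∃ (Y C : ModuleCat.{u} R) (f : X →ₗ[R] Y) (g : Y →ₗ[R] C),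
    W Y ∧ F C ∧ SE f g
  ext_van : ∀ {X Y : ModuleCat.{u} R} (n : ℕ), F X → W Y → V X Y (n + 1)
  F_iso : ∀ (X Y : ModuleCat.{u} R), (X ≃ₗ[R] Y) → F X → F Y
  F_sum : ∀ {X : ModuleCat.{u} R}, F X → F (ModuleCat.of R (ℕ →₀ X))

variable (D : GD R)

def GD.EV (X : ModuleCat.{u} R) : Prop := ∀ (Y : ModuleCat.{u} R) (n : ℕ), D.W Y → V X Y (n + 1)

/-- the relative Gorenstein class -/
def GD.G (N : ModuleCat.{u} R) : Prop := ∃ (S : ModuleCat.{u} R → Prop), S N ∧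
  ∀ X, S X → D.EV X ∧ ∃ (W C : ModuleCat.{u} R) (f : X →ₗ[R] W) (g : W →ₗ[R] C), D.W W ∧ S C ∧ SE f g

/-- extension closure -/
inductive GD.Cl (S : ModuleCat.{u} R → Prop) : ModuleCat.{u} R → Prop
  | base (X) : S X → GD.Cl S X
  | flat (X) : D.F X → GD.Cl S X
  | ext (A B C : ModuleCat.{u} R) (f : A →ₗ[R] B) (g : B →ₗ[R] C) : SE f g → GD.Cl S A → GD.Cl S C → GD.Cl S B

variable {D}

lemma GD.Cl_ev {S : ModuleCat.{u} R → Prop} (hS : ∀ X, S X → D.EV X) {X} (h : D.Cl S X) : D.EV X := by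
  induction h with
  | base X h => exact hS X h
  | flat X h => exact fun Y n hY => D.ext_van n h hY
  | ext A B C f g h _ _ h1 h2 => exact fun Y n hY => h.V_mid (h1 Y n hY) (h2 Y n hY)

lemma GD.Cl_step {S : ModuleCat.{u} R → Prop}
    (hS : ∀ X, S X → D.EV X ∧ ∃ (W C : ModuleCat.{u} R) (f : X →ₗ[R] W) (g : W →ₗ[R] C),
      D.F W ∧ D.Cl S C ∧ SE f g) {X} (h : D.Cl S X) :
    ∃ (W C : ModuleCat.{u} R) (f : X →ₗ[R] W) (g : W →ₗ[R] C), D.W W ∧ D.Cl S C ∧ SE f g := by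
  induction h with
  | base X h =>
    obtain ⟨_, F, C, f, g, hF, hC, hs⟩ := hS X h
    obtain ⟨W, C', f', g', hW, hC', hs'⟩ := D.F_embed hF
    obtain ⟨C'', a, b, c, h1, h2, _⟩ := hs.S1 hs'
    exact ⟨W, C'', _, a, hW, GD.Cl.ext _ _ _ b c h2 hC (GD.Cl.flat _ hC'), h1⟩
  | flat X h =>
    obtain ⟨W, C', f', g', hW, hC', hs'⟩ := D.F_embed h
    exact ⟨W, C', f', g', hW, GD.Cl.flat _ hC', hs'⟩
  | ext A B C f g h hA hC h1 h2 =>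
    obtain ⟨W1, C1, f1, g1, hW1, hC1, hs1⟩ := h1
    obtain ⟨W2, C2, f2, g2, hW2, hC2, hs2⟩ := h2
    obtain ⟨al, hal⟩ := h.extend (Y := W1) (GD.Cl_ev (fun X hX => (hS X hX).1) hC W1 0 hW1) f1
    obtain ⟨C', s, t, b, c, h3, h4⟩ := h.S2 hs1 hs2 al hal
    exact ⟨_, C', s, t, D.W_prod hW1 hW2, GD.Cl.ext _ _ _ b c h4 hC1 hC2, h3⟩

/-- strong coinduction -/
lemma GD.L1 (S : ModuleCat.{u} R → Prop)
    (hS : ∀ X, S X → D.EV X ∧ ∃ (W C : ModuleCat.{u} R) (f : X →ₗ[R] W) (g : W →ₗ[R] C),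
      D.F W ∧ D.Cl S C ∧ SE f g) {X} (h : D.Cl S X) : D.G X :=
  ⟨D.Cl S, h, fun X hX => ⟨GD.Cl_ev (fun X hX => (hS X hX).1) hX, GD.Cl_step hS hX⟩⟩

lemma GD.G.ev {X} (h : D.G X) : D.EV X := by
  obtain ⟨S, h1, h2⟩ := h
  exact (h2 X h1).1

lemma GD.G.step {X} (h : D.G X) :
    ∃ (W C : ModuleCat.{u} R) (f : X →ₗ[R] W) (g : W →ₗ[R] C), D.W W ∧ D.G C ∧ SE f g := by
  obtain ⟨S, h1, h2⟩ := h
  obtain ⟨W, C, f, g, hW, hC, hs⟩ := (h2 X h1).2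
  exact ⟨W, C, f, g, hW, ⟨S, hC, h2⟩, hs⟩

lemma GD.Cl_G {X} (h : D.Cl D.G X) : D.G X := by
  refine GD.L1 D.G (fun X hX => ⟨hX.ev, ?_⟩) h
  obtain ⟨W, C, f, g, hW, hC, hs⟩ := hX.step
  exact ⟨W, C, f, g, D.W_F hW, GD.Cl.base _ hC, hs⟩

lemma GD.G_F {X} (h : D.F X) : D.G X := GD.Cl_G (GD.Cl.flat _ h)

lemma GD.G_proj {X : ModuleCat.{u} R} (h : Module.Projective R X) : D.G X := GD.G_F (D.F_proj h)

lemma GD.G_zero : D.G (Z0 (R := R)) := GD.G_proj (inferInstanceAs (Module.Projective R PUnit.{u+1}))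

variable {A B C X Y N : ModuleCat.{u} R} {f : A →ₗ[R] B} {g : B →ₗ[R] C}

lemma GD.G_ext (h : SE f g) (hA : D.G A) (hC : D.G C) : D.G B :=
  GD.Cl_G (GD.Cl.ext _ _ _ f g h (GD.Cl.base _ hA) (GD.Cl.base _ hC))

lemma GD.G_iso (e : A ≃ₗ[R] B) (h : D.G A) : D.G B := GD.G_ext (SE.ofIso e) h GD.G_zero

/-- one step coinduction -/
lemma GD.G_of_embed (h : SE f g) (hA : D.EV A) (hB : D.F B) (hC : D.G C) : D.G A := by
  refine GD.L1 (fun X => D.G X ∨ (D.EV X ∧ ∃ (W C : ModuleCat.{u} R) (f : X →ₗ[R] W) (g : W →ₗ[R] C),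
    D.F W ∧ D.G C ∧ SE f g)) ?_ (GD.Cl.base _ (Or.inr ⟨hA, B, C, f, g, hB, hC, h⟩))
  rintro X (hX | ⟨hX, W, C, f, g, hW, hC, hs⟩)
  · obtain ⟨W, C, f, g, hW, hC, hs⟩ := hX.step
    exact ⟨hX.ev, W, C, f, g, D.W_F hW, GD.Cl.base _ (Or.inl hC), hs⟩
  · exact ⟨hX, W, C, f, g, hW, GD.Cl.base _ (Or.inl hC), hs⟩

/-- kernels of epimorphisms -/
lemma GD.L3 (h : SE f g) (hB : D.G B) (hC : D.G C) : D.G A := by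
  obtain ⟨W, C1, i, p, hW, hC1, hs⟩ := hB.step
  obtain ⟨C', a, b, c, h1, h2, _⟩ := h.S1 hs
  exact GD.G_of_embed h1 (fun Y n hY => h.V_left (hB.ev Y n hY) (hC.ev Y (n + 1) hY)) (D.W_F hW)
    (GD.G_ext h2 hC hC1)

lemma GD.L4 (h : SE f g) (hA : D.G A) (hB : D.G B) (hC : ∀ Y, D.W Y → V C Y 1) : D.G C := by
  obtain ⟨W, C1, i, p, hW, hC1, hs⟩ := hA.step
  obtain ⟨P, a, b, a', b', h1, h2, _⟩ := h.S4 hs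
  have hP : D.G P := GD.G_ext h2 hB hC1
  obtain ⟨s, hs'⟩ := h1.lift (hC W hW) LinearMap.id
  obtain ⟨r, hr⟩ := h1.rev s hs'
  exact GD.L3 hr hP (GD.G_F (D.W_F hW))

/-- finite resolution dimension -/
abbrev GD.LE (D : GD R) (s : ℕ) (N : ModuleCat.{u} R) : Prop := Paper.ResDimLE R D.G s N

lemma resLE_iso {P : ModuleCat.{u} R → Prop} (hP : ∀ X Y : ModuleCat.{u} R, (X ≃ₗ[R] Y) → P X → P Y)
    {s : ℕ} : ∀ {A B : ModuleCat.{u} R}, (A ≃ₗ[R] B) → Paper.ResDimLE R P s A → Paper.ResDimLE R P s B := by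
  induction s with
  | zero => intro A B e h; exact hP _ _ e h
  | succ s ih =>
    rintro A B e (h | ⟨X, f, hX, hf, hK⟩)
    · exact Or.inl (ih e h)
    · refine Or.inr ⟨X, e.toLinearMap ∘ₗ f, hX, e.surjective.comp hf, ih ?_ hK⟩
      exact LinearEquiv.ofEq _ _ (by ext; simp)

lemma resLE_mono {P : ModuleCat.{u} R → Prop} {s t : ℕ} (h : s ≤ t) (hN : Paper.ResDimLE R P s N) :
    Paper.ResDimLE R P t N := by
  induction h with
  | refl => exact hN
  | step _ ih => exact Or.inl ih

lemma SE.kerEquiv (h : SE f g) : Nonempty (A ≃ₗ[R] LinearMap.ker g) :=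
  ⟨(LinearEquiv.ofInjective f h.inj).trans (LinearEquiv.ofEq _ _ (by
    ext x; rw [LinearMap.mem_ker]; exact (h.ex x).symm))⟩

lemma GD.LE_succ {s : ℕ} (h : SE f g) (hA : D.LE s A) (hB : D.G B) : D.LE (s + 1) C := by
  obtain ⟨e⟩ := h.kerEquiv
  exact Or.inr ⟨B, g, hB, h.surj, resLE_iso (fun _ _ e h => GD.G_iso e h)
    (B := ModuleCat.of R (LinearMap.ker g)) e hA⟩

lemma GD.LE_iso {s : ℕ} (e : A ≃ₗ[R] B) (h : D.LE s A) : D.LE s B :=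
  resLE_iso (fun _ _ e h => GD.G_iso e h) e h

lemma GD.LE_zero (s : ℕ) : D.LE s (Z0 (R := R)) := resLE_mono (Nat.zero_le s) GD.G_zero

lemma GD.LE_cases {s : ℕ} (h : D.LE (s + 1) N) : ∃ (K X : ModuleCat.{u} R) (f : K →ₗ[R] X)
    (g : X →ₗ[R] N), SE f g ∧ D.LE s K ∧ D.G X := by
  induction s generalizing N with
  | zero =>
    rcases h with h | ⟨X, f, hX, hf, hK⟩
    · exact ⟨Z0, N, _, _, SE.ofIso' (LinearEquiv.refl R N), GD.LE_zero _, h⟩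
    · exact ⟨_, X, _, f, SE.ofSurj f hf, hK, hX⟩
  | succ s ih =>
    rcases h with h | ⟨X, f, hX, hf, hK⟩
    · obtain ⟨K, X, f, g, h1, h2, h3⟩ := ih h
      exact ⟨K, X, f, g, h1, Or.inl h2, h3⟩
    · exact ⟨_, X, _, f, SE.ofSurj f hf, hK, hX⟩

lemma GD.LE_ev {s : ℕ} (h : D.LE s N) {Y} (hY : D.W Y) (j : ℕ) (hj : s < j) : V N Y j := by
  obtain ⟨j, rfl⟩ : ∃ k, j = k + 1 := ⟨j - 1, by omega⟩
  induction s generalizing N j with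
  | zero => exact GD.G.ev h Y j hY
  | succ s ih =>
    obtain ⟨K, X, f, g, h1, h2, h3⟩ := GD.LE_cases h
    obtain ⟨j, rfl⟩ : ∃ k, j = k + 1 := ⟨j - 1, by omega⟩
    exact h1.V_right (ih h2 j (by omega)) (h3.ev Y _ hY)

lemma GD.L7 {s r : ℕ} (h : D.LE s N) (hv : ∀ Y, D.W Y → ∀ j, r < j → V N Y j) : D.LE r N := by
  induction s generalizing N r with
  | zero => exact resLE_mono (Nat.zero_le r) h
  | succ s ih =>
    obtain ⟨K, X, f, g, h1, h2, h3⟩ := GD.LE_cases h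
    cases r with
    | zero =>
      have hK : D.G K := ih (r := 0) h2 (fun Y hY j hj => by
        obtain ⟨j, rfl⟩ : ∃ k, j = k + 1 := ⟨j - 1, by omega⟩
        exact h1.V_left (h3.ev Y _ hY) (hv Y hY _ (by omega)))
      exact GD.L4 h1 hK h3 (fun Y hY => hv Y hY 1 (by omega))
    | succ r =>
      refine GD.LE_succ h1 (ih h2 (fun Y hY j hj => ?_)) h3
      obtain ⟨j, rfl⟩ : ∃ k, j = k + 1 := ⟨j - 1, by omega⟩
      exact h1.V_left (h3.ev Y _ hY) (hv Y hY _ (by omega))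

/-- embedding in a module of finite `F`-dimension -/
lemma GD.L5 {s : ℕ} (h : D.LE s N) : ∃ (L C : ModuleCat.{u} R) (f : N →ₗ[R] L) (g : L →ₗ[R] C),
    SE f g ∧ Paper.ResDimLE R D.F s L ∧ D.G C := by
  induction s generalizing N with
  | zero =>
    obtain ⟨W, C, f, g, hW, hC, hs⟩ := GD.G.step h
    exact ⟨W, C, f, g, hs, D.W_F hW, hC⟩
  | succ s ih =>
    rcases h with h | ⟨X, f, hX, hf, hK⟩
    · obtain ⟨L, C, f, g, h1, h2, h3⟩ := ih h
      exact ⟨L, C, f, g, h1, Or.inl h2, h3⟩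
    · obtain ⟨L, C, i, p, h1, h2, h3⟩ := ih hK
      obtain ⟨P, a, b, a', b', k1, k2, _⟩ := h1.S4 (SE.ofSurj f hf)
      have hP : D.G P := GD.G_ext k1 hX h3
      obtain ⟨W, C2, i2, p2, hW, hC2, hs⟩ := hP.step
      obtain ⟨C', c1, c2, c3, m1, m2, _⟩ := k2.S1 hs
      obtain ⟨e⟩ := m1.kerEquiv
      exact ⟨C', C2, c2, c3, m2, Or.inr ⟨W, c1, D.W_F hW, m1.surj,
        resLE_iso D.F_iso (B := ModuleCat.of R (LinearMap.ker c1)) e h2⟩, hC2⟩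

lemma GD.LE_K {s : ℕ} (h : SE f g) (hB : D.LE s B) (hC : D.G C) : D.LE s A := by
  cases s with
  | zero => exact GD.L3 h hB hC
  | succ s =>
    obtain ⟨K, X, k, p, h1, h2, h3⟩ := GD.LE_cases hB
    obtain ⟨X', a, b, c, h4, h5, _⟩ := h1.S1' h
    exact GD.LE_succ h5 h2 (GD.L3 h4 h3 hC)

lemma GD.syz (h : SE f g) (hB : D.F B) (hC : D.G C) : D.G A := GD.L3 h (GD.G_F hB) hC

lemma GD.LE_ext1 {s : ℕ} (h : SE f g) (hA : D.LE s A) (hC : D.G C) : D.LE s B := by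
  induction s generalizing A B C with
  | zero => exact GD.G_ext h hA hC
  | succ s ih =>
    obtain ⟨K, X, k, p, h1, h2, h3⟩ := GD.LE_cases hA
    obtain ⟨Q, P, i, q, hP, hq⟩ := exists_proj B
    -- X × P → B
    obtain ⟨Om, a, b, c, h4, h5, h6, h7⟩ := hq.S1' h
    have hOm : D.G Om := GD.syz h4 (D.F_proj hP) hC
    -- kernel of `X × P → B` : pullback of X → A ← Om
    have hcop : SE (A := ModuleCat.of R (LinearMap.ker ((f ∘ₗ p).coprod q)))
        (B := ModuleCat.of R (X × P)) (C := B) _ ((f ∘ₗ p).coprod q) :=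
      SE.ofSurj (B := ModuleCat.of R (X × P)) ((f ∘ₗ p).coprod q) (fun y => by
        obtain ⟨x, rfl⟩ := hq.surj y
        exact ⟨(0, x), by simp⟩)
    have hXP : D.G (ModuleCat.of R (X × P)) := GD.G_ext SE.prod h3 (GD.G_proj hP)
    refine GD.LE_succ hcop ?_ hXP
    -- SE K → ker → Om
    have hf := h.inj
    have key : ∀ y : LinearMap.ker ((f ∘ₗ p).coprod q), q y.1.2 = - f (p y.1.1) := fun y => by
      have := y.2
      rw [LinearMap.mem_ker, LinearMap.coprod_apply] at this
      exact (neg_eq_of_add_eq_zero_right this).symm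
    have keyO : ∀ y : LinearMap.ker ((f ∘ₗ p).coprod q), ∃ o : Om, a o = y.1.2 := fun y =>
      (h4.ex _).1 (by simp [key, h.gf])
    let e := LinearEquiv.ofInjective a h4.inj
    let t : LinearMap.ker ((f ∘ₗ p).coprod q) →ₗ[R] Om := e.symm.toLinearMap ∘ₗ
      (LinearMap.snd R X P ∘ₗ (LinearMap.ker ((f ∘ₗ p).coprod q)).subtype).codRestrict
        (LinearMap.range a) keyO
    have ht : ∀ y, a (t y) = y.1.2 := fun y => by
      have := e.apply_symm_apply ((LinearMap.snd R X P ∘ₗ (LinearMap.ker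
        ((f ∘ₗ p).coprod q)).subtype).codRestrict (LinearMap.range a) keyO y)
      exact congrArg Subtype.val this
    let u : K →ₗ[R] LinearMap.ker ((f ∘ₗ p).coprod q) := (LinearMap.inl R X P ∘ₗ k).codRestrict _
      (fun z => by simp [h1.gf])
    have hu : SE (B := ModuleCat.of R (LinearMap.ker ((f ∘ₗ p).coprod q))) u t := by
      refine ⟨fun x y hxy => h1.inj (congrArg (fun z => z.1.1) hxy), ?_, ?_⟩
      · intro y
        constructor
        · intro hy
          have h8 := ht y
          rw [hy, map_zero] at h8
          have h9 := key y
          rw [← h8, map_zero] at h9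
          have h10 : p y.1.1 = 0 := hf (by rw [map_zero]; simpa using h9.symm)
          obtain ⟨z, hz⟩ := (h1.ex _).1 h10
          exact ⟨z, Subtype.ext (Prod.ext hz h8)⟩
        · rintro ⟨z, rfl⟩
          apply h4.inj
          rw [ht, map_zero]; rfl
      · intro o
        obtain ⟨x, hx⟩ := h1.surj (-(c o))
        have h7' : f (c o) = q (a o) := LinearMap.congr_fun h7 o
        refine ⟨⟨(x, a o), ?_⟩, h4.inj ?_⟩
        · simp [hx, h7']
        · rw [ht]
    exact ih hu h2 hOm

lemma GD.LE_ext {s : ℕ} (h : SE f g) (hA : D.LE s A) (hC : D.LE s C) : D.LE s B := by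
  induction s generalizing A B C with
  | zero => exact GD.G_ext h hA hC
  | succ s ih =>
    obtain ⟨K, X, k, p, h1, h2, h3⟩ := GD.LE_cases hC
    obtain ⟨Y, a, b, a', b', h4, h5, _⟩ := h.S3 h1
    have hY : D.LE (s + 1) Y := GD.LE_ext1 h4 hA h3
    obtain ⟨K2, X2, k2, p2, h6, h7, h8⟩ := GD.LE_cases hY
    obtain ⟨Z, c1, c2, c3, m1, m2, _⟩ := h6.S1' h5
    exact GD.LE_succ m1 (ih m2 h7 h2) h8

lemma GD.LE_coker {s : ℕ} (h : SE f g) (hA : D.LE s A) (hB : D.LE s B) : D.LE (s + 1) C := by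
  cases s with
  | zero => exact GD.LE_succ h hA hB
  | succ s =>
    obtain ⟨K, X, k, p, h1, h2, h3⟩ := GD.LE_cases hB
    obtain ⟨Z, c1, c2, c3, m1, m2, _⟩ := h1.S1' h
    exact GD.LE_succ m1 (GD.LE_ext m2 (Or.inl h2) hA) h3

end GGo


namespace GGo
variable {R : Type u} [CommRing R]

/-- countable direct sum -/
noncomputable abbrev Sm (X : ModuleCat.{u} R) : ModuleCat.{u} R := ModuleCat.of R (ℕ →₀ X)

noncomputable abbrev sg {X : ModuleCat.{u} R} (i : ℕ) : X →ₗ[R] Sm X := Finsupp.lsingle i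

noncomputable abbrev Sm.map {X Y : ModuleCat.{u} R} (f : X →ₗ[R] Y) : Sm X →ₗ[R] Sm Y :=
  Finsupp.mapRange.linearMap f

lemma SE.sum {A B C : ModuleCat.{u} R} {f : A →ₗ[R] B} {g : B →ₗ[R] C} (h : SE f g) :
    SE (Sm.map f) (Sm.map g) := by
  refine ⟨Finsupp.mapRange_injective _ (map_zero f) h.inj, ?_,
    Finsupp.mapRange_surjective _ (map_zero g) h.surj⟩
  intro y
  constructor
  · intro hy
    have hy' : ∀ n, g (y n) = 0 := fun n => by
      have := DFunLike.congr_fun hy n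
      simpa using this
    choose z hz using fun n => (h.ex (y n)).1 (hy' n)
    refine ⟨Finsupp.onFinset y.support z (fun n hn => ?_), ?_⟩
    · rw [Finsupp.mem_support_iff]
      intro h0
      apply hn
      apply h.inj
      rw [hz, h0, map_zero]
    · ext n
      simp [hz]
  · rintro ⟨z, rfl⟩
    ext n
    simp [h.gf]

lemma DS_eq {X : ModuleCat.{u} R} (n : ℕ) : ∀ {Y : ModuleCat.{u} R} (e : EX (Sm X) Y n),
    (∀ i, pre (sg i) e = 0) → e = 0 := by
  induction n with
  | zero =>
    intro Y e he
    obtain ⟨a, rfl⟩ := m0.surjective e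
    have : a = 0 := by
      apply Finsupp.lhom_ext'
      intro i
      have := he i
      rw [pre_m0] at this
      have h2 : a ∘ₗ sg i = 0 := by simpa using this
      rw [LinearMap.zero_comp]; exact h2
    rw [this, map_zero]
  | succ n ih =>
    intro Y e he
    obtain ⟨I, C, f, g, hI, hs⟩ := exists_inj Y
    obtain ⟨c, rfl⟩ := hs.cov1 e (V_inj _)
    have h1 : ∀ i, hs.cd (pre (sg i) c) = 0 := fun i => by rw [← hs.pre_cd, he]
    cases n with
    | zero =>
      obtain ⟨a, rfl⟩ := m0.surjective c
      have h2 : ∀ i, ∃ b : X →ₗ[R] I, g ∘ₗ b = a ∘ₗ sg i := fun i => by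
        obtain ⟨b, hb⟩ := hs.cov3 _ (h1 i)
        obtain ⟨b, rfl⟩ := m0.surjective b
        rw [post_m0, pre_m0] at hb
        exact ⟨b, m0.injective hb⟩
      choose b hb using h2
      let B : Sm X →ₗ[R] I := Finsupp.lsum R b
      have hB : g ∘ₗ B = a := by
        apply Finsupp.lhom_ext'
        intro i
        ext x
        have := LinearMap.congr_fun (hb i) x
        simpa [B] using this
      rw [← hB, ← post_m0, hs.cd_post]
    | succ n =>
      have : c = 0 := ih c (fun i => by
        obtain ⟨b, hb⟩ := hs.cov3 _ (h1 i)
        rw [← hb, V_inj b, map_zero])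
      rw [this, map_zero]

lemma DS_exists {X : ModuleCat.{u} R} (n : ℕ) : ∀ {Y : ModuleCat.{u} R} (c : ℕ → EX X Y n),
    ∃ e : EX (Sm X) Y n, ∀ i, pre (sg i) e = c i := by
  induction n with
  | zero =>
    intro Y c
    choose a ha using fun i => m0.surjective (c i)
    refine ⟨m0 (Finsupp.lsum R a), fun i => ?_⟩
    rw [pre_m0, ← ha]
    congr 1
    ext x
    simp
  | succ n ih =>
    intro Y c
    obtain ⟨I, C, f, g, hI, hs⟩ := exists_inj Y
    choose b hb using fun i => hs.cov1 (c i) (V_inj _)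
    obtain ⟨e, he⟩ := ih b
    exact ⟨hs.cd e, fun i => by rw [hs.pre_cd, he, hb]⟩

lemma V_sum {X Y : ModuleCat.{u} R} {n : ℕ} (h : V X Y n) : V (Sm X) Y n :=
  fun e => DS_eq n e (fun i => h _)

variable {D : GD R}

lemma GD.G_sum {X : ModuleCat.{u} R} (h : D.G X) : D.G (Sm X) := by
  refine GD.L1 (fun Y => ∃ X, D.G X ∧ Y = Sm X) ?_ (GD.Cl.base _ ⟨X, h, rfl⟩)
  rintro _ ⟨X, h, rfl⟩
  refine ⟨fun Y n hY => V_sum (h.ev Y n hY), ?_⟩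
  obtain ⟨W, C, f, g, hW, hC, hs⟩ := h.step
  exact ⟨_, _, _, _, D.F_sum (D.W_F hW), GD.Cl.base _ ⟨C, hC, rfl⟩, hs.sum⟩

lemma GD.LE_sum {s : ℕ} {X : ModuleCat.{u} R} (h : D.LE s X) : D.LE s (Sm X) := by
  induction s generalizing X with
  | zero => exact GD.G_sum h
  | succ s ih =>
    obtain ⟨K, Y, k, p, h1, h2, h3⟩ := GD.LE_cases h
    exact GD.LE_succ h1.sum (ih h2) (GD.G_sum h3)

end GGo


namespace GGo
variable {R : Type u} [CommRing R]

lemma inj_retract {Y I : ModuleCat.{u} R} (s : Y →ₗ[R] I) (r : I →ₗ[R] Y) (h : r ∘ₗ s = LinearMap.id)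
    (hI : Module.Injective R I) : Module.Injective R Y := by
  refine ⟨fun A B _ _ _ _ f hf g => ?_⟩
  obtain ⟨k, hk⟩ := hI.out f hf (s ∘ₗ g)
  refine ⟨r ∘ₗ k, fun x => ?_⟩
  have := LinearMap.congr_fun h (g x)
  simp only [LinearMap.comp_apply, hk]
  exact this

lemma inj_of_V {Y : ModuleCat.{u} R} (h : ∀ Z : ModuleCat.{u} R, V Z Y 1) : Module.Injective R Y := by
  obtain ⟨I, C, f, g, hI, hs⟩ := exists_inj Y
  obtain ⟨r, hr⟩ := hs.extend (h C) LinearMap.id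
  exact inj_retract f r hr hI

lemma inj_prod {I J : ModuleCat.{u} R} (hI : Module.Injective R I) (hJ : Module.Injective R J) :
    Module.Injective R (I × J) := by
  refine ⟨fun A B _ _ _ _ f hf g => ?_⟩
  obtain ⟨k, hk⟩ := hI.out f hf (LinearMap.fst R I J ∘ₗ g)
  obtain ⟨k', hk'⟩ := hJ.out f hf (LinearMap.snd R I J ∘ₗ g)
  refine ⟨LinearMap.prod k k', fun x => ?_⟩
  ext <;> simp [hk, hk']

lemma inj_iso {I J : ModuleCat.{u} R} (e : I ≃ₗ[R] J) (hI : Module.Injective R I) : Module.Injective R J :=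
  inj_retract e.symm.toLinearMap e.toLinearMap (by ext; simp) hI

abbrev ch (X : ModuleCat.{u} R) : ModuleCat.{u} R := ModuleCat.of R (CharacterModule X)

abbrev chd {X Y : ModuleCat.{u} R} (f : X →ₗ[R] Y) : ch Y →ₗ[R] ch X := CharacterModule.dual f

lemma dual_exact {A B C : Type*} [AddCommGroup A] [AddCommGroup B] [AddCommGroup C]
    [Module R A] [Module R B] [Module R C] (f : A →ₗ[R] B) (g : B →ₗ[R] C) (h : Function.Exact f g) :
    Function.Exact (CharacterModule.dual g) (CharacterModule.dual f) := by
  intro x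
  constructor
  · intro hx
    have hx' : ∀ a, x (f a) = 0 := fun a => DFunLike.congr_fun hx a
    have hk : (LinearMap.ker g).toAddSubgroup ≤ AddMonoidHom.ker (show B →+ AddCircle (1:ℚ) from x) := by
      intro b hb
      obtain ⟨a, rfl⟩ := (h b).1 hb
      exact hx' a
    let x' : CharacterModule (B ⧸ LinearMap.ker g) :=
      QuotientAddGroup.lift (LinearMap.ker g).toAddSubgroup (show B →+ AddCircle (1:ℚ) from x) hk
    obtain ⟨y, hy⟩ := CharacterModule.dual_surjective_of_injective
      ((LinearMap.ker g).liftQ g le_rfl) (LinearMap.ker_eq_bot.1 (Submodule.ker_liftQ_eq_bot _ _ _ le_rfl)) x'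
    refine ⟨y, ?_⟩
    ext b
    have := DFunLike.congr_fun hy (Submodule.Quotient.mk b)
    exact this
  · rintro ⟨y, rfl⟩
    ext a
    have : g (f a) = 0 := (h _).2 ⟨a, rfl⟩
    show y (g (f a)) = 0
    rw [this, map_zero]

lemma dual_exact_iff {A B C : Type*} [AddCommGroup A] [AddCommGroup B] [AddCommGroup C]
    [Module R A] [Module R B] [Module R C] (f : A →ₗ[R] B) (g : B →ₗ[R] C)
    (h : Function.Exact (CharacterModule.dual g) (CharacterModule.dual f)) :
     Function.Exact f g := by
  have hz : ∀ a, g (f a) = 0 := fun a => CharacterModule.eq_zero_of_character_apply (fun c =>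
    DFunLike.congr_fun ((h _).2 ⟨c, rfl⟩) a)
  intro b
  constructor
  · intro hb
    have : Submodule.Quotient.mk (p := LinearMap.range f) b = 0 := by
      refine CharacterModule.eq_zero_of_character_apply (fun c => ?_)
      obtain ⟨y, hy⟩ := (h (CharacterModule.dual (LinearMap.range f).mkQ c)).1 (by
        ext a
        show c (Submodule.Quotient.mk (f a)) = 0
        rw [(Submodule.Quotient.mk_eq_zero _).2 (LinearMap.mem_range_self f a)]
        exact map_zero c)
      have := DFunLike.congr_fun hy b
      refine this.symm.trans ?_
      show y (g b) = 0
      rw [hb, map_zero]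
    obtain ⟨a, ha⟩ := (Submodule.Quotient.mk_eq_zero _).1 this
    exact ⟨a, ha⟩
  · rintro ⟨a, rfl⟩; exact hz a

lemma SE.dual {A B C : ModuleCat.{u} R} {f : A →ₗ[R] B} {g : B →ₗ[R] C} (h : SE f g) :
    SE (chd g) (chd f) :=
  ⟨CharacterModule.dual_injective_of_surjective _ h.surj, dual_exact _ _ h.ex,
    CharacterModule.dual_surjective_of_injective _ h.inj⟩

lemma flat_iff {X : ModuleCat.{u} R} : Module.Flat R X ↔ Module.Injective R (ch X) :=
  Module.Flat.iff_characterModule_injective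

lemma flat_ch [IsNoetherianRing R] {I : ModuleCat.{u} R} (hI : Module.Injective R I) :
    Module.Flat R (ch I) := by
  refine Module.Flat.of_forall_isTrivialRelation ?_
  intro l f x hx
  let φ : (Fin l → R) →ₗ[R] R := Fintype.linearCombination R f
  obtain ⟨k, a, ha⟩ := Submodule.fg_iff_exists_fin_generating_family.1
    (IsNoetherian.noetherian (LinearMap.ker φ))
  let F : I →ₗ[R] (Fin l → I) := LinearMap.pi (fun i => f i • LinearMap.id)
  let A : (Fin l → I) →ₗ[R] (Fin k → I) := LinearMap.pi (fun j => ∑ i, a j i • LinearMap.proj i)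
  have haK : ∀ j, φ (a j) = 0 := fun j => by
    have : a j ∈ LinearMap.ker φ := by rw [← ha]; exact Submodule.subset_span ⟨j, rfl⟩
    exact this
  have hex : Function.Exact F A := by
    intro v
    constructor
    · intro hv
      let ψ : (Fin l → R) →ₗ[R] I := Fintype.linearCombination R v
      have hψ : LinearMap.ker φ ≤ LinearMap.ker ψ := by
        rw [← ha, Submodule.span_le]
        rintro _ ⟨j, rfl⟩
        have := congrFun hv j
        simpa [A, ψ, Fintype.linearCombination_apply] using this
      let φ' : ((Fin l → R) ⧸ LinearMap.ker φ) →ₗ[R] R := (LinearMap.ker φ).liftQ φ le_rfl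
      let ψ' : ((Fin l → R) ⧸ LinearMap.ker φ) →ₗ[R] I := (LinearMap.ker φ).liftQ ψ hψ
      obtain ⟨w, hw⟩ := hI.out φ' (LinearMap.ker_eq_bot.1 (Submodule.ker_liftQ_eq_bot _ _ _ le_rfl)) ψ'
      refine ⟨w 1, ?_⟩
      ext i
      have := hw (Submodule.Quotient.mk (Pi.single i 1))
      have h1 : φ' (Submodule.Quotient.mk (Pi.single i 1)) = f i := by
        simp [φ', φ, Fintype.linearCombination_apply_single]
      have h2 : ψ' (Submodule.Quotient.mk (Pi.single i 1)) = v i := by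
        simp [ψ', ψ, Fintype.linearCombination_apply_single]
      rw [h1, h2] at this
      simp only [F, LinearMap.pi_apply, LinearMap.smul_apply, LinearMap.id_apply]
      rw [← map_smul, smul_eq_mul, mul_one, this]
    · rintro ⟨w, rfl⟩
      ext j
      have := haK j
      simp only [φ, Fintype.linearCombination_apply, smul_eq_mul] at this
      simp [F, A, smul_smul, ← Finset.sum_smul, this]
  let X : CharacterModule (Fin l → I) := ∑ i, CharacterModule.dual (LinearMap.proj i : (Fin l → I) →ₗ[R] I) (x i)
  have hX : CharacterModule.dual F X = 0 := by
    rw [← hx]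
    simp only [X, map_sum]
    refine Finset.sum_congr rfl (fun i _ => ?_)
    rfl
  obtain ⟨y, hy⟩ := (dual_exact _ _ hex X).1 hX
  refine ⟨k, fun i j => a j i, fun j => CharacterModule.dual (LinearMap.single R (fun _ => I) j) y, ?_, ?_⟩
  · intro i
    have h1 : CharacterModule.dual (LinearMap.single R (fun _ => I) i) X = x i := by
      simp only [X, map_sum]
      rw [Finset.sum_eq_single i]
      · ext v
        show x i ((Pi.single i v : Fin l → I) i) = _
        rw [Pi.single_eq_same]
      · intro j _ hj
        ext v
        show x j ((Pi.single i v : Fin l → I) j) = _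
        rw [Pi.single_eq_of_ne hj, map_zero]; rfl
      · simp
    rw [← h1, ← hy]
    have : ∀ j, a j i • CharacterModule.dual (LinearMap.single R (fun _ => I) j) y =
      CharacterModule.dual (a j i • LinearMap.single R (fun _ => I) j) y := fun j => by
        ext v
        show y (Pi.single j (a j i • v)) = y (a j i • Pi.single j v)
        congr 1
        exact (LinearMap.single R (fun _ : Fin k => I) j).map_smul (a j i) v
    have h3 : A ∘ₗ LinearMap.single R (fun _ => I) i = ∑ j, a j i • LinearMap.single R (fun _ => I) j := by
      ext v j
      simp [A, LinearMap.sum_apply, Finset.sum_apply, Pi.single_apply]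
    ext v
    show y ((A ∘ₗ LinearMap.single R (fun _ => I) i) v) = _
    rw [h3]
    have h4 : ∀ (s : Finset (Fin k)) (z : Fin k → CharacterModule I), (∑ j ∈ s, z j) v = ∑ j ∈ s, z j v := by
      intro s z
      exact map_sum (AddMonoidHom.eval v) _ _
    rw [LinearMap.sum_apply, map_sum]
    erw [h4]
    refine Finset.sum_congr rfl (fun j _ => ?_)
    rw [this]
    rfl
  · intro j
    have := haK j
    simp only [φ, Fintype.linearCombination_apply, smul_eq_mul] at this
    rw [← this]
    exact Finset.sum_congr rfl (fun i _ => mul_comm _ _)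

end GGo


namespace GGo
variable {R : Type u} [CommRing R]

/-- projective instance -/
def GP (R : Type u) [CommRing R] : GD R where
  F X := Module.Projective R X
  W X := Module.Projective R X
  W_F h := h
  W_prod := by intro X Y h1 h2; exact inferInstanceAs (Module.Projective R (X × Y))
  F_proj h := h
  F_flat := by intro X h; exact inferInstance
  F_embed := by
    intro X h
    exact ⟨X, Z0, _, _, h, inferInstanceAs (Module.Projective R PUnit.{u+1}), SE.ofIso (LinearEquiv.refl R X)⟩
  ext_van := by intro X Y n h1 h2; exact V_proj
  F_iso := by intro X Y e h; exact Module.Projective.of_equiv e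
  F_sum := by intro X h; exact Module.Projective.of_equiv (finsuppLEquivDirectSum R X ℕ).symm

lemma flat_ker {A B C : ModuleCat.{u} R} {f : A →ₗ[R] B} {g : B →ₗ[R] C} (h : SE f g)
    (hB : Module.Flat R B) (hC : Module.Flat R C) : Module.Flat R A := by
  rw [flat_iff] at *
  exact inj_of_V (fun Z => h.dual.cV_right V_inj V_inj)

lemma V_flat_hom {I B : ModuleCat.{u} R} (hI : Module.Injective R I) (n : ℕ) :
    ∀ {F : ModuleCat.{u} R}, Module.Flat R F → V F (ModuleCat.of R (B →ₗ[R] I)) (n + 1) := by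
  induction n with
  | zero =>
    intro F hF
    obtain ⟨K, P, f, g, hP, hs⟩ := exists_proj F
    refine hs.V_of_extend V_proj (fun a => ?_)
    have h1 := LinearMap.lTensor_injective_of_exact_of_flat g hs.surj f hs.inj hs.ex B
    obtain ⟨c, hc⟩ := hI.out (f.lTensor B) h1 (TensorProduct.lift (LinearMap.flip a))
    refine ⟨LinearMap.flip (TensorProduct.curry c), ?_⟩
    refine LinearMap.ext (fun k => ?_)
    refine LinearMap.ext (M := B) (M₃ := I) (fun (b : B) => ?_)
    have := hc (TensorProduct.tmul R b k)
    simpa using this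
  | succ n ih =>
    intro F hF
    obtain ⟨K, P, f, g, hP, hs⟩ := exists_proj F
    exact hs.V_right (ih (flat_ker hs inferInstance hF)) V_proj

noncomputable def chHom (I : ModuleCat.{u} R) : ch I ≃ₗ[R] (I →ₗ[R] ch (ModuleCat.of R R)) :=
  (CharacterModule.congr (TensorProduct.rid R I)).symm ≪≫ₗ CharacterModule.homEquiv.symm

lemma ch_R_inj : Module.Injective R (ch (ModuleCat.of R R)) := flat_iff.1 (inferInstanceAs (Module.Flat R R))

lemma V_flat_ch {I : ModuleCat.{u} R} (n : ℕ) {F : ModuleCat.{u} R} (hF : Module.Flat R F) :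
    V F (ch I) (n + 1) :=
  cV_iso (Y := ModuleCat.of R (I →ₗ[R] ch (ModuleCat.of R R))) (chHom I) (V_flat_hom ch_R_inj n hF)

noncomputable def chProd (I J : ModuleCat.{u} R) : CharacterModule (I × J) ≃ₗ[R] (ch I × ch J) :=
  LinearEquiv.ofLinear
    (LinearMap.prod (CharacterModule.dual (LinearMap.inl R I J)) (CharacterModule.dual (LinearMap.inr R I J)))
    (LinearMap.coprod (CharacterModule.dual (LinearMap.fst R I J)) (CharacterModule.dual (LinearMap.snd R I J)))
    (by
      refine LinearMap.ext (fun p => Prod.ext ?_ ?_) <;> ext v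
      · show p.1 v + p.2 0 = p.1 v
        rw [map_zero, add_zero]
      · show p.1 0 + p.2 v = p.2 v
        rw [map_zero, zero_add])
    (by
      refine LinearMap.ext (fun p => ?_); ext v
      show p (v.1, 0) + p (0, v.2) = p v
      rw [← map_add]; simp)

/-- evaluation -/
def chev (X : ModuleCat.{u} R) : X →ₗ[R] ch (ch X) where
  toFun x := AddMonoidHom.eval x
  map_add' x y := by ext c; exact map_add c x y
  map_smul' r x := by ext c; rfl

lemma chev_inj (X : ModuleCat.{u} R) : Function.Injective (chev X) := by
  rw [injective_iff_map_eq_zero]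
  intro x hx
  refine CharacterModule.eq_zero_of_character_apply (fun c => ?_)
  exact DFunLike.congr_fun hx c

lemma chev_coker [IsNoetherianRing R] {X C : ModuleCat.{u} R} {g : ch (ch X) →ₗ[R] C}
    (hs : SE (chev X) g) (hX : Module.Flat R X) : Module.Flat R C := by
  obtain ⟨r, hr⟩ := hs.dual.rev (chev (ch X)) (by ext c x; rfl)
  have h1 : Module.Injective R (ch X) := flat_iff.1 hX
  have h2 : Module.Injective R (ch (ch (ch X))) := flat_iff.1 (flat_ch h1)
  exact flat_iff.2 (inj_of_V (fun Z => hr.cV_right V_inj V_inj))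

/-- flat instance -/
def GF (R : Type u) [CommRing R] [IsNoetherianRing R] : GD R where
  F X := Module.Flat R X
  W X := ∃ I : ModuleCat.{u} R, Module.Injective R I ∧ Nonempty (X ≃ₗ[R] ch I)
  W_F := by
    rintro X ⟨I, hI, ⟨e⟩⟩
    have := flat_ch hI
    exact Module.Flat.of_linearEquiv e
  W_prod := by
    rintro X Y ⟨I, hI, ⟨e⟩⟩ ⟨J, hJ, ⟨e'⟩⟩
    exact ⟨ModuleCat.of R (I × J), inj_prod hI hJ, ⟨(LinearEquiv.prodCongr e e') ≪≫ₗ (chProd I J).symm⟩⟩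
  F_proj := by intro X h; exact inferInstance
  F_flat h := h
  F_embed := by
    intro X h
    exact ⟨ch (ch X), _, chev X, _, ⟨ch X, flat_iff.1 h, ⟨LinearEquiv.refl R _⟩⟩,
      chev_coker (SE.ofInj (chev X) (chev_inj X)) h, SE.ofInj (chev X) (chev_inj X)⟩
  ext_van := by
    rintro X Y n h1 ⟨I, hI, ⟨e⟩⟩
    exact cV_iso e (V_flat_ch n h1)
  F_iso := by intro X Y e h; exact Module.Flat.of_linearEquiv e.symm
  F_sum := by intro X h; exact Module.Flat.of_linearEquiv (finsuppLEquivDirectSum R X ℕ)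

end GGo


namespace GGo
variable {R : Type u} [CommRing R]

/-- complete resolutions -/
def GD.CC (D : GD R) (N : Type u) [AddCommGroup N] [Module R N] : Prop :=
  ∃ (Z : ℤ → ModuleCat.{u} R) (d : ∀ i : ℤ, Z i →ₗ[R] Z (i + 1)),
    (∀ i, D.F (Z i)) ∧
    (∀ i, Function.Exact (d i) (d (i + 1))) ∧
    (∀ (P : ModuleCat.{u} R), D.W P →
      ∀ (i : ℤ) (g : Z (i + 1) →ₗ[R] P), g.comp (d i) = 0 →
        ∃ h : Z (i + 1 + 1) →ₗ[R] P, h.comp (d (i + 1)) = g) ∧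
    ∃ π : Z 0 →ₗ[R] N, Function.Surjective π ∧ Function.Exact (d (-1)) π

abbrev rgm {A B : ModuleCat.{u} R} (f : A →ₗ[R] B) : ModuleCat.{u} R := ModuleCat.of R (LinearMap.range f)

lemma SE.rg {A B C : ModuleCat.{u} R} (f : A →ₗ[R] B) (g : B →ₗ[R] C) (h : Function.Exact f g) :
    SE (A := rgm f) (C := rgm g) (LinearMap.range f).subtype g.rangeRestrict := by
  refine ⟨Subtype.val_injective, ?_, LinearMap.surjective_rangeRestrict g⟩
  intro b
  have h1 : g.rangeRestrict b = 0 ↔ g b = 0 := by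
    rw [← LinearMap.mem_ker, LinearMap.ker_rangeRestrict, LinearMap.mem_ker]
  rw [h1, h b]
  constructor
  · rintro ⟨a, rfl⟩; exact ⟨⟨f a, a, rfl⟩, rfl⟩
  · rintro ⟨⟨_, a, rfl⟩, rfl⟩; exact ⟨a, rfl⟩

variable {D : GD R}

lemma GD.CC_G {N : ModuleCat.{u} R} (h : D.CC N) : D.G N := by
  obtain ⟨Z, d, hF, hex, hW, π, hπ, hπ'⟩ := h
  have hev : ∀ (Y : ModuleCat.{u} R), D.W Y → ∀ (n : ℕ) (i : ℤ), V (rgm (d i)) Y (n + 1) := by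
    intro Y hY n
    induction n with
    | zero =>
      intro i
      obtain ⟨k, rfl⟩ : ∃ k, i = k + 1 + 1 := ⟨i - 2, by ring⟩
      refine (SE.rg _ _ (hex (k + 1))).V_of_extend (D.ext_van 0 (hF _) hY) (fun a => ?_)
      obtain ⟨h, hh⟩ := hW Y hY k (a ∘ₗ (d (k + 1)).rangeRestrict) (by
        ext z
        have : (d (k + 1)).rangeRestrict (d k z) = 0 := by
          apply Subtype.ext
          exact (hex k _).2 ⟨z, rfl⟩
        simp only [LinearMap.comp_apply]
        rw [this, map_zero]; rfl)
      refine ⟨h, ?_⟩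
      refine LinearMap.ext ?_
      rintro ⟨_, z, rfl⟩
      exact LinearMap.congr_fun hh z
    | succ n ih =>
      intro i
      obtain ⟨k, rfl⟩ : ∃ k, i = k + 1 := ⟨i - 1, by ring⟩
      exact (SE.rg _ _ (hex k)).V_right (ih k) (D.ext_van (n + 1) (hF _) hY)
  have key : ∀ i, D.G (rgm (d i)) := by
    intro i
    refine GD.L1 (fun X => ∃ i, X = rgm (d i)) ?_ (GD.Cl.base _ ⟨i, rfl⟩)
    rintro _ ⟨i, rfl⟩
    exact ⟨fun Y n hY => hev Y hY n i, _, _, _, _, hF _, GD.Cl.base _ ⟨i + 1, rfl⟩, SE.rg _ _ (hex i)⟩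
  have h0 : Function.Exact (d (-1)) (d 0) := hex (-1)
  have hk : LinearMap.ker (d 0) = LinearMap.ker π := by
    ext z
    rw [LinearMap.mem_ker, LinearMap.mem_ker, h0 z, hπ' z]
  exact GD.G_iso ((LinearMap.quotKerEquivRange (d 0)).symm ≪≫ₗ Submodule.quotEquivOfEq _ _ hk ≪≫ₗ
    LinearMap.quotKerEquivOfSurjective π hπ) (key 0)

lemma GD.G_CC {N : ModuleCat.{u} R} (h : D.G N) : D.CC N := by
  classical
  have hup : ∀ X : {X : ModuleCat.{u} R // D.G X}, ∃ Y : {X : ModuleCat.{u} R // D.G X},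
      ∃ (Z : ModuleCat.{u} R) (f : X.1 →ₗ[R] Z) (g : Z →ₗ[R] Y.1), D.F Z ∧ SE f g := by
    rintro ⟨X, hX⟩
    obtain ⟨W, C, f, g, hW, hC, hs⟩ := hX.step
    exact ⟨⟨C, hC⟩, W, f, g, D.W_F hW, hs⟩
  have hdn : ∀ X : {X : ModuleCat.{u} R // D.G X}, ∃ Y : {X : ModuleCat.{u} R // D.G X},
      ∃ (Z : ModuleCat.{u} R) (f : Y.1 →ₗ[R] Z) (g : Z →ₗ[R] X.1), D.F Z ∧ SE f g := by
    rintro ⟨X, hX⟩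
    obtain ⟨K, P, f, g, hP, hs⟩ := exists_proj X
    exact ⟨⟨K, GD.syz hs (D.F_proj hP) hX⟩, P, f, g, D.F_proj hP, hs⟩
  choose up hup using hup
  choose dn hdn using hdn
  let UP : ℕ → {X : ModuleCat.{u} R // D.G X} := fun n => Nat.rec ⟨N, h⟩ (fun _ X => up X) n
  let DN : ℕ → {X : ModuleCat.{u} R // D.G X} := fun n => Nat.rec (dn ⟨N, h⟩) (fun _ X => dn X) n
  obtain ⟨T, hT0, hT⟩ : ∃ T : ℤ → {X : ModuleCat.{u} R // D.G X}, T 0 = ⟨N, h⟩ ∧ ∀ i j : ℤ, j = i + 1 →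
      ∃ (Z : ModuleCat.{u} R) (f : (T i).1 →ₗ[R] Z) (g : Z →ₗ[R] (T j).1), D.F Z ∧ SE f g := by
    let T : ℤ → {X : ModuleCat.{u} R // D.G X} := fun i => match i with
      | Int.ofNat n => UP n
      | Int.negSucc n => DN n
    have hT : ∀ i j : ℤ, j = i + 1 → ∃ (Z : ModuleCat.{u} R) (f : (T i).1 →ₗ[R] Z) (g : Z →ₗ[R] (T j).1),
        D.F Z ∧ SE f g := by
      intro i j hj
      subst hj
      match i with
      | Int.ofNat n => exact hup (UP n)
      | Int.negSucc 0 => exact hdn ⟨N, h⟩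
      | Int.negSucc (n + 1) => exact hdn (DN n)
    exact ⟨T, rfl, hT⟩
  suffices hh : D.CC (T 0).1 by rw [hT0] at hh; exact hh
  choose Z ι π hF hs using fun i : ℤ => hT (i - 1) (i + 1 - 1) (by ring)
  refine ⟨Z, fun i => ι (i + 1) ∘ₗ π i, hF, ?_, ?_, π 0, (hs 0).surj, ?_⟩
  · intro i z
    simp only [LinearMap.comp_apply]
    rw [map_eq_zero_iff _ (hs _).inj, (hs (i + 1)).ex z]
    constructor
    · rintro ⟨x, rfl⟩
      obtain ⟨y, rfl⟩ := (hs i).surj x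
      exact ⟨y, rfl⟩
    · rintro ⟨y, rfl⟩
      exact ⟨_, rfl⟩
  · intro P hP i g hg
    have h1 : g ∘ₗ ι (i + 1) = 0 := by
      refine LinearMap.ext (fun x => ?_)
      obtain ⟨y, rfl⟩ := (hs i).surj x
      exact LinearMap.congr_fun hg y
    have h2 : LinearMap.ker (π (i + 1)) ≤ LinearMap.ker g := by
      intro z hz
      obtain ⟨x, rfl⟩ := ((hs (i + 1)).ex z).1 hz
      exact LinearMap.congr_fun h1 x
    let a := ((LinearMap.ker (π (i + 1))).liftQ g h2) ∘ₗ
      (LinearMap.quotKerEquivOfSurjective (π (i + 1)) (hs (i + 1)).surj).symm.toLinearMap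
    have ha : a ∘ₗ π (i + 1) = g := by
      refine LinearMap.ext (fun z => ?_)
      have : (LinearMap.quotKerEquivOfSurjective (π (i + 1)) (hs (i + 1)).surj).symm (π (i + 1) z) =
        Submodule.Quotient.mk z := by
        rw [LinearEquiv.symm_apply_eq]; rfl
      simp only [a, LinearMap.comp_apply, LinearEquiv.coe_coe, this]
      rfl
    obtain ⟨b, hb⟩ := (hs (i + 1 + 1)).extend ((T _).2.ev P 0 hP) a
    exact ⟨b, by rw [← ha, ← hb]; rfl⟩
  · have key : ∀ k : ℤ, Function.Exact (ι (k + 1) ∘ₗ π k) (π (k + 1)) := by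
      intro k z
      rw [(hs (k + 1)).ex z]
      constructor
      · rintro ⟨x, rfl⟩
        obtain ⟨y, rfl⟩ := (hs k).surj x
        exact ⟨y, rfl⟩
      · rintro ⟨y, rfl⟩
        exact ⟨_, rfl⟩
    exact key (-1)

lemma GP_iff {N : ModuleCat.{u} R} : Paper.IsGorensteinProjective R N ↔ (GP R).G N :=
  ⟨fun h => GD.CC_G h, fun h => GD.G_CC h⟩

lemma tensor_exact_iff {A B C : ModuleCat.{u} R} (f : A →ₗ[R] B) (g : B →ₗ[R] C) (hfg : g ∘ₗ f = 0)
    (I : ModuleCat.{u} R) :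
    Function.Exact (LinearMap.rTensor (R := R) I f) (LinearMap.rTensor (R := R) I g) ↔
    ∀ a : B →ₗ[R] ch I, a ∘ₗ f = 0 → ∃ b : C →ₗ[R] ch I, b ∘ₗ g = a := by
  constructor
  · intro h a ha
    obtain ⟨c, hc⟩ := (dual_exact _ _ h (CharacterModule.homEquiv a)).1 (by
      have : CharacterModule.dual (LinearMap.rTensor (R := R) I f) (CharacterModule.homEquiv a) =
        CharacterModule.homEquiv (a ∘ₗ f) := by
        apply CharacterModule.homEquiv.symm.injective
        rw [LinearEquiv.symm_apply_apply]
        rfl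
      rw [this, ha, map_zero])
    refine ⟨CharacterModule.homEquiv.symm c, ?_⟩
    apply CharacterModule.homEquiv.injective
    rw [← hc]
    apply CharacterModule.homEquiv.symm.injective
    rw [LinearEquiv.symm_apply_apply]
    rfl
  · intro h
    apply dual_exact_iff
    intro c
    constructor
    · intro hc
      obtain ⟨b, hb⟩ := h (CharacterModule.homEquiv.symm c) (by
        have : CharacterModule.homEquiv.symm c ∘ₗ f =
          CharacterModule.homEquiv.symm (CharacterModule.dual (LinearMap.rTensor (R := R) I f) c) := rfl
        rw [this, hc, map_zero])
      refine ⟨CharacterModule.homEquiv b, ?_⟩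
      apply CharacterModule.homEquiv.symm.injective
      rw [← hb]
      rfl
    · rintro ⟨c, rfl⟩
      rw [← LinearMap.comp_apply, ← CharacterModule.dual_comp, ← LinearMap.rTensor_comp, hfg,
        LinearMap.rTensor_zero, CharacterModule.dual_zero]
      rfl

lemma GF_iff [IsNoetherianRing R] {N : ModuleCat.{u} R} : Paper.IsGorensteinFlat R N ↔ (GF R).G N := by
  rw [show (GF R).G N ↔ (GF R).CC N from ⟨GD.G_CC, GD.CC_G⟩]
  constructor
  · rintro ⟨Z, d, h1, h2, h3, h4⟩
    refine ⟨Z, d, h1, h2, ?_, h4⟩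
    rintro P ⟨I, hI, ⟨e⟩⟩ i g hg
    obtain ⟨b, hb⟩ := (tensor_exact_iff _ _ (h2 i).linearMap_comp_eq_zero I).1 (h3 I hI i)
      (e.toLinearMap ∘ₗ g) (by rw [LinearMap.comp_assoc, hg, LinearMap.comp_zero])
    refine ⟨e.symm.toLinearMap ∘ₗ b, ?_⟩
    rw [LinearMap.comp_assoc, hb]
    ext z
    simp
  · rintro ⟨Z, d, h1, h2, h3, h4⟩
    refine ⟨Z, d, h1, h2, ?_, h4⟩
    intro I hI i
    rw [tensor_exact_iff _ _ (h2 i).linearMap_comp_eq_zero I]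
    exact h3 (ch I) ⟨I, hI, ⟨LinearEquiv.refl R _⟩⟩ i

end GGo


namespace GGo
variable {R : Type u} [CommRing R]

lemma post_sum {X Y Y' : ModuleCat.{u} R} {n : ℕ} {ι : Type*} (s : Finset ι) (f : ι → (Y →ₗ[R] Y'))
    (e : EX X Y n) : post (∑ i ∈ s, f i) e = ∑ i ∈ s, post (f i) e := by
  classical
  induction s using Finset.induction_on with
  | empty => simp [post_zero]
  | insert a s ha ih => rw [Finset.sum_insert ha, Finset.sum_insert ha, post_add, ih]

lemma V_fin {X : ModuleCat.{u} R} {n k : ℕ} {Y : ModuleCat.{u} R} (h : V X Y n) :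
    V X (ModuleCat.of R (Fin k →₀ Y)) n := by
  intro e
  have hid : (LinearMap.id : (Fin k →₀ Y) →ₗ[R] (Fin k →₀ Y)) =
      ∑ i : Fin k, (Finsupp.lsingle i) ∘ₗ (Finsupp.lapply i) := by
    ext i x j
    simp [LinearMap.sum_apply, Finsupp.single_apply, Finsupp.finset_sum_apply]
  rw [← post_id e]
  have := post_sum (X := X) (n := n) (Y := ModuleCat.of R (Fin k →₀ Y))
    (Y' := ModuleCat.of R (Fin k →₀ Y)) Finset.univ
    (fun i : Fin k => (Finsupp.lsingle i) ∘ₗ (Finsupp.lapply i)) e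
  refine ((congrArg (fun f => post f e) hid).trans this).trans ?_
  refine Finset.sum_eq_zero (fun i _ => ?_)
  rw [post_comp (Y' := Y), h (post (Y' := Y) _ e), map_zero]

lemma exists_proj_fin [IsNoetherianRing R] (X : ModuleCat.{u} R) [Module.Finite R X] :
    ∃ (K P : ModuleCat.{u} R) (f : K →ₗ[R] P) (g : P →ₗ[R] X),
    Module.Projective R P ∧ Module.Finite R P ∧ Module.Finite R K ∧ SE f g := by
  obtain ⟨n, f, hf⟩ := Module.Finite.exists_fin' R X
  refine ⟨_, ModuleCat.of R (Fin n → R), _, f, inferInstanceAs (Module.Projective R (Fin n → R)),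
    inferInstanceAs (Module.Finite R (Fin n → R)), ?_, SE.ofSurj (B := ModuleCat.of R (Fin n → R)) f hf⟩
  exact inferInstanceAs (Module.Finite R (LinearMap.ker f))

/-- universal classes -/
lemma LU [IsNoetherianRing R] (j : ℕ) : ∀ (M : ModuleCat.{u} R) [Module.Finite R M],
    ∃ (N : ModuleCat.{u} R) (e : EX M N j), Module.Finite R N ∧
      ∀ (Y : ModuleCat.{u} R) (c : EX M Y j), ∃ f : N →ₗ[R] Y, post f e = c := by
  induction j with
  | zero =>
    intro M hM
    refine ⟨M, m0 LinearMap.id, hM, fun Y c => ?_⟩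
    obtain ⟨a, rfl⟩ := m0.surjective c
    exact ⟨a, by rw [post_m0]; rfl⟩
  | succ j ih =>
    intro M hM
    obtain ⟨K, P, f, g, hP, hP2, hK, hs⟩ := exists_proj_fin M
    obtain ⟨N, e, hN, he⟩ := ih K
    refine ⟨N, hs.d e, hN, fun Y c => ?_⟩
    obtain ⟨b, rfl⟩ := hs.ctr3 c (V_proj _)
    obtain ⟨a, rfl⟩ := he Y b
    exact ⟨a, by rw [hs.d_post]⟩

abbrev RR (R : Type u) [CommRing R] : ModuleCat.{u} R := ModuleCat.of R R

lemma V_flat_of_R [IsNoetherianRing R] {M W : ModuleCat.{u} R} [Module.Finite R M] (hW : Module.Flat R W)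
    {j : ℕ} (h : V M (RR R) j) : V M W j := by
  intro c
  obtain ⟨N, e, hN, he⟩ := LU j M
  obtain ⟨f, rfl⟩ := he W c
  have : Module.FinitePresentation R N := Module.finitePresentation_of_finite R N
  obtain ⟨k, h2, h3, rfl⟩ := Module.Flat.exists_factorization_of_finitePresentation f
  rw [post_comp (Y' := ModuleCat.of R (Fin k →₀ R)) h2 h3, V_fin (Y := RR R) h (post (Y' := ModuleCat.of R (Fin k →₀ R)) h2 e), map_zero]

lemma SE.cokerIso {A B C C' : ModuleCat.{u} R} {f : A →ₗ[R] B} {g : B →ₗ[R] C} {g' : B →ₗ[R] C'}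
    (h : SE f g) (h' : SE f g') : Nonempty (C ≃ₗ[R] C') := by
  have : LinearMap.ker g = LinearMap.ker g' := by
    ext z
    rw [LinearMap.mem_ker, LinearMap.mem_ker, h.ex z, h'.ex z]
  exact ⟨(LinearMap.quotKerEquivOfSurjective g h.surj).symm ≪≫ₗ Submodule.quotEquivOfEq _ _ this ≪≫ₗ
    LinearMap.quotKerEquivOfSurjective g' h'.surj⟩

lemma SE.proj_right {A B C : ModuleCat.{u} R} {f : A →ₗ[R] B} {g : B →ₗ[R] C} (h : SE f g)
    (r : B →ₗ[R] A) (hr : r ∘ₗ f = LinearMap.id) (hB : Module.Projective R B) : Module.Projective R C := by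
  obtain ⟨s, hs⟩ : ∃ s : C →ₗ[R] B, g ∘ₗ s = LinearMap.id := by
    have hk : LinearMap.ker g ≤ LinearMap.ker (LinearMap.id - f ∘ₗ r) := by
      intro b hb
      obtain ⟨a, rfl⟩ := (h.ex b).1 hb
      have := LinearMap.congr_fun hr a
      simp only [LinearMap.comp_apply, LinearMap.id_apply] at this
      simp [this]
    refine ⟨((LinearMap.ker g).liftQ _ hk) ∘ₗ (LinearMap.quotKerEquivOfSurjective g h.surj).symm.toLinearMap, ?_⟩
    refine LinearMap.ext (fun c => ?_)
    obtain ⟨b, rfl⟩ := h.surj c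
    have : (LinearMap.quotKerEquivOfSurjective g h.surj).symm (g b) = Submodule.Quotient.mk b := by
      rw [LinearEquiv.symm_apply_eq]; rfl
    simp [this, h.gf]
  exact Module.Projective.of_split s g hs

lemma GP_fin_embed [IsNoetherianRing R] {X : ModuleCat.{u} R} [hX : Module.Finite R X] (h : (GP R).G X) :
    ∃ (F C : ModuleCat.{u} R) (f : X →ₗ[R] F) (g : F →ₗ[R] C), Module.Projective R F ∧
      Module.Finite R C ∧ (GP R).G C ∧ SE f g := by
  classical
  obtain ⟨P, C, f, g, hP, hC, hs⟩ := h.step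
  have hP : Module.Projective R P := hP
  obtain ⟨s, hs'⟩ := Module.projective_def'.1 hP
  let L : ModuleCat.{u} R := ModuleCat.of R (P →₀ R)
  have hL : Module.Projective R L := inferInstanceAs (Module.Projective R (P →₀ R))
  let s' : P →ₗ[R] L := s
  let t : L →ₗ[R] P := Finsupp.linearCombination R id
  have hts : t ∘ₗ s' = LinearMap.id := hs'
  have hinj : Function.Injective s' := fun a b hab => by
    have := congrArg t hab
    have h1 := LinearMap.congr_fun hts a
    have h2 := LinearMap.congr_fun hts b
    exact h1.symm.trans (this.trans h2)
  have hq := SE.ofInj s' hinj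
  have hQ := hq.proj_right t hts hL
  obtain ⟨C', a, b, c, k1, k2, _⟩ := hs.S1 hq
  have hC' : (GP R).G C' := GD.G_ext k2 hC (GD.G_proj hQ)
  let i : X →ₗ[R] L := s' ∘ₗ f
  obtain ⟨T, hT⟩ := hX.fg_top
  let S : Finset P := T.biUnion (fun x => (show P →₀ R from i x).support)
  let F : Submodule R (P →₀ R) := Finsupp.supported R R (S : Set P)
  have hi : ∀ x, i x ∈ F := by
    have : (⊤ : Submodule R X) ≤ F.comap i := by
      rw [← hT, Submodule.span_le]
      intro x hx
      show i x ∈ F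
      rw [Finsupp.mem_supported]
      exact_mod_cast Finset.subset_biUnion_of_mem (fun x => (show P →₀ R from i x).support) hx
    exact fun x => this (Submodule.mem_top)
  have hF := SE.ofSub (B := L) F
  have hF' := hF.proj_right (Finsupp.restrictDom R R (S : Set P))
    (by exact Finsupp.restrictDom_comp_subtype (S : Set P)) hL
  have eF : F ≃ₗ[R] (S →₀ R) := Finsupp.supportedEquivFinsupp (S : Set P)
  have hFp : Module.Projective R F := Module.Projective.of_equiv eF.symm
  have hFf : Module.Finite R F := Module.Finite.equiv eF.symm
  let i' : X →ₗ[R] F := LinearMap.codRestrict F i hi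
  have hi' : Function.Injective i' := by
    intro x y hxy
    exact k1.inj (congrArg Subtype.val hxy)
  have m1 := SE.ofInj (B := ModuleCat.of R F) i' hi'
  obtain ⟨C'', a', b', c', l1, l2, _⟩ := m1.S1 hF
  have l1' : SE i a' := l1
  obtain ⟨e⟩ := k1.cokerIso l1'
  have hC'' : (GP R).G C'' := GD.G_iso e hC'
  refine ⟨_, _, _, _, hFp, ?_, GD.L3 l2 hC'' (GD.G_proj hF'), m1⟩
  exact Module.Finite.of_surjective (M := F) _ m1.surj

lemma GP_GF [IsNoetherianRing R] {X : ModuleCat.{u} R} [hX : Module.Finite R X] (h : (GP R).G X) : (GF R).G X := by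
  refine GD.L1 (fun X => Module.Finite R X ∧ (GP R).G X) ?_ (GD.Cl.base _ ⟨hX, h⟩)
  rintro X ⟨hX, h⟩
  refine ⟨fun Y n hY => V_flat_of_R ((GF R).W_F hY)
    (h.ev (RR R) n (inferInstanceAs (Module.Projective R R))), ?_⟩
  obtain ⟨F, C, f, g, h1, h2, h3, h4⟩ := GP_fin_embed h
  exact ⟨F, C, f, g, (GF R).F_proj h1, GD.Cl.base _ ⟨h2, h3⟩, h4⟩

lemma GP_GF_LE [IsNoetherianRing R] {s : ℕ} {X : ModuleCat.{u} R} [hX : Module.Finite R X] (h : (GP R).LE s X) :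
    (GF R).LE s X := by
  induction s generalizing X with
  | zero => exact GP_GF h
  | succ s ih =>
    obtain ⟨K, P, f, g, hP, hP2, hK, hs⟩ := exists_proj_fin X
    refine GD.LE_succ hs (ih ?_) (GD.G_proj hP)
    have h1 : (GP R).LE (s + 1) K := by
      obtain ⟨K', X', f', g', k1, k2, k3⟩ := GD.LE_cases h
      obtain ⟨Q, a, b, a', b', q1, q2, _⟩ := hs.S3 k1
      have : (GP R).LE s Q := GD.LE_ext1 q2 k2 (GD.G_proj hP)
      exact resLE_mono (Nat.le_succ s) (GD.LE_K q1 this k3)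
    refine GD.L7 h1 (fun Y hY j hj => ?_)
    exact hs.V_left (by obtain ⟨j, rfl⟩ := Nat.exists_eq_succ_of_ne_zero (by omega : j ≠ 0); exact V_proj)
      (GD.LE_ev h hY (j + 1) (by omega))

end GGo


namespace GGo
open scoped Pointwise
variable {R : Type u} [CommRing R]

/-- derived Nakayama -/
lemma dNak {H Y : ModuleCat.{u} R} {j : ℕ} (x : R) (hH : ∀ h : H, ∃ k : ℕ, x ^ k • h = 0)
    (hs : ∀ c : EX H Y j, ∃ c', x • c' = c) : V H Y j := by
  intro c0
  choose F hF using hs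
  let c : ℕ → EX H Y j := fun i => Nat.rec c0 (fun _ p => F p) i
  have hc : ∀ i, x • c (i + 1) = c i := fun i => hF _
  obtain ⟨E, hE⟩ := DS_exists j c
  let ps : Sm H →ₗ[R] Sm H := LinearMap.id - x • (Finsupp.lmapDomain H R Nat.succ)
  have h0 : pre ps E = 0 := by
    apply DS_eq
    intro i
    rw [← LinearMap.comp_apply]
    have h1 : ps ∘ₗ sg i = sg i + (-x) • sg (i + 1) := by
      apply LinearMap.ext
      intro h
      simp only [ps, LinearMap.comp_apply, LinearMap.sub_apply, LinearMap.add_apply,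
        LinearMap.smul_apply, LinearMap.id_apply, Finsupp.lmapDomain_apply, Finsupp.lsingle_apply,
        Finsupp.mapDomain_single, neg_smul]
      exact sub_eq_add_neg _ _
    rw [LinearMap.comp_apply, ← pre_comp, h1, pre_add, pre_smul, hE, hE, neg_smul, hc]
    exact add_neg_cancel _
  have hsurj : Function.Surjective ps := by
    have key : ∀ (k i : ℕ) (h : H), x ^ k • h = 0 → sg i h ∈ LinearMap.range ps := by
      intro k
      induction k with
      | zero => intro i h hh; rw [pow_zero, one_smul] at hh; rw [hh, map_zero]; exact zero_mem _
      | succ k ih =>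
        intro i h hh
        have h2 := ih (i + 1) (x • h) (by rw [← mul_smul, ← pow_succ]; exact hh)
        have : sg i h = ps (sg i h) + sg (i + 1) (x • h) := by
          simp only [ps, LinearMap.sub_apply,
            LinearMap.smul_apply, LinearMap.id_apply, Finsupp.lmapDomain_apply, Finsupp.lsingle_apply,
            Finsupp.mapDomain_single]
          rw [Finsupp.smul_single]; simp
        rw [this]
        exact add_mem ⟨_, rfl⟩ h2
    rw [← LinearMap.range_eq_top, eq_top_iff]
    rintro v -
    induction v using Finsupp.induction_linear with
    | zero => exact zero_mem _
    | add a b ha hb => exact add_mem ha hb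
    | single i h => obtain ⟨k, hk⟩ := hH h; exact key k i h hk
  have hinj : Function.Injective ps := by
    rw [injective_iff_map_eq_zero]
    intro v hv
    have h1 : v = x • Finsupp.mapDomain Nat.succ v := sub_eq_zero.1 hv
    have h2 : ∀ i, v i = 0 := by
      intro i
      induction i with
      | zero =>
        have := DFunLike.congr_fun h1 0
        rw [this, Finsupp.smul_apply, Finsupp.mapDomain_notin_range, smul_zero]
        simp
      | succ i ih =>
        have := DFunLike.congr_fun h1 (i + 1)
        rw [this, Finsupp.smul_apply, show i + 1 = Nat.succ i from rfl,
          Finsupp.mapDomain_apply Nat.succ_injective, ih, smul_zero]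
    ext i; exact h2 i
  let e := LinearEquiv.ofBijective ps ⟨hinj, hsurj⟩
  have h3 : E = 0 := by
    have : (ps ∘ₗ e.symm.toLinearMap) = LinearMap.id := by
      refine LinearMap.ext (fun v => ?_); exact e.apply_symm_apply v
    rw [← pre_id E, ← this, pre_comp, h0, map_zero]
  have := hE 0
  rw [h3, map_zero] at this
  exact this.symm

lemma SE.qs {Y : ModuleCat.{u} R} {r : R} (h : IsSMulRegular Y r) :
    SE (C := ModuleCat.of R (QuotSMulTop r Y)) (r • (LinearMap.id : Y →ₗ[R] Y))
      (r • (⊤ : Submodule R Y)).mkQ := by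
  refine ⟨h, fun y => ?_, Submodule.mkQ_surjective _⟩
  rw [Submodule.mkQ_apply, Submodule.Quotient.mk_eq_zero, Submodule.mem_smul_pointwise_iff_exists]
  simp

/-- quotient by a list of elements -/
def Q : List R → ModuleCat.{u} R → ModuleCat.{u} R
  | [], Y => Y
  | r :: rs, Y => Q rs (ModuleCat.of R (QuotSMulTop r Y))

lemma Q_kill (rs : List R) : ∀ (Y : ModuleCat.{u} R), (∃ I : Ideal R, Ideal.ofList rs ≤ I) →
    ∀ r ∈ Ideal.ofList rs, ∀ y : Q rs Y, r • y = 0 := by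
  suffices h : ∀ (Y : ModuleCat.{u} R) (J : Ideal R), (∀ r ∈ J, ∀ y : Y, r • y = 0) →
      ∀ r ∈ J ⊔ Ideal.ofList rs, ∀ y : Q rs Y, r • y = 0 by
    intro Y _ r hr
    exact h Y ⊥ (fun r hr y => by rw [(Submodule.mem_bot R).1 hr, zero_smul]) r (by simpa using hr)
  induction rs with
  | nil => intro Y J hJ r hr; exact hJ r (by simpa using hr)
  | cons a rs ih =>
    intro Y J hJ r hr
    refine ih (ModuleCat.of R (QuotSMulTop a Y)) (J ⊔ Ideal.span {a}) ?_ r ?_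
    · intro r hr y
      obtain ⟨y, rfl⟩ := Submodule.mkQ_surjective _ y
      obtain ⟨b, hb, c, hc, rfl⟩ := Submodule.mem_sup.1 hr
      obtain ⟨t, rfl⟩ := Ideal.mem_span_singleton'.1 hc
      rw [← map_smul, add_smul, hJ b hb, zero_add, mul_comm, mul_smul, Submodule.mkQ_apply,
        Submodule.Quotient.mk_eq_zero]
      exact Submodule.smul_mem_pointwise_smul _ _ _ trivial
    · rw [Ideal.ofList_cons, ← sup_assoc] at hr; exact hr

lemma wr_cons {Y : ModuleCat.{u} R} {a : R} {rs : List R}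
    (h : RingTheory.Sequence.IsWeaklyRegular Y (a :: rs)) :
    IsSMulRegular Y a ∧ RingTheory.Sequence.IsWeaklyRegular (ModuleCat.of R (QuotSMulTop a Y)) rs :=
  (RingTheory.Sequence.isWeaklyRegular_cons_iff _ _ _).1 h

lemma Q_V {G : ModuleCat.{u} R} (rs : List R) : ∀ (Y : ModuleCat.{u} R),
    RingTheory.Sequence.IsWeaklyRegular Y rs → (∀ j, V G Y (j + 1)) → ∀ j, V G (Q rs Y) (j + 1) := by
  induction rs with
  | nil => intro Y _ h; exact h
  | cons a rs ih =>
    intro Y hY h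
    obtain ⟨h1, h2⟩ := wr_cons hY
    exact ih _ h2 (fun j => (SE.qs h1).cV_right (h j) (h (j + 1)))

lemma Q_V' {H : ModuleCat.{u} R} {j : ℕ} (rs : List R) (hH : ∀ x ∈ rs, ∀ h : H, ∃ k : ℕ, x ^ k • h = 0) :
    ∀ (Y : ModuleCat.{u} R), RingTheory.Sequence.IsWeaklyRegular Y rs → V H (Q rs Y) j → V H Y j := by
  induction rs with
  | nil => intro Y _ h; exact h
  | cons a rs ih =>
    intro Y hY h
    obtain ⟨h1, h2⟩ := wr_cons hY
    have h3 := ih (fun x hx => hH x (List.mem_cons_of_mem _ hx)) _ h2 h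
    refine dNak a (hH a List.mem_cons_self) (fun c => ?_)
    obtain ⟨b, hb⟩ := (SE.qs h1).cov2 c (h3 _)
    exact ⟨b, by rw [← hb, post_smul, post_id]⟩

lemma flat_wr {W : ModuleCat.{u} R} (hW : Module.Flat R W) {rs : List R}
    (h : RingTheory.Sequence.IsWeaklyRegular R rs) : RingTheory.Sequence.IsWeaklyRegular W rs := by
  have := h.isWeaklyRegular_lTensor (M₂ := W)
  exact ((TensorProduct.rid R W).isWeaklyRegular_congr rs).1 this

end GGo


namespace GGo
open scoped Pointwise
variable {R : Type u} [CommRing R]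

lemma resF_hom {D : GD R} {I B : ModuleCat.{u} R} (hI : Module.Injective R I) {s : ℕ} :
    ∀ {L : ModuleCat.{u} R}, Paper.ResDimLE R D.F s L → ∀ j, s < j → V L (ModuleCat.of R (B →ₗ[R] I)) j := by
  induction s with
  | zero =>
    intro L hL j hj
    obtain ⟨j, rfl⟩ : ∃ k, j = k + 1 := ⟨j - 1, by omega⟩
    exact V_flat_hom hI j (D.F_flat hL)
  | succ s ih =>
    intro L hL j hj
    obtain ⟨j, rfl⟩ : ∃ k, j = k + 1 + 1 := ⟨j - 2, by omega⟩
    rcases hL with hL | ⟨X, f, hX, hf, hK⟩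
    · exact ih hL _ (by omega)
    · exact (SE.ofSurj f hf).V_right (ih hK _ (by omega)) (V_flat_hom hI _ (D.F_flat hX))

lemma V_sub0 {X Y : ModuleCat.{u} R} {n : ℕ} (h : ∀ y : Y, y = 0) : V X Y n := fun e => by
  have : (LinearMap.id : Y →ₗ[R] Y) = 0 := LinearMap.ext fun y => h y
  rw [← post_id e, this, post_zero]

lemma semi_kill {m : Ideal R} [hm : m.IsMaximal] {Z : Type u} [AddCommGroup Z] [Module R Z]
    (hZ : ∀ r ∈ m, ∀ z : Z, r • z = 0) : IsSemisimpleModule R Z := by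
  have h : Module.IsTorsionBySet R Z m := fun z r => hZ r r.2 z
  rw [← h.isSemisimpleModule_iff]
  letI := Ideal.Quotient.field m
  letI := h.module
  infer_instance

lemma Vm {m : Ideal R} [hm : m.IsMaximal] {L : ModuleCat.{u} R} {j : ℕ}
    (h : ∀ I : ModuleCat.{u} R, Module.Injective R I → V L (ModuleCat.of R ((R ⧸ m) →ₗ[R] I)) j)
    (Y : ModuleCat.{u} R) (hY : ∀ r ∈ m, ∀ y : Y, r • y = 0) : V L Y j := by
  obtain ⟨I, C, f, g, hI, hs⟩ := exists_inj Y
  let s : Y →ₗ[R] ((R ⧸ m) →ₗ[R] I) :=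
    { toFun := fun y => m.liftQ (LinearMap.toSpanSingleton R I (f y)) (fun r hr => by
        rw [LinearMap.mem_ker, LinearMap.toSpanSingleton_apply, ← map_smul, hY r hr, map_zero])
      map_add' := fun a b => by
        refine LinearMap.ext fun q => ?_
        obtain ⟨q, rfl⟩ := Submodule.mkQ_surjective _ q
        change q • f (a + b) = q • f a + q • f b
        rw [map_add, smul_add]
      map_smul' := fun a b => by
        refine LinearMap.ext fun q => ?_
        obtain ⟨q, rfl⟩ := Submodule.mkQ_surjective _ q
        change q • f (a • b) = a • (q • f b)
        rw [map_smul, smul_comm] }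
  have hsi : Function.Injective s := by
    intro a b hab
    apply hs.inj
    have := LinearMap.congr_fun hab (Submodule.mkQ _ 1)
    have h2 : (1 : R) • f a = (1 : R) • f b := this
    simpa using h2
  haveI : IsSemisimpleModule R ((R ⧸ m) →ₗ[R] I) := by
    apply semi_kill (m := m)
    intro r hr z
    refine LinearMap.ext fun q => ?_
    obtain ⟨q, rfl⟩ := Submodule.mkQ_surjective _ q
    rw [LinearMap.smul_apply, ← map_smul, ← map_smul, LinearMap.zero_apply]
    have : m.mkQ (r • q) = 0 := by
      rw [Submodule.mkQ_apply, Submodule.Quotient.mk_eq_zero]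
      exact m.mul_mem_right _ hr
    rw [this, map_zero]
  obtain ⟨t, ht⟩ := IsSemisimpleModule.extension_property s hsi LinearMap.id
  exact cV_retract (Y := ModuleCat.of R ((R ⧸ m) →ₗ[R] I)) s t ht (h I hI)

lemma Vpow {m : Ideal R} {L : ModuleCat.{u} R} {j : ℕ}
    (h : ∀ Y : ModuleCat.{u} R, (∀ r ∈ m, ∀ y : Y, r • y = 0) → V L Y j) (N : ℕ) :
    ∀ (Y : ModuleCat.{u} R), (∀ r ∈ m ^ N, ∀ y : Y, r • y = 0) → V L Y j := by
  induction N with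
  | zero =>
    intro Y hY
    exact V_sub0 (fun y => by simpa using hY 1 (by simp) y)
  | succ N ih =>
    intro Y hY
    refine (SE.ofSub (B := Y) (m • (⊤ : Submodule R Y))).cV_mid (ih _ ?_) (h _ ?_)
    · rintro r hr ⟨y, hy⟩
      apply Subtype.ext
      change r • y = 0
      refine Submodule.smul_induction_on hy (fun a ha b _ => ?_) (fun a b ha hb => ?_)
      · rw [← mul_smul]
        exact hY _ (by rw [pow_succ]; exact Ideal.mul_mem_mul hr ha) _
      · rw [smul_add, ha, hb, add_zero]
    · intro r hr y
      obtain ⟨y, rfl⟩ := Submodule.mkQ_surjective _ y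
      rw [← map_smul, Submodule.mkQ_apply, Submodule.Quotient.mk_eq_zero]
      exact Submodule.smul_mem_smul hr trivial

/-- Hom into an injective -/
lemma SE.hom {A B C I : ModuleCat.{u} R} {f : A →ₗ[R] B} {g : B →ₗ[R] C} (h : SE f g)
    (hI : Module.Injective R I) :
    SE (A := ModuleCat.of R (C →ₗ[R] I)) (B := ModuleCat.of R (B →ₗ[R] I)) (C := ModuleCat.of R (A →ₗ[R] I))
      (LinearMap.lcomp R I g) (LinearMap.lcomp R I f) := by
  refine ⟨fun a b hab => ?_, fun b => ⟨fun hb => ?_, ?_⟩, fun a => ?_⟩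
  · refine LinearMap.ext fun c => ?_
    obtain ⟨c, rfl⟩ := h.surj c
    exact LinearMap.congr_fun hab c
  · have hb' : b ∘ₗ f = 0 := hb
    obtain ⟨e, he⟩ := (show ∃ e : C →ₗ[R] I, e ∘ₗ g = b from by
        have hk : LinearMap.ker g ≤ LinearMap.ker b := by
          intro x hx
          obtain ⟨a, rfl⟩ := (h.ex x).1 hx
          exact LinearMap.congr_fun hb' a
        refine ⟨(LinearMap.ker g).liftQ b hk ∘ₗ (g.quotKerEquivOfSurjective h.surj).symm.toLinearMap, ?_⟩
        refine LinearMap.ext fun x => ?_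
        have : (g.quotKerEquivOfSurjective h.surj).symm (g x) = (LinearMap.ker g).mkQ x := by
          rw [LinearEquiv.symm_apply_eq]; rfl
        simp only [LinearMap.comp_apply, LinearEquiv.coe_coe, this]
        rfl)
    exact ⟨e, he⟩
  · rintro ⟨c, rfl⟩
    refine LinearMap.ext fun x => ?_
    change c (g (f x)) = 0
    rw [h.gf, map_zero]
  · obtain ⟨e, he⟩ := hI.out f h.inj a
    exact ⟨e, LinearMap.ext he⟩

lemma homQ {L I : ModuleCat.{u} R} (hI : Module.Injective R I) (rs : List R) : ∀ (t : ℕ) (Y : ModuleCat.{u} R),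
    RingTheory.Sequence.IsWeaklyRegular Y rs →
    (∀ j, t < j → V L (ModuleCat.of R (Y →ₗ[R] I)) j) →
    ∀ j, t + rs.length < j → V L (ModuleCat.of R (Q rs Y →ₗ[R] I)) j := by
  induction rs with
  | nil => intro t Y _ h; exact h
  | cons a rs ih =>
    intro t Y hY h j hj
    obtain ⟨h1, h2⟩ := wr_cons hY
    refine ih (t + 1) _ h2 (fun j hj => ?_) j (by simp at hj; omega)
    obtain ⟨j, rfl⟩ : ∃ k, j = k + 1 := ⟨j - 1, by omega⟩
    exact ((SE.qs h1).hom hI).cV_left (h _ (by omega)) (h _ (by omega))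

end GGo


namespace GGo
open scoped Pointwise
variable {R : Type u} [CommRing R]

lemma socle {m : Ideal R} {X : Type u} [AddCommGroup X] [Module R X] (N : ℕ) :
    ∀ x : X, x ≠ 0 → (∀ r ∈ m ^ N, r • x = 0) → ∃ u : X, u ≠ 0 ∧ ∀ r ∈ m, r • u = 0 := by
  induction N with
  | zero => intro x hx h; exact absurd (by simpa using h 1 (by simp)) hx
  | succ N ih =>
    intro x hx h
    by_cases h1 : ∀ r ∈ m, r • x = 0
    · exact ⟨x, hx, h1⟩
    · push Not at h1
      obtain ⟨r, hr, hrx⟩ := h1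
      exact ih (r • x) hrx (fun a ha => by
        rw [← mul_smul]; exact h _ (by rw [pow_succ]; exact Ideal.mul_mem_mul ha hr))

variable [IsLocalRing R]

lemma Q_nt (rs : List R) : ∀ (Y : ModuleCat.{u} R) [Module.Finite R Y] [Nontrivial Y],
    (∀ x ∈ rs, x ∈ maximalIdeal R) → Nontrivial (Q rs Y) := by
  induction rs with
  | nil => intro Y _ h _; exact h
  | cons a rs ih =>
    intro Y _ _ hx
    haveI : Nontrivial (QuotSMulTop a Y) :=
      nontrivial_quotSMulTop_of_mem_maximalIdeal Y (hx a List.mem_cons_self)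
    exact ih (ModuleCat.of R (QuotSMulTop a Y)) (fun x h => hx x (List.mem_cons_of_mem _ h))

lemma TCb {D : GD R} {L : ModuleCat.{u} R} {s : ℕ} (hL : Paper.ResDimLE R D.F s L)
    {z : List R} (hz : ∀ x ∈ z, x ∈ maximalIdeal R) (hr : RingTheory.Sequence.IsWeaklyRegular R z)
    {N : ℕ} (hN : maximalIdeal R ^ N ≤ Ideal.ofList z) (k : ℕ) : ∀ j, z.length < j → s < j + k →
    ∀ N' (Y : ModuleCat.{u} R), (∀ r ∈ maximalIdeal R ^ N', ∀ y : Y, r • y = 0) → V L Y j := by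
  induction k with
  | zero =>
    intro j _ hj N' Y hY
    exact Vpow (Vm fun I hI => resF_hom (B := ModuleCat.of R (R ⧸ maximalIdeal R)) hI hL j hj) N' Y hY
  | succ k ih =>
    intro j hj hjk N' Y hY
    refine Vpow (Vm fun I hI => ?_) N' Y hY
    have hkill := Q_kill z (RR R) ⟨_, le_rfl⟩
    haveI := Q_nt z (RR R) hz
    obtain ⟨x, hx⟩ := exists_ne (0 : Q z (RR R))
    obtain ⟨u, hu, hmu⟩ := socle N x hx (fun r hr => hkill r (hN hr) x)
    let f : (R ⧸ maximalIdeal R) →ₗ[R] Q z (RR R) :=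
      (maximalIdeal R).liftQ (LinearMap.toSpanSingleton R _ u) (fun r hr => hmu r hr)
    have hf : Function.Injective f := by
      rw [injective_iff_map_eq_zero]
      intro q hq
      obtain ⟨q, rfl⟩ := Submodule.mkQ_surjective _ q
      have hq : q • u = 0 := hq
      rw [Submodule.mkQ_apply, Submodule.Quotient.mk_eq_zero]
      by_contra hc
      have hun : IsUnit q := by simpa using hc
      exact hu ((hun.smul_eq_zero).1 hq)
    have hse := (SE.ofInj (A := ModuleCat.of R (R ⧸ maximalIdeal R)) f hf).hom hI
    refine hse.cV_right ?_ (ih (j + 1) (by omega) (by omega) N _ ?_)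
    · refine homQ hI z 0 (RR R) hr (fun j hj => ?_) j (by omega)
      obtain ⟨j, rfl⟩ : ∃ k, j = k + 1 := ⟨j - 1, by omega⟩
      exact cV_iso (Y := I) (LinearMap.ringLmapEquivSelf R R I) V_inj
    · intro r hr y
      refine LinearMap.ext fun q => ?_
      obtain ⟨q, rfl⟩ := Submodule.mkQ_surjective _ q
      rw [LinearMap.smul_apply, ← map_smul, ← map_smul, hkill r (hN hr)]
      rw [map_zero, map_zero]; rfl

/-- Theorem C -/
lemma TC {D : GD R} {H : ModuleCat.{u} R} {s : ℕ} (hH : D.LE s H)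
    (hT : ∀ x ∈ maximalIdeal R, ∀ h : H, ∃ k : ℕ, x ^ k • h = 0)
    {z : List R} (hz : ∀ x ∈ z, x ∈ maximalIdeal R) (hr : RingTheory.Sequence.IsWeaklyRegular R z)
    {N : ℕ} (hN : maximalIdeal R ^ N ≤ Ideal.ofList z) : D.LE z.length H := by
  obtain ⟨L, C, f, g, hs, hL, hC⟩ := GD.L5 hH
  refine GD.L7 hH (fun W hW j hj => ?_)
  have hwr := flat_wr (D.F_flat (D.W_F hW)) hr
  refine Q_V' z (fun x hx => hT x (hz x hx)) W hwr ?_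
  refine hs.V_left ?_ (Q_V z W hwr (fun j => hC.ev W j hW) j)
  exact TCb hL hz hr hN (s + 1) j hj (by omega) N _
    (fun r hr y => Q_kill z W ⟨_, le_rfl⟩ r (hN hr) y)

end GGo


namespace GGo
open scoped Pointwise
variable {R : Type u} [CommRing R] [IsNoetherianRing R] [IsLocalRing R]

section
variable {M : Type u} [AddCommGroup M] [Module R M] [Module.Finite R M] [Nontrivial M]

lemma mdim_eq : Paper.moduleDim R M = Module.supportDim R M :=
  (Module.supportDim_eq_ringKrullDim_quotient_annihilator R M).symm

lemma reg_len_le {d : ℕ} (hd : Paper.moduleDim R M = (d : WithBot ℕ∞)) {rs : List R}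
    (hr : RingTheory.Sequence.IsRegular M rs) : rs.length ≤ d := by
  have h := Module.supportDim_add_length_eq_supportDim_of_isRegular rs hr
  haveI : Nontrivial (M ⧸ Ideal.ofList rs • (⊤ : Submodule R M)) := hr.quot_ofList_smul_nontrivial ⊤
  have h1 : (0 : WithBot ℕ∞) ≤ Module.supportDim R (M ⧸ Ideal.ofList rs • (⊤ : Submodule R M)) := by
    rw [Module.supportDim_eq_ringKrullDim_quotient_annihilator]
    haveI : Nontrivial (R ⧸ Module.annihilator R (M ⧸ Ideal.ofList rs • (⊤ : Submodule R M))) := by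
      rw [Ideal.Quotient.nontrivial_iff]
      intro h
      rw [Module.annihilator_eq_top_iff] at h
      exact not_subsingleton _ h
    exact ringKrullDim_nonneg_of_nontrivial
  rw [← mdim_eq (M := M), hd] at h
  have h2 : ((rs.length : ℕ) : WithBot ℕ∞) ≤ (d : WithBot ℕ∞) := by
    rw [← h]
    calc ((rs.length : ℕ) : WithBot ℕ∞) = 0 + (rs.length : ℕ) := by rw [zero_add]
      _ ≤ _ := add_le_add_left h1 _
  exact_mod_cast h2

lemma depth_le {d : ℕ} (hd : Paper.moduleDim R M = (d : WithBot ℕ∞)) : Paper.depth R M ≤ d := by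
  refine sSup_le ?_
  rintro n ⟨rs, rfl, _, hr⟩
  exact_mod_cast reg_len_le hd hr

lemma CM_exists {d : ℕ} (hd : Paper.moduleDim R M = (d : WithBot ℕ∞))
    (h : Paper.IsCohenMacaulayModule R M) :
    ∃ rs : List R, rs.length = d ∧ (∀ x ∈ rs, x ∈ maximalIdeal R) ∧ RingTheory.Sequence.IsRegular M rs := by
  unfold Paper.IsCohenMacaulayModule at h
  rw [hd] at h
  have h1 : Paper.depth R M = (d : ℕ∞) := by exact_mod_cast h
  have h2 : Paper.depth R M ∈ {n : ℕ∞ | ∃ rs : List R, (rs.length : ℕ∞) = n ∧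
      (∀ x ∈ rs, x ∈ maximalIdeal R) ∧ RingTheory.Sequence.IsRegular M rs} := by
    haveI : Nonempty {n : ℕ∞ | ∃ rs : List R, (rs.length : ℕ∞) = n ∧
      (∀ x ∈ rs, x ∈ maximalIdeal R) ∧ RingTheory.Sequence.IsRegular M rs} :=
      ⟨⟨0, [], by simp, by simp, RingTheory.Sequence.IsRegular.nil R M⟩⟩
    refine ENat.sSup_mem_of_nonempty_of_lt_top ?_
    change Paper.depth R M < ⊤
    rw [h1]; exact ENat.natCast_lt_top d
  obtain ⟨rs, h3, h4, h5⟩ := h2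
  refine ⟨rs, ?_, h4, h5⟩
  rw [h1] at h3
  exact_mod_cast h3

lemma CM_of {d : ℕ} (hd : Paper.moduleDim R M = (d : WithBot ℕ∞)) {rs : List R} (h : d ≤ rs.length)
    (hm : ∀ x ∈ rs, x ∈ maximalIdeal R) (hr : RingTheory.Sequence.IsRegular M rs) :
    Paper.IsCohenMacaulayModule R M := by
  unfold Paper.IsCohenMacaulayModule
  have : Paper.depth R M = d := by
    refine le_antisymm (depth_le hd) ?_
    refine le_trans ?_ (le_sSup ⟨rs, rfl, hm, hr⟩)
    exact_mod_cast h
  rw [hd, this]; rfl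

lemma pow_le {d : ℕ} (hd : Paper.moduleDim R M = (d : WithBot ℕ∞)) {rs : List R} (h : rs.length = d)
    (hr : RingTheory.Sequence.IsRegular M rs) :
    ∃ N, maximalIdeal R ^ N ≤ Module.annihilator R M ⊔ Ideal.ofList rs := by
  have h1 := Module.supportDim_add_length_eq_supportDim_of_isRegular rs hr
  haveI : Nontrivial (M ⧸ Ideal.ofList rs • (⊤ : Submodule R M)) := hr.quot_ofList_smul_nontrivial ⊤
  rw [← mdim_eq (M := M), hd, h, Module.supportDim_eq_ringKrullDim_quotient_annihilator] at h1
  set A := Module.annihilator R (M ⧸ Ideal.ofList rs • (⊤ : Submodule R M)) with hA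
  haveI : Nontrivial (R ⧸ A) := by
    rw [Ideal.Quotient.nontrivial_iff]
    intro h
    rw [hA, Module.annihilator_eq_top_iff] at h
    exact not_subsingleton _ h
  have h2 : ringKrullDim (R ⧸ A) ≤ 0 := by
    have : ringKrullDim (R ⧸ A) + (d : WithBot ℕ∞) ≤ 0 + (d : WithBot ℕ∞) := by rw [h1, zero_add]
    have h0 := ringKrullDim_nonneg_of_nontrivial (R := R ⧸ A)
    revert this h0
    generalize ringKrullDim (R ⧸ A) = t
    intro this h0
    induction t with
    | bot => exact bot_le
    | coe t =>
      induction t with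
      | top => exfalso; revert this; rw [zero_add]; exact fun h => absurd (WithBot.coe_le_coe.1 h) (by simp)
      | coe t => norm_cast at this ⊢; omega
  haveI : Ring.KrullDimLE 0 (R ⧸ A) :=
    ringKrullDimZero_iff_ringKrullDim_eq_zero.2 (le_antisymm h2 ringKrullDim_nonneg_of_nontrivial)
  haveI : IsArtinianRing (R ⧸ A) := IsNoetherianRing.isArtinianRing_of_krullDimLE_zero
  obtain ⟨N, hN⟩ := exists_maximalIdeal_pow_le_of_isArtinianRing_quotient A
  have h3 : A ≤ (Module.annihilator R M ⊔ Ideal.ofList rs).radical := by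
    rw [Ideal.radical_eq_sInf, le_sInf_iff]
    rintro p ⟨hp, hpp⟩
    have h4 : (⟨p, hpp⟩ : PrimeSpectrum R) ∈ Module.support R (M ⧸ Ideal.ofList rs • (⊤ : Submodule R M)) := by
      rw [Module.support_quotient]
      refine ⟨?_, ?_⟩
      · rw [Module.support_eq_zeroLocus]
        exact le_trans le_sup_left hp
      · exact le_trans le_sup_right hp
    rw [Module.support_eq_zeroLocus] at h4
    exact h4
  obtain ⟨k, hk⟩ := Ideal.exists_pow_le_of_le_radical_of_fg h3 (IsNoetherian.noetherian A)
  exact ⟨N * k, by rw [pow_mul]; exact (Ideal.pow_right_mono hN k).trans hk⟩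

end

lemma CM_ring (hR : Paper.IsCohenMacaulayRing R) : ∃ z : List R, (∀ x ∈ z, x ∈ maximalIdeal R) ∧
    RingTheory.Sequence.IsRegular R z ∧ ∃ N, maximalIdeal R ^ N ≤ Ideal.ofList z := by
  have h1 : Paper.moduleDim R R = ringKrullDim R := by
    rw [mdim_eq, Module.supportDim_self_eq_ringKrullDim]
  obtain ⟨n, hn⟩ : ∃ n : ℕ, ringKrullDim R = (n : WithBot ℕ∞) := by
    have h2 := ringKrullDim_ne_top (R := R)
    have h3 := ringKrullDim_ne_bot (R := R)
    revert h2 h3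
    generalize ringKrullDim R = t
    intro h2 h3
    induction t with
    | bot => exact absurd rfl h3
    | coe t =>
      induction t with
      | top => exact absurd rfl h2
      | coe t => exact ⟨t, rfl⟩
  rw [hn] at h1
  obtain ⟨z, hz, hm, hr⟩ := CM_exists h1 hR
  obtain ⟨N, hN⟩ := pow_le h1 hz hr
  refine ⟨z, hm, hr, N, hN.trans ?_⟩
  refine sup_le (fun r hr => ?_) le_rfl
  rw [Module.mem_annihilator] at hr
  have := hr 1
  rw [smul_eq_mul, mul_one] at this
  rw [this]; exact zero_mem _

abbrev kk (R : Type u) [CommRing R] [IsLocalRing R] : ModuleCat.{u} R := ModuleCat.of R (R ⧸ maximalIdeal R)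

lemma sm_lt {M : Type u} [AddCommGroup M] [Module R M] [Module.Finite R M] [Nontrivial M] :
    maximalIdeal R • (⊤ : Submodule R M) < ⊤ :=
  lt_top_iff_ne_top.2 (Ne.symm (Submodule.top_ne_ideal_smul_of_le_jacobson_annihilator
    (maximalIdeal_le_jacobson _)))

lemma kk_supp : Module.support R (kk R) = PrimeSpectrum.zeroLocus (maximalIdeal R : Set R) := by
  rw [Module.support_eq_zeroLocus, Ideal.annihilator_quotient]

lemma AB {z : List R} (hz : ∀ x ∈ z, x ∈ maximalIdeal R) (hr : RingTheory.Sequence.IsRegular R z)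
    {M : ModuleCat.{u} R} {s : ℕ} (hM : (GP R).LE s M) : ∀ i, i + s < z.length → V (kk R) M i := by
  have h1 : ∀ i < z.length, V (kk R) (RR R) i := fun i hi e => by
    haveI := ModuleCat.subsingleton_ext_of_exists_isRegular (maximalIdeal R) (kk R) kk_supp.le (RR R)
      (sm_lt (M := R)) z hz hr i hi
    exact Subsingleton.elim _ _
  have h2 : ∀ W, (GP R).W W → ∀ i < z.length, V (kk R) W i := fun W hW i hi =>
    V_flat_of_R ((GP R).F_flat ((GP R).W_F hW)) (h1 i hi)
  have h3 : ∀ i, i < z.length → ∀ G, (GP R).G G → V (kk R) G i := by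
    intro i
    induction i with
    | zero =>
      intro hi G hG
      obtain ⟨W, C, f, g, hW, hC, hs⟩ := hG.step
      rw [V_zero_iff]
      intro a
      have := V_zero_iff.1 (h2 W hW 0 hi) (f ∘ₗ a)
      refine LinearMap.ext fun x => hs.inj ?_
      have h4 := LinearMap.congr_fun this x
      simpa using h4
    | succ i ih =>
      intro hi G hG
      obtain ⟨W, C, f, g, hW, hC, hs⟩ := hG.step
      exact hs.cV_left (ih (by omega) C hC) (h2 W hW _ hi)
  induction s generalizing M with
  | zero => intro i hi; exact h3 i hi M hM
  | succ s ih =>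
    intro i hi
    obtain ⟨K, X, f, g, hs, hK, hX⟩ := GD.LE_cases hM
    exact hs.cV_right (h3 i (by omega) X hX) (ih hK (i + 1) (by omega))

lemma AB_reg {z : List R} (hz : ∀ x ∈ z, x ∈ maximalIdeal R) (hr : RingTheory.Sequence.IsRegular R z)
    {M : Type u} [AddCommGroup M] [Module R M] [Module.Finite R M] [Nontrivial M]
    {s : ℕ} (hM : (GP R).LE s (ModuleCat.of R M)) :
    ∃ rs : List R, rs.length = z.length - s ∧ (∀ x ∈ rs, x ∈ maximalIdeal R) ∧
      RingTheory.Sequence.IsRegular M rs :=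
  ModuleCat.exists_isRegular_of_exists_subsingleton_ext (maximalIdeal R) (z.length - s) (ModuleCat.of R M)
    sm_lt (kk R) kk_supp (fun i hi => ⟨fun a b => by
      rw [AB hz hr hM i (by omega) a, AB hz hr hM i (by omega) b]⟩)

end GGo


namespace GGo
open scoped Pointwise
variable {R : Type u} [CommRing R]

lemma LU2 [IsNoetherianRing R] (j : ℕ) : ∀ (M : ModuleCat.{u} R) [Module.Finite R M],
    ∃ (N F : ModuleCat.{u} R) (e : EX M N j) (i : N →ₗ[R] F), Module.Finite R N ∧ Module.Finite R F ∧
      (∀ (Y : ModuleCat.{u} R) (c : EX M Y j), ∃ f : N →ₗ[R] Y, post f e = c) ∧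
      (∀ (Y : ModuleCat.{u} R) (f : N →ₗ[R] Y), post f e = 0 → ∃ u : F →ₗ[R] Y, u ∘ₗ i = f) ∧
      post i e = 0 := by
  rcases j with _ | j
  · intro M hM
    refine ⟨M, Z0, m0 LinearMap.id, 0, hM, inferInstanceAs (Module.Finite R PUnit.{u+1}), fun Y c => ?_, fun Y f hf => ?_, ?_⟩
    · obtain ⟨a, rfl⟩ := m0.surjective c
      exact ⟨a, by rw [post_m0]; rfl⟩
    · rw [post_m0] at hf
      have hf : f ∘ₗ LinearMap.id = 0 := by simpa using hf
      exact ⟨0, by rw [← LinearMap.comp_id f, hf]; rfl⟩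
    · rw [post_zero]
  induction j with
  | zero =>
    intro M hM
    obtain ⟨K, P, f, g, hP, hP2, hK, hs⟩ := exists_proj_fin M
    refine ⟨K, P, hs.d (m0 LinearMap.id), f, hK, hP2, fun Y c => ?_, fun Y a ha => ?_, ?_⟩
    · obtain ⟨b, rfl⟩ := hs.ctr3 c (V_proj _)
      obtain ⟨a, rfl⟩ := m0.surjective b
      exact ⟨a, by rw [← hs.d_post, post_m0]; rfl⟩
    · rw [← hs.d_post, post_m0] at ha
      obtain ⟨b, hb⟩ := hs.ctr1 _ ha
      obtain ⟨b, rfl⟩ := m0.surjective b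
      rw [pre_m0] at hb
      exact ⟨b, m0.injective hb⟩
    · rw [← hs.d_post, post_m0]
      have := hs.d_pre (m0 (LinearMap.id : P →ₗ[R] P))
      rw [pre_m0] at this
      exact this
  | succ j ih =>
    intro M hM
    obtain ⟨K, P, f, g, hP, hP2, hK, hs⟩ := exists_proj_fin M
    obtain ⟨N, F, e, i, hN, hF, h1, h2, h3⟩ := ih K
    refine ⟨N, F, hs.d e, i, hN, hF, fun Y c => ?_, fun Y a ha => ?_, ?_⟩
    · obtain ⟨b, rfl⟩ := hs.ctr3 c (V_proj _)
      obtain ⟨a, rfl⟩ := h1 Y b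
      exact ⟨a, by rw [hs.d_post]⟩
    · rw [← hs.d_post] at ha
      obtain ⟨b, hb⟩ := hs.ctr1 _ ha
      apply h2
      rw [← hb, V_proj (X := P) b, map_zero]
    · rw [← hs.d_post, h3, map_zero]

lemma sum_rep {A : Type u} [AddCommGroup A] [Module R A] {m : Ideal R} {x : A}
    (hx : x ∈ m • (⊤ : Submodule R A)) : ∃ (n : ℕ) (a : Fin n → R) (c : Fin n → A),
      (∀ i, a i ∈ m) ∧ x = ∑ i, a i • c i := by
  refine Submodule.smul_induction_on hx (fun r hr n _ => ⟨1, fun _ => r, fun _ => n, fun _ => hr, by simp⟩) ?_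
  rintro x y ⟨n, a, c, ha, rfl⟩ ⟨n', a', c', ha', rfl⟩
  refine ⟨n + n', Fin.append a a', Fin.append c c', fun i => ?_, ?_⟩
  · refine Fin.addCases (fun i => ?_) (fun i => ?_) i
    · rw [Fin.append_left]; exact ha i
    · rw [Fin.append_right]; exact ha' i
  · rw [Fin.sum_univ_add]; simp

lemma post_sum' {X Y Y' : ModuleCat.{u} R} {n k : ℕ} (a : Fin k → R) (f : Fin k → (Y →ₗ[R] Y'))
    (e : EX X Y n) : post (∑ i, a i • f i) e = ∑ i, a i • post (f i) e := by
  rw [post_sum]; exact Finset.sum_congr rfl fun i _ => post_smul _ _ _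

/-- purity -/
lemma pure_ext [IsNoetherianRing R] {M W C : ModuleCat.{u} R} [Module.Finite R M] {m : Ideal R}
    {io : RR R →ₗ[R] W} {p : W →ₗ[R] C} (hs : SE io p) (hC : Module.Flat R C) {j : ℕ} (e : EX M (RR R) j)
    (he : post io e ∈ m • (⊤ : Submodule R (EX M W j))) : e ∈ m • (⊤ : Submodule R (EX M (RR R) j)) := by
  obtain ⟨N, F, ep, i, hN, hF, h1, h2, h3⟩ := LU2 j M
  obtain ⟨n, a, c, ha, hc⟩ := sum_rep he
  obtain ⟨f, rfl⟩ := h1 _ e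
  choose fi hfi using fun k => h1 _ (c k)
  have h4 : post (io ∘ₗ f - ∑ k, a k • fi k) ep = 0 := by
    have := post_add (io ∘ₗ f - ∑ k, a k • fi k) (∑ k, a k • fi k) ep
    rw [sub_add_cancel, post_sum', post_comp, hc] at this
    simp only [hfi] at this
    exact (left_eq_add.1 ((add_comm _ _).symm.trans this.symm).symm)
  obtain ⟨u, hu⟩ := h2 _ _ h4
  let Q : ModuleCat.{u} R := ModuleCat.of R ((Fin n → N) × F)
  let U : N →ₗ[R] (Fin n → N) × F := LinearMap.prod (LinearMap.pi fun k => a k • LinearMap.id) i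
  let G : ((Fin n → N) × F) →ₗ[R] W := LinearMap.coprod (∑ k, fi k ∘ₗ LinearMap.proj k) u
  have hG : ∀ x, G (U x) = io (f x) := by
    intro x
    have := LinearMap.congr_fun hu x
    simp only [LinearMap.comp_apply, LinearMap.sub_apply, LinearMap.sum_apply, LinearMap.smul_apply] at this
    simp only [G, U, LinearMap.prod_apply, Pi.prod, LinearMap.coprod_apply, LinearMap.sum_apply,
      LinearMap.comp_apply, LinearMap.proj_apply, LinearMap.pi_apply, LinearMap.smul_apply,
      LinearMap.id_apply, map_smul]
    have h9 : ∀ d, fi d ((Function.prod (⇑(LinearMap.pi fun k => a k • (LinearMap.id : N →ₗ[R] N))) (⇑i) x).1 d) =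
        a d • fi d x := fun d => map_smul (fi d) (a d) x
    simp only [h9]
    refine (congrArg (fun z : W => (∑ k, a k • fi k x) + z) this).trans ?_
    exact add_sub_cancel (∑ k, a k • fi k x) (io (f x))
  let q : (((Fin n → N) × F) ⧸ LinearMap.range U) →ₗ[R] C := (LinearMap.range U).liftQ (p ∘ₗ G) (by
    rintro _ ⟨x, rfl⟩
    change p (G (U x)) = 0
    rw [hG, hs.gf])
  haveI : Module.Finite R (((Fin n → N) × F) ⧸ LinearMap.range U) := inferInstance
  haveI : Module.FinitePresentation R (((Fin n → N) × F) ⧸ LinearMap.range U) :=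
    Module.finitePresentation_of_finite R _
  obtain ⟨k, b1, b2, hb⟩ := Module.Flat.exists_factorization_of_finitePresentation q
  obtain ⟨b3, hb3⟩ := Module.projective_lifting_property p b2 hs.surj
  let l : ((Fin n → N) × F) →ₗ[R] W := b3 ∘ₗ b1 ∘ₗ (LinearMap.range U).mkQ
  have h5 : ∀ x, ∃ r, io r = G x - l x := by
    intro x
    refine (hs.ex _).1 ?_
    rw [map_sub, sub_eq_zero]
    change p (G x) = p (b3 (b1 ((LinearMap.range U).mkQ x)))
    have e1 := LinearMap.congr_fun hb3 (b1 ((LinearMap.range U).mkQ x))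
    have e2 := LinearMap.congr_fun hb ((LinearMap.range U).mkQ x)
    simp only [LinearMap.comp_apply] at e1 e2
    rw [e1, ← e2]
    rfl
  choose t ht using h5
  let T : ((Fin n → N) × F) →ₗ[R] R :=
    { toFun := t
      map_add' := fun x y => hs.inj (by rw [map_add, ht, ht, ht, map_add, map_add]; abel)
      map_smul' := fun r x => hs.inj (by
        rw [RingHom.id_apply, map_smul, ht, ht, map_smul, map_smul, smul_sub]) }
  have hT : ∀ x, T (U x) = f x := by
    intro x
    apply hs.inj
    change io (t (U x)) = _
    rw [ht, hG]
    have : l (U x) = 0 := by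
      change b3 (b1 ((LinearMap.range U).mkQ (U x))) = 0
      rw [Submodule.mkQ_apply, (Submodule.Quotient.mk_eq_zero (LinearMap.range U)).2 (LinearMap.mem_range_self U x), map_zero, map_zero]
    rw [this, sub_zero]
  have hf : f = (∑ k, a k • (T ∘ₗ LinearMap.inl R _ _ ∘ₗ LinearMap.single R (fun _ => N) k)) +
      (T ∘ₗ LinearMap.inr R _ _) ∘ₗ i := by
    refine LinearMap.ext fun x => ?_
    rw [← hT x]
    simp only [LinearMap.add_apply, LinearMap.sum_apply, LinearMap.smul_apply, LinearMap.comp_apply,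
      ← map_smul, ← map_sum, ← map_add]
    congr 1
    ext k
    · simp [U, Prod.fst_sum, Finset.sum_apply, Pi.single_apply]
    · simp [U, Prod.snd_sum]
  rw [hf, post_add, post_comp, h3, map_zero, add_zero]
  have := post_sum' (Y := N) (Y' := RR R) a
    (fun k => T ∘ₗ LinearMap.inl R _ _ ∘ₗ LinearMap.single R (fun _ => N) k) ep
  refine this.symm ▸ ?_
  exact Submodule.sum_mem _ fun k _ => Submodule.smul_mem_smul (ha k) trivial

end GGo


namespace GGo
open scoped Pointwise
open RingTheory.Sequence
variable {R : Type u} [CommRing R]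

/-- `C` is the union of the `K / x^(n+1) K`. -/
structure IsC (x : R) {K C : ModuleCat.{u} R} (t : ℕ → K →ₗ[R] C) : Prop where
  up : ∀ n k, t (n+1) (x • k) = t n k
  zero : ∀ k, t 0 (x • k) = 0
  sur : ∀ c, ∃ n k, t n k = c
  ker : ∀ n k, t n k = 0 → ∃ k', k = x^(n+1) • k'

section
variable {x : R} {K C : ModuleCat.{u} R} {t : ℕ → K →ₗ[R] C}

lemma IsC.up' (h : IsC x t) (n j : ℕ) (k : K) : t (n+j) (x^j • k) = t n k := by
  induction j with
  | zero => simp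
  | succ j ih =>
    rw [← ih, pow_succ', mul_smul, ← add_assoc, h.up]

lemma IsC.kill (h : IsC x t) (n : ℕ) (k : K) : t n (x^(n+1) • k) = 0 := by
  have := h.up' 0 n (x • k)
  rw [zero_add, h.zero, ← mul_smul, ← pow_succ] at this
  exact this

lemma IsC.tors (h : IsC x t) (r : R) (hr : ∀ k : K, ∃ n : ℕ, r^n • k = 0) (c : C) : ∃ n : ℕ, r^n • c = 0 := by
  obtain ⟨n, k, rfl⟩ := h.sur c
  obtain ⟨j, hj⟩ := hr k
  exact ⟨j, by rw [← map_smul, hj, map_zero]⟩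

lemma IsC.torsx (h : IsC x t) (c : C) : ∃ n : ℕ, x^n • c = 0 := by
  obtain ⟨n, k, rfl⟩ := h.sur c
  exact ⟨n+1, by rw [← map_smul, h.kill]⟩

lemma reg_pow (hx : IsSMulRegular K x) (n : ℕ) {a b : K} (h : x^n • a = x^n • b) : a = b :=
  hx.pow n h

lemma QS_eq {y : R} {k : K} : (Submodule.Quotient.mk k : QuotSMulTop y K) = 0 ↔ ∃ k', k = y • k' := by
  rw [Submodule.Quotient.mk_eq_zero, Submodule.mem_smul_pointwise_iff_exists]
  constructor
  · rintro ⟨b, -, rfl⟩; exact ⟨b, rfl⟩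
  · rintro ⟨b, rfl⟩; exact ⟨b, trivial, rfl⟩

lemma reg_Q (hx : IsSMulRegular K x) {y : R} (hy : IsSMulRegular (QuotSMulTop x K) y) (n : ℕ) :
    ∀ (k k' : K), y • k = x^n • k' → ∃ k'', k = x^n • k'' := by
  induction n with
  | zero => intro k k' _; exact ⟨k, by simp⟩
  | succ n ih =>
    intro k k' hk
    obtain ⟨k1, rfl⟩ := ih k (x • k') (by rw [hk, pow_succ, mul_smul])
    have : y • k1 = x • k' := by
      apply reg_pow hx n
      rw [smul_comm, hk, pow_succ, mul_smul]
    have h2 : y • (Submodule.Quotient.mk k1 : QuotSMulTop x K) = 0 := QS_eq.2 ⟨k', this⟩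
    obtain ⟨k2, rfl⟩ := QS_eq.1 ((isSMulRegular_iff_right_eq_zero_of_smul.1 hy) _ h2)
    exact ⟨k2, by rw [pow_succ, mul_smul]⟩

lemma IsC.reg (h : IsC x t) (hx : IsSMulRegular K x) {y : R} (hy : IsSMulRegular (QuotSMulTop x K) y) :
    IsSMulRegular C y := by
  rw [isSMulRegular_iff_right_eq_zero_of_smul]
  intro c hc
  obtain ⟨n, k, rfl⟩ := h.sur c
  rw [← map_smul] at hc
  obtain ⟨k', hk'⟩ := h.ker _ _ hc
  obtain ⟨k'', rfl⟩ := reg_Q hx hy _ _ _ hk'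
  exact h.kill _ _

lemma swap_reg (hx : IsSMulRegular K x) {y : R} (hy : IsSMulRegular (QuotSMulTop x K) y) :
    IsSMulRegular (QuotSMulTop y K) x := by
  rw [isSMulRegular_iff_right_eq_zero_of_smul]
  intro c hc
  obtain ⟨k, rfl⟩ := Submodule.Quotient.mk_surjective _ c
  obtain ⟨k', hk'⟩ := QS_eq.1 (hc : (Submodule.Quotient.mk (x • k) : QuotSMulTop y K) = 0)
  obtain ⟨k'', rfl⟩ := reg_Q hx hy 1 k' k (by rw [← hk', pow_one])
  refine QS_eq.2 ⟨k'', hx ?_⟩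
  change x • k = x • y • k''
  refine (show x • k = _ from hk').trans ?_
  rw [pow_one, smul_comm]

lemma IsC.quot (h : IsC x t) (y : R) (hx : IsSMulRegular (QuotSMulTop y K) x) :
    IsC x (K := ModuleCat.of R (QuotSMulTop y K)) (C := ModuleCat.of R (QuotSMulTop y C))
      (fun n => QuotSMulTop.map y (t n)) := by
  refine ⟨fun n k => ?_, fun k => ?_, fun c => ?_, fun n k hk => ?_⟩
  · obtain ⟨k, rfl⟩ := Submodule.Quotient.mk_surjective _ k
    exact congrArg Submodule.Quotient.mk (h.up n k)
  · obtain ⟨k, rfl⟩ := Submodule.Quotient.mk_surjective _ k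
    exact congrArg Submodule.Quotient.mk (h.zero k)
  · obtain ⟨c, rfl⟩ := Submodule.Quotient.mk_surjective _ c
    obtain ⟨n, k, rfl⟩ := h.sur c
    exact ⟨n, Submodule.Quotient.mk k, rfl⟩
  · obtain ⟨k, rfl⟩ := Submodule.Quotient.mk_surjective _ k
    obtain ⟨c, hc⟩ := QS_eq.1 (hk : (Submodule.Quotient.mk (t n k) : QuotSMulTop y C) = 0)
    obtain ⟨n', k', rfl⟩ := h.sur c
    replace hc : t n k = y • t n' k' := hc
    rw [← h.up' n n', ← h.up' n' n k', add_comm n' n, ← map_smul, ← sub_eq_zero, ← map_sub] at hc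
    obtain ⟨a, ha⟩ := h.ker _ _ hc
    refine ⟨Submodule.Quotient.mk a, ?_⟩
    refine (hx.pow n') ?_
    change (Submodule.Quotient.mk (x^n' • k) : QuotSMulTop y K) = Submodule.Quotient.mk (x^n' • x^(n+1) • a)
    rw [← sub_eq_zero, ← Submodule.Quotient.mk_sub, QS_eq]
    refine ⟨x^n • k', ?_⟩
    rw [← mul_smul, ← pow_add, show n' + (n+1) = n + n' + 1 by omega, ← ha]
    abel

end

/-- double quotient projection -/
noncomputable def pq (x y : R) (K : ModuleCat.{u} R) : K →ₗ[R] QuotSMulTop y (QuotSMulTop x K) :=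
  (y • ⊤ : Submodule R (QuotSMulTop x K)).mkQ ∘ₗ (x • ⊤ : Submodule R K).mkQ

lemma pq_ker (x y : R) (K : ModuleCat.{u} R) (k : K) :
    k ∈ LinearMap.ker (pq x y K) ↔ ∃ a b : K, k = x • a + y • b := by
  have : k ∈ LinearMap.ker (pq x y K) ↔
    (Submodule.Quotient.mk ((x • ⊤ : Submodule R K).mkQ k) :
      QuotSMulTop y (ModuleCat.of R (QuotSMulTop x K))) = 0 := Iff.rfl
  refine this.trans (QS_eq.trans ?_)
  constructor
  · rintro ⟨c, hc⟩
    obtain ⟨b, rfl⟩ := Submodule.Quotient.mk_surjective _ c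
    have h2 : (Submodule.Quotient.mk (k - y • b) : QuotSMulTop x K) = 0 := by
      rw [Submodule.Quotient.mk_sub, Submodule.Quotient.mk_smul, sub_eq_zero]; exact hc
    obtain ⟨a, ha⟩ := QS_eq.1 h2
    exact ⟨a, b, by rw [← ha]; abel⟩
  · rintro ⟨a, b, rfl⟩
    refine ⟨Submodule.Quotient.mk b, ?_⟩
    have h2 : (Submodule.Quotient.mk (x • a + y • b - y • b) : QuotSMulTop x K) = 0 :=
      QS_eq.2 ⟨a, by abel⟩
    rw [Submodule.Quotient.mk_sub, sub_eq_zero] at h2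
    exact h2

lemma pq_surj (x y : R) (K : ModuleCat.{u} R) : Function.Surjective (pq x y K) :=
  (Submodule.mkQ_surjective _).comp (Submodule.mkQ_surjective _)

/-- swapping quotients -/
noncomputable def Qswap (x y : R) (K : ModuleCat.{u} R) :
    QuotSMulTop y (QuotSMulTop x K) ≃ₗ[R] QuotSMulTop x (QuotSMulTop y K) :=
  ((pq x y K).quotKerEquivOfSurjective (pq_surj x y K)).symm ≪≫ₗ
    (Submodule.quotEquivOfEq _ _ (by
      ext k
      rw [pq_ker, pq_ker]
      exact ⟨fun ⟨a, b, h⟩ => ⟨b, a, by rw [h, add_comm]⟩, fun ⟨a, b, h⟩ => ⟨b, a, by rw [h, add_comm]⟩⟩)) ≪≫ₗ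
    ((pq y x K).quotKerEquivOfSurjective (pq_surj y x K))

lemma IsC.wr {x : R} (rs : List R) : ∀ {K C : ModuleCat.{u} R} {t : ℕ → K →ₗ[R] C} (h : IsC x t)
    (hx : IsSMulRegular K x) (hr : IsWeaklyRegular (QuotSMulTop x K) rs), IsWeaklyRegular C rs := by
  induction rs with
  | nil => intro K C t _ _ _; exact IsWeaklyRegular.nil R C
  | cons y rs ih =>
    intro K C t h hx hr
    rw [isWeaklyRegular_cons_iff] at hr ⊢
    have h1 := swap_reg hx hr.1
    refine ⟨h.reg hx hr.1, ih (h.quot y h1) h1 ?_⟩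
    exact ((Qswap x y K).isWeaklyRegular_congr rs).1 hr.2

/-- telescope -/
noncomputable def phi (x : R) (K : ModuleCat.{u} R) : Sm K →ₗ[R] Sm K :=
  x • LinearMap.id - Finsupp.lcomapDomain Nat.succ Nat.succ_injective

lemma phi_apply (x : R) {K : ModuleCat.{u} R} (f : Sm K) (n : ℕ) :
    (phi x K f : ℕ →₀ K) n = x • (f : ℕ →₀ K) n - (f : ℕ →₀ K) (n+1) := rfl

lemma phi_sg0 (x : R) (K : ModuleCat.{u} R) (k : K) : phi x K (sg 0 k) = sg 0 (x • k) := by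
  refine Finsupp.ext fun n => ?_
  rw [phi_apply]
  change x • (Finsupp.single 0 k) n - (Finsupp.single 0 k) (n+1) = (Finsupp.single 0 (x • k)) n
  rw [Finsupp.single_apply, Finsupp.single_apply, Finsupp.single_apply, if_neg (show ¬ 0 = n + 1 by omega), sub_zero]
  split_ifs <;> simp

lemma phi_sgS (x : R) (K : ModuleCat.{u} R) (m : ℕ) (k : K) :
    phi x K (sg (m+1) k) = sg (m+1) (x • k) - sg m k := by
  refine Finsupp.ext fun n => ?_
  rw [phi_apply]
  change x • (Finsupp.single (m+1) k) n - (Finsupp.single (m+1) k) (n+1) =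
    (Finsupp.single (m+1) (x • k)) n - (Finsupp.single m k) n
  simp only [Finsupp.single_apply, Nat.add_right_cancel_iff]
  congr 1
  split_ifs
  · rfl
  · exact smul_zero _

lemma phi_inj {x : R} {K : ModuleCat.{u} R} (hx : IsSMulRegular K x) : Function.Injective (phi x K) := by
  rw [← LinearMap.ker_eq_bot, LinearMap.ker_eq_bot']
  intro f hf
  have h1 : ∀ n, (f : ℕ →₀ K) (n+1) = 0 → (f : ℕ →₀ K) n = 0 := by
    intro n hn
    have := DFunLike.congr_fun hf n
    rw [phi_apply, hn, sub_zero] at this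
    exact hx.right_eq_zero_of_smul this
  have h2 : ∀ j n, (f : ℕ →₀ K) (n+j) = 0 → (f : ℕ →₀ K) n = 0 := by
    intro j
    induction j with
    | zero => intro n h; exact h
    | succ j ih => intro n h; exact ih n (h1 _ h)
  refine Finsupp.ext fun n => ?_
  refine h2 (f.support.sup id + 1) n ?_
  by_contra h
  have := Finset.le_sup (f := id) (Finsupp.mem_support_iff.2 h)
  simp only [id] at this
  omega

lemma IsC.se {x : R} {K C : ModuleCat.{u} R} {t : ℕ → K →ₗ[R] C} (h : IsC x t)
    (hx : IsSMulRegular K x) : SE (phi x K) (Finsupp.lsum R t : (ℕ →₀ K) →ₗ[R] C) := by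
  have hq : ∀ n k, (Finsupp.lsum R t : (ℕ →₀ K) →ₗ[R] C) (sg n k) = t n k := fun n k => by simp
  have h0 : ∀ f, (Finsupp.lsum R t : (ℕ →₀ K) →ₗ[R] C) (phi x K f) = 0 := by
    intro f
    have : (Finsupp.lsum R t : (ℕ →₀ K) →ₗ[R] C) ∘ₗ phi x K = 0 := by
      refine Finsupp.lhom_ext fun n k => ?_
      change (Finsupp.lsum R t : (ℕ →₀ K) →ₗ[R] C) (phi x K (sg n k)) = 0
      cases n with
      | zero => rw [phi_sg0, hq, h.zero]
      | succ n => rw [phi_sgS, map_sub, hq, hq, h.up, sub_self]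
    exact LinearMap.congr_fun this f
  have hsh : ∀ n j k, (sg n k : Sm K) - sg (n+j) (x^j • k) ∈ LinearMap.range (phi x K) := by
    intro n j k
    induction j with
    | zero => simp
    | succ j ih =>
      have : phi x K (sg (n+j+1) (x^j • k)) ∈ LinearMap.range (phi x K) := ⟨_, rfl⟩
      rw [phi_sgS, ← mul_smul, ← pow_succ'] at this
      have := Submodule.sub_mem _ ih this
      convert this using 1
      rw [← add_assoc]; abel
  have hrep : ∀ f : Sm K, ∃ N k, f - sg N k ∈ LinearMap.range (phi x K) := by
    intro f
    refine Finsupp.induction_linear f ⟨0, 0, by simp⟩ ?_ (fun n k => ⟨n, k, by simp⟩)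
    rintro f g ⟨N, k, hk⟩ ⟨N', k', hk'⟩
    refine ⟨N + N', x^N' • k + x^N • k', ?_⟩
    have h1 := Submodule.add_mem _ hk (hsh N N' k)
    have h2 := Submodule.add_mem _ hk' (hsh N' N k')
    have := Submodule.add_mem _ h1 h2
    convert this using 1
    rw [map_add, add_comm N' N]; abel
  refine ⟨phi_inj hx, fun f => ⟨fun hf => ?_, ?_⟩, fun c => ?_⟩
  · obtain ⟨N, k, hk⟩ := hrep f
    obtain ⟨g, hg⟩ := id hk
    have h3 := h0 g
    rw [hg, map_sub, hf, zero_sub, neg_eq_zero, hq] at h3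
    obtain ⟨k', rfl⟩ := h.ker _ _ h3
    have h4 := hsh 0 N (x • k')
    rw [zero_add, ← mul_smul, ← pow_succ, ← phi_sg0] at h4
    have h5 : phi x K (sg 0 k') ∈ LinearMap.range (phi x K) := ⟨_, rfl⟩
    have := Submodule.sub_mem _ (Submodule.add_mem _ hk h5) h4
    have h6 : f ∈ LinearMap.range (phi x K) := by
      convert this using 1; abel
    exact h6
  · rintro ⟨g, rfl⟩; exact h0 g
  · obtain ⟨n, k, rfl⟩ := h.sur c
    exact ⟨sg n k, hq n k⟩

lemma exists_C {x : R} {K : ModuleCat.{u} R} (hx : IsSMulRegular K x) :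
    ∃ (E C : ModuleCat.{u} R) (i : K →ₗ[R] E) (p : E →ₗ[R] C) (t : ℕ → K →ₗ[R] C) (w : E →ₗ[R] E),
      SE i p ∧ IsC x t ∧ w ∘ₗ (x • LinearMap.id) = LinearMap.id := by
  let S := Submonoid.powers x
  let xs : S := ⟨x, Submonoid.mem_powers x⟩
  let i : K →ₗ[R] LocalizedModule S K := LocalizedModule.mkLinearMap S K
  have hi : Function.Injective i := by
    rw [← LinearMap.ker_eq_bot, LinearMap.ker_eq_bot']
    intro k hk
    obtain ⟨⟨_, n, rfl⟩, hc⟩ := (IsLocalizedModule.eq_zero_iff S i).1 hk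
    exact (hx.pow n).right_eq_zero_of_smul hc
  let E := ModuleCat.of R (LocalizedModule S K)
  have hs := SE.ofInj (B := E) i hi
  let w : E →ₗ[R] E := LocalizedModule.divBy xs
  have hw : ∀ e : E, w (x • e) = e := LocalizedModule.divBy_mul_by xs
  have hw' : ∀ e : E, x • w e = e := LocalizedModule.mul_by_divBy xs
  have hwn : ∀ n (e : E), (w^n) (x^n • e) = e := by
    intro n
    induction n with
    | zero => intro e; simp
    | succ n ih =>
      intro e
      rw [pow_succ, Module.End.mul_apply, pow_succ', mul_smul, hw, ih]
  have hwn' : ∀ n (e : E), x^n • (w^n) e = e := by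
    intro n
    induction n with
    | zero => intro e; simp
    | succ n ih =>
      intro e
      rw [pow_succ, pow_succ', mul_smul, Module.End.mul_apply, hw', ih]
  refine ⟨E, _, i, _, fun n => Submodule.mkQ _ ∘ₗ (w^(n+1)) ∘ₗ i, w, hs,
    ⟨fun n k => ?_, fun k => ?_, fun c => ?_, fun n k hk => ?_⟩, LinearMap.ext hw⟩
  · change Submodule.Quotient.mk ((w^(n+1+1)) (i (x • k))) = Submodule.Quotient.mk ((w^(n+1)) (i k))
    rw [map_smul, pow_succ, Module.End.mul_apply, hw]
  · refine (Submodule.Quotient.mk_eq_zero _).2 ?_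
    refine ⟨k, ?_⟩
    change i k = (w^(0+1)) (i (x • k))
    rw [map_smul, zero_add, pow_one, hw]
  · obtain ⟨e, rfl⟩ := Submodule.Quotient.mk_surjective _ c
    obtain ⟨⟨k, ⟨_, n, rfl⟩⟩, hk⟩ := IsLocalizedModule.surj S i e
    replace hk : x^n • e = i k := hk
    refine ⟨n, x • k, ?_⟩
    change Submodule.Quotient.mk ((w^(n+1)) (i (x • k))) = _
    rw [map_smul, pow_succ, Module.End.mul_apply, hw, ← hk, hwn]
  · obtain ⟨k', hk'⟩ := (Submodule.Quotient.mk_eq_zero _).1 hk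
    refine ⟨k', hi ?_⟩
    rw [map_smul, hk']
    exact (hwn' _ _).symm

lemma Vx {x : R} {X E : ModuleCat.{u} R} {w : E →ₗ[R] E} (hw : w ∘ₗ (x • LinearMap.id) = LinearMap.id)
    {n : ℕ} (hX : ∀ a : X, x^n • a = 0) (j : ℕ) : V X E j := by
  have h1 : ∀ (n : ℕ) (e : EX X E j), x^n • e = 0 → e = 0 := by
    intro n
    induction n with
    | zero => intro e he; simpa using he
    | succ n ih =>
      intro e he
      apply ih
      have := post_comp (x • LinearMap.id) w (x^n • e)
      rw [hw, post_id, post_smul, post_id, ← mul_smul, ← pow_succ', he, map_zero] at this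
      exact this
  intro e
  apply h1 n
  have := pre_smul (x^n) (LinearMap.id : X →ₗ[R] X) e
  rw [pre_id] at this
  rw [← this]
  have h2 : x^n • (LinearMap.id : X →ₗ[R] X) = 0 := LinearMap.ext hX
  rw [h2, pre_zero]

lemma nak_step {m : Ideal R} {x : R} (hx : x ∈ m) {K C W : ModuleCat.{u} R} {q : Sm K →ₗ[R] C}
    (hs : SE (phi x K) q) {j : ℕ} (hV : V K W (j+1))
    (h : m • (⊤ : Submodule R (EX C W (j+1))) = ⊤) : m • (⊤ : Submodule R (EX K W j)) = ⊤ := by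
  rw [eq_top_iff]
  intro a _
  obtain ⟨E, hE⟩ := DS_exists j (fun i => if i = 0 then a else 0)
  have hd : LinearMap.range (hs.d (Y := W) (n := j)) = ⊤ := by
    rw [LinearMap.range_eq_top]
    intro c
    exact hs.ctr3 c (V_sum hV _)
  have h1 : hs.d E ∈ Submodule.map hs.d (m • (⊤ : Submodule R (EX (Sm K) W j))) := by
    rw [Submodule.map_smul'', Submodule.map_top, hd, h]; trivial
  obtain ⟨E', hE', h2⟩ := h1
  obtain ⟨b, hb⟩ := hs.ctr1 (E - E') (by rw [map_sub, h2, sub_self])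
  have h3 := hE 0
  rw [if_pos rfl] at h3
  have h4 : pre (sg 0) (E - E') = x • pre (sg 0) b := by
    rw [← hb, ← pre_comp, ← pre_smul]
    congr 2
    refine LinearMap.ext fun k => ?_
    exact (phi_sg0 x K k).trans (map_smul _ _ _)
  rw [map_sub, h3, sub_eq_iff_eq_add] at h4
  rw [h4]
  refine Submodule.add_mem _ (Submodule.smul_mem_smul hx trivial) ?_
  have h5 : pre (sg 0) E' ∈ Submodule.map (pre (sg 0)) (m • (⊤ : Submodule R (EX (Sm K) W j))) := ⟨_, hE', rfl⟩
  rw [Submodule.map_smul''] at h5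
  exact Submodule.smul_mono le_rfl le_top h5

/-- The iterated construction. -/
structure Tower (m : Ideal R) (K H : ModuleCat.{u} R) (rs : List R) : Prop where
  ub : ∀ (D : GD R) (s : ℕ), D.LE s K → D.LE (s + rs.length) H
  lb : ∀ (W : ModuleCat.{u} R) (j : ℕ), (∀ i, j < i → V K W i) →
    m • (⊤ : Submodule R (EX H W (j + rs.length))) = ⊤ → m • (⊤ : Submodule R (EX K W j)) = ⊤
  tors : ∀ r : R, (r ∈ rs ∨ ∀ k : K, ∃ n : ℕ, r^n • k = 0) → ∀ h : H, ∃ n : ℕ, r^n • h = 0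
  ext : ∃ θ : ∀ X : ModuleCat.{u} R, (X →ₗ[R] H) →ₗ[R] EX X K rs.length,
    (∀ (X X' : ModuleCat.{u} R) (g : X' →ₗ[R] X) (f : X →ₗ[R] H), θ X' (f ∘ₗ g) = pre g (θ X f)) ∧
    ∀ X : ModuleCat.{u} R, (∀ r ∈ rs, ∃ n : ℕ, ∀ a : X, r^n • a = 0) → Function.Bijective (θ X)

lemma tower (m : Ideal R) (rs : List R) : ∀ (K : ModuleCat.{u} R) (hm : ∀ r ∈ rs, r ∈ m)
    (hr : IsWeaklyRegular K rs), ∃ H, Tower m K H rs := by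
  induction rs with
  | nil =>
    intro K hm hr
    refine ⟨K, ⟨fun D s h => h, fun W j _ h => h, fun r h => ?_, fun X => m0.toLinearMap, ?_, ?_⟩⟩
    · rcases h with h | h
      · simp at h
      · exact h
    · intro X X' g f
      exact (pre_m0 g f).symm
    · intro X _; exact m0.bijective
  | cons x rs ih =>
    intro K hm hr
    rw [isWeaklyRegular_cons_iff] at hr
    obtain ⟨E, C, i, p, t, w, hs, hC, hw⟩ := exists_C hr.1
    obtain ⟨H, hH⟩ := ih C (fun r h => hm r (List.mem_cons_of_mem _ h)) (hC.wr rs hr.1 hr.2)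
    have hse := hC.se hr.1
    have hlen : (x :: rs).length = rs.length + 1 := rfl
    refine ⟨H, ⟨fun D s h => ?_, fun W j hV h => ?_, fun r h => ?_, ?_⟩⟩
    · rw [hlen, show s + (rs.length + 1) = (s+1) + rs.length by omega]
      exact hH.ub D _ (GD.LE_coker hse (GD.LE_sum h) (GD.LE_sum h))
    · rw [hlen, show j + (rs.length + 1) = (j+1) + rs.length by omega] at h
      refine nak_step (hm x (List.mem_cons_self)) hse (hV _ (by omega)) (hH.lb W (j+1) (fun i hi => ?_) h)
      obtain ⟨i, rfl⟩ : ∃ k, i = k + 1 := ⟨i - 1, by omega⟩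
      exact hse.V_right (V_sum (hV _ (by omega))) (V_sum (hV _ (by omega)))
    · refine hH.tors r ?_
      rcases h with h | h
      · rcases List.mem_cons.1 h with rfl | h
        · exact Or.inr hC.torsx
        · exact Or.inl h
      · exact Or.inr (hC.tors r h)
    · obtain ⟨θ, h1, h2⟩ := hH.ext
      refine ⟨fun X => hs.cd ∘ₗ θ X, fun X X' g f => ?_, fun X hX => ?_⟩
      · rw [LinearMap.comp_apply, LinearMap.comp_apply, h1, hs.pre_cd]
      · have h3 := h2 X fun r hr => hX r (List.mem_cons_of_mem _ hr)
        obtain ⟨n, hn⟩ := hX x List.mem_cons_self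
        have hE := Vx hw hn
        have h4 : Function.Bijective (hs.cd (X := X) (n := rs.length)) := by
          constructor
          · rw [← LinearMap.ker_eq_bot, LinearMap.ker_eq_bot']
            intro e he
            obtain ⟨b, rfl⟩ := hs.cov3 e he
            rw [hE _ b, map_zero]
          · intro e
            exact hs.cov1 e (hE _ _)
        exact h4.comp h3

end GGo


namespace GGo
open scoped Pointwise
open RingTheory.Sequence
variable {R : Type u} [CommRing R] [IsNoetherianRing R] [IsLocalRing R]

lemma notV {M : ModuleCat.{u} R} [Module.Finite R M] [Nontrivial M] {g : ℕ} (h : (GP R).LE g M)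
    (hmin : ∀ s, s < g → ¬ (GP R).LE s M) : ¬ V M (RR R) g := by
  intro hv
  rcases g with _ | g
  · obtain ⟨W, C, f, p, hW, hC, hs⟩ := GD.G.step (D := GP R) h
    haveI : Module.Projective R W := hW
    have h1 := V_flat_of_R (W := W) inferInstance hv
    rw [V_zero_iff] at h1
    obtain ⟨a, ha⟩ := exists_ne (0 : M)
    exact ha (hs.inj (by rw [h1 f]; rfl))
  · refine hmin g (Nat.lt_succ_self g) (GD.L7 h fun Y hY j hj => ?_)
    haveI : Module.Projective R Y := hY
    rcases Nat.lt_or_ge (g+1) j with h2 | h2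
    · exact GD.LE_ev h hY j h2
    · obtain rfl : j = g + 1 := by omega
      exact V_flat_of_R inferInstance hv

lemma nak1 {M : ModuleCat.{u} R} [Module.Finite R M] {g : ℕ} (h : ¬ V M (RR R) g) :
    maximalIdeal R • (⊤ : Submodule R (EX M (RR R) g)) ≠ ⊤ := by
  intro h1
  haveI : Module.Finite R (RR R) := inferInstanceAs (Module.Finite R R)
  haveI : Module.Finite R (EX M (RR R) g) := ModuleCat.finite_ext R M (RR R) g
  have h2 := Submodule.eq_bot_of_le_smul_of_le_jacobson_bot (maximalIdeal R) (⊤ : Submodule R (EX M (RR R) g))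
    Module.Finite.fg_top h1.ge (IsLocalRing.maximalIdeal_le_jacobson _)
  refine h fun e => ?_
  have : e ∈ (⊤ : Submodule R (EX M (RR R) g)) := trivial
  rw [h2] at this
  exact this

lemma nak2 {M : ModuleCat.{u} R} [Module.Finite R M] {g : ℕ} (h : ¬ V M (RR R) g) :
    maximalIdeal R • (⊤ : Submodule R (EX M (ch (ch (RR R))) g)) ≠ ⊤ := by
  intro h1
  refine nak1 h (eq_top_iff.2 fun e _ => ?_)
  have hs := SE.ofInj (chev (RR R)) (chev_inj (RR R))
  refine pure_ext hs (chev_coker hs (inferInstanceAs (Module.Flat R R))) e ?_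
  rw [h1]; trivial

lemma not_LE {D : GD R} {m : Ideal R} {H W : ModuleCat.{u} R} (hW : D.W W) {n : ℕ}
    (h : m • (⊤ : Submodule R (EX H W n)) ≠ ⊤) (s : ℕ) (hs : s < n) : ¬ D.LE s H := by
  intro h1
  apply h
  rw [eq_top_iff]
  intro e _
  rw [GD.LE_ev h1 hW n hs e]
  exact Submodule.zero_mem _

/-- The Cohen–Macaulay case, for a tower module. -/
lemma CM_tower {M : Type u} [AddCommGroup M] [Module R M] [Module.Finite R M] [Nontrivial M] {d g : ℕ}
    (hd : Paper.moduleDim R M = (d : WithBot ℕ∞)) (h : Paper.IsCohenMacaulayModule R M)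
    (hg : (GP R).LE g (ModuleCat.of R M)) (hmin : ∀ s, s < g → ¬ (GP R).LE s (ModuleCat.of R M)) :
    ∃ H : ModuleCat.{u} R,
      ((GP R).LE (g + d) H ∧ ∀ s, s < g + d → ¬ (GP R).LE s H) ∧
      ((GF R).LE (g + d) H ∧ ∀ s, s < g + d → ¬ (GF R).LE s H) ∧
      (∀ r ∈ maximalIdeal R, ∀ h : H, ∃ n : ℕ, r^n • h = 0) ∧
      ∃ θ : ∀ X : ModuleCat.{u} R, (X →ₗ[R] H) →ₗ[R] EX X (ModuleCat.of R M) d,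
        (∀ (X X' : ModuleCat.{u} R) (g : X' →ₗ[R] X) (f : X →ₗ[R] H), θ X' (f ∘ₗ g) = pre g (θ X f)) ∧
        ∀ X : ModuleCat.{u} R, (∀ r ∈ maximalIdeal R, ∃ n : ℕ, ∀ a : X, r^n • a = 0) →
          Function.Bijective (θ X) := by
  obtain ⟨rs, rfl, hm, hr⟩ := CM_exists hd h
  obtain ⟨N, hN⟩ := pow_le hd rfl hr
  obtain ⟨H, hH⟩ := tower (maximalIdeal R) rs (ModuleCat.of R M) hm hr.toIsWeaklyRegular
  haveI : Nontrivial (ModuleCat.of R M) := inferInstanceAs (Nontrivial M)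
  haveI : Module.Finite R (ModuleCat.of R M) := inferInstanceAs (Module.Finite R M)
  have hnV := notV hg hmin
  have hWP : (GP R).W (RR R) := inferInstanceAs (Module.Projective R R)
  have hWF : (GF R).W (ch (ch (RR R))) := ⟨_, ch_R_inj, ⟨LinearEquiv.refl R _⟩⟩
  have hgF := GP_GF_LE hg
  refine ⟨H, ⟨hH.ub _ _ hg, not_LE (m := maximalIdeal R) hWP fun h1 => ?_⟩, ⟨hH.ub _ _ hgF, not_LE (m := maximalIdeal R) hWF fun h1 => ?_⟩, ?_, ?_⟩
  · exact nak1 hnV (hH.lb _ g (fun i hi => GD.LE_ev hg hWP i hi) h1)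
  · exact nak2 hnV (hH.lb _ g (fun i hi => GD.LE_ev hgF hWF i hi) h1)
  · intro r hr' h
    have h1 : ∀ r ∈ Module.annihilator R M ⊔ Ideal.ofList rs, ∃ n : ℕ, r^n • h = 0 := by
      have h2 : Module.annihilator R M ⊔ Ideal.ofList rs ≤ (Ideal.torsionOf R H h).radical := by
        refine sup_le (fun a ha => ?_) (Ideal.span_le.2 fun a ha => ?_)
        · obtain ⟨n, hn⟩ := hH.tors a (Or.inr fun k => ⟨1, by
            rw [pow_one]; exact (Module.mem_annihilator.1 ha) k⟩) h
          exact ⟨n, hn⟩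
        · obtain ⟨n, hn⟩ := hH.tors a (Or.inl ha) h
          exact ⟨n, hn⟩
      intro r hr
      obtain ⟨n, hn⟩ := h2 hr
      exact ⟨n, hn⟩
    obtain ⟨n, hn⟩ := h1 _ (hN (Ideal.pow_mem_pow hr' N))
    exact ⟨N * n, by rw [pow_mul, hn]⟩
  · obtain ⟨θ, h1, h2⟩ := hH.ext
    exact ⟨θ, h1, fun X hX => h2 X fun r hr => hX r (hm r hr)⟩

end GGo

namespace GGo
open Opposite

section
variable {R : Type u} [CommRing R] (K : ChainComplex (ModuleCat.{u} R)ᵒᵖ ℕ) (n : ℕ)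

lemma hι_surj : Function.Surjective (K.homologyι n).unop.hom := by
  have : Epi (K.homologyι n).unop := inferInstance
  exact (ModuleCat.epi_iff_surjective _).1 this

lemma pO_inj : Function.Injective (K.pOpcycles n).unop.hom := by
  have : Mono (K.pOpcycles n).unop := inferInstance
  exact (ModuleCat.mono_iff_injective _).1 this

lemma pO_ex : Function.Exact (K.pOpcycles n).unop.hom (K.d (n+1) n).unop.hom := by
  have h := ShortComplex.exact_of_g_is_cokernel (ShortComplex.mk _ _ (K.d_pOpcycles (n+1) n))
    (K.opcyclesIsCokernel (n+1) n (by simp))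
  exact (ShortComplex.ShortExact.moduleCat_exact_iff_function_exact _).1 h.unop

lemma hι_ex (p : ℕ) (hp : p + 1 = n) :
    Function.Exact (K.fromOpcycles n p).unop.hom (K.homologyι n).unop.hom := by
  have h := ShortComplex.exact_of_f_is_kernel (ShortComplex.mk _ _ (K.homologyι_comp_fromOpcycles n p))
    (K.homologyIsKernel n p (by subst hp; simp))
  exact (ShortComplex.ShortExact.moduleCat_exact_iff_function_exact _).1 h.unop

lemma hι_inj : Function.Injective (K.homologyι 0).unop.hom := by
  have : Mono (K.homologyι 0).unop := inferInstance
  exact (ModuleCat.mono_iff_injective _).1 this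

lemma pO_from (p : ℕ) (y : (unop (K.X p) : ModuleCat.{u} R)) :
    (K.pOpcycles n).unop.hom ((K.fromOpcycles n p).unop.hom y) = (K.d n p).unop.hom y := by
  have := congrArg Quiver.Hom.unop (K.p_fromOpcycles n p)
  exact congrArg (fun f => f.hom y) this

end

section
variable {R : Type u} [CommRing R] {X Y : ModuleCat.{u} R} (P : ProjectiveResolution X)

lemma extMk_smul {n : ℕ} (f : P.complex.X n ⟶ Y) (hf : P.complex.d (n+1) n ≫ f = 0) (r : R) :
    P.extMk (r • f) (n+1) rfl (by simp [hf]) = r • P.extMk f (n+1) rfl hf := by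
  have h := P.extMk_comp_mk₀ f (n+1) rfl hf (r • 𝟙 Y)
  rw [Abelian.Ext.mk₀_smul] at h
  simp only [Abelian.Ext.comp_smul, Abelian.Ext.comp_mk₀_id, Linear.comp_smul, Category.comp_id] at h
  exact h.symm

lemma extMk_zero_inj (f : P.complex.X 0 ⟶ Y) (hf : P.complex.d 1 0 ≫ f = 0)
   (h : P.extMk f 1 rfl hf = 0) : f = 0 := by
  have h0 : P.complex.d 1 0 ≫ P.π.f 0 = 0 := P.complex_d_comp_π_f_zero
  have fac : ∀ (Y : ModuleCat.{u} R) (f : P.complex.X 0 ⟶ Y), P.complex.d 1 0 ≫ f = 0 →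
      ∃ t : X ⟶ Y, P.π.f 0 ≫ t = f := by
    intro Y f hf
    exact ⟨P.exact₀.desc f hf, P.exact₀.g_desc f hf⟩
  obtain ⟨f', rfl⟩ := fac Y f hf
  obtain ⟨h1, h2, h3⟩ := P.extMk_surjective (Abelian.Ext.mk₀ (𝟙 X)) 1 rfl
  obtain ⟨t, rfl⟩ := fac X h1 h2
  have key : ∃ α : Abelian.Ext X X 0, α.comp (Abelian.Ext.mk₀ f') (add_zero 0) = 0 ∧
      (Abelian.Ext.mk₀ t).comp α (zero_add 0) = Abelian.Ext.mk₀ (𝟙 X) := by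
    refine ⟨P.extMk (P.π.f 0) 1 rfl h0, (P.extMk_comp_mk₀ (P.π.f 0) 1 rfl h0 f').trans h, ?_⟩
    have hc := ProjectiveResolution.lift_commutes_zero t P P
    refine (ProjectiveResolution.mk₀_comp_extMk (P.π.f 0) 1 rfl h0
      (R' := P) (R := P) ⟨ProjectiveResolution.lift t P P, hc⟩).trans ?_
    rw [← h3]
    congr 1
  obtain ⟨α, e2, e3⟩ := key
  have e4 : Abelian.Ext.mk₀ f' = 0 := by
    have := Abelian.Ext.comp_assoc (Abelian.Ext.mk₀ t) α (Abelian.Ext.mk₀ f') (zero_add 0) (zero_add 0) (show 0+0+0=0 from rfl)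
    rw [e3, e2] at this
    simpa using this
  have e5 : f' = 0 := by
    apply (Abelian.Ext.addEquiv₀ (X := X) (Y := Y)).symm.injective
    simpa using e4
  subst e5; exact Limits.comp_zero (f := P.π.f 0)
end
end GGo

namespace GGo
open Opposite

section
variable {R : Type u} [CommRing R] {X Y : ModuleCat.{u} R} (P : ProjectiveResolution X)

variable (Y) in
/-- the complex computing old Ext -/
noncomputable abbrev KK : ChainComplex (ModuleCat.{u} R)ᵒᵖ ℕ :=
  (((linearYoneda R (ModuleCat.{u} R)).obj Y).rightOp.mapHomologicalComplex _).obj P.complex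

variable (Y) in
noncomputable abbrev OO (n : ℕ) : ModuleCat.{u} R := unop ((KK Y P).opcycles n)

noncomputable def bb (n : ℕ) : OO Y P n →ₗ[R] (P.complex.X n ⟶ Y) :=
  ((KK Y P).pOpcycles n).unop.hom

lemma bb_inj (n : ℕ) : Function.Injective (bb (Y := Y) P n) := pO_inj (KK Y P) n

lemma bb_range (n : ℕ) (f : P.complex.X n ⟶ Y) :
    P.complex.d (n+1) n ≫ f = 0 ↔ ∃ o, bb P n o = f :=
  pO_ex (KK Y P) n f

lemma bb_cocycle (n : ℕ) (o : OO Y P n) : P.complex.d (n+1) n ≫ bb P n o = 0 :=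
  (bb_range P n _).2 ⟨o, rfl⟩

noncomputable def ee (n : ℕ) : OO Y P n →ₗ[R] EX X Y n where
  toFun o := P.extMk (bb P n o) (n+1) rfl (bb_cocycle P n o)
  map_add' a b := by
    rw [P.add_extMk]; congr 1; simp
  map_smul' r a := by
    refine Eq.trans ?_ (extMk_smul P _ (bb_cocycle P n a) r)
    congr 1; simp

variable (Y) in
noncomputable abbrev oldE (X Y : ModuleCat.{u} R) (n : ℕ) : ModuleCat.{u} R :=
  ((Ext R (ModuleCat.{u} R) n).obj (op X)).obj Y

noncomputable def cc (n : ℕ) : OO Y P n →ₗ[R] oldE X Y n :=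
  ((P.isoLeftDerivedObj ((linearYoneda R (ModuleCat.{u} R)).obj Y).rightOp n).hom ≫ (KK Y P).homologyι n).unop.hom

lemma ee_surj (n : ℕ) : Function.Surjective (ee (Y := Y) P n) := by
  intro a
  obtain ⟨f, hf, rfl⟩ := P.extMk_surjective a (n+1) rfl
  obtain ⟨o, rfl⟩ := (bb_range P n f).1 hf
  exact ⟨o, rfl⟩

lemma cc_eq (n : ℕ) (o : OO Y P n) : cc P n o =
   (P.isoLeftDerivedObj ((linearYoneda R (ModuleCat.{u} R)).obj Y).rightOp n).hom.unop.hom (((KK Y P).homologyι n).unop.hom o) := rfl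

lemma iso_bij (n : ℕ) : Function.Bijective
    (P.isoLeftDerivedObj ((linearYoneda R (ModuleCat.{u} R)).obj Y).rightOp n).hom.unop.hom := by
  have : IsIso (P.isoLeftDerivedObj ((linearYoneda R (ModuleCat.{u} R)).obj Y).rightOp n).hom.unop := inferInstance
  exact (ConcreteCategory.isIso_iff_bijective _).1 this

lemma cc_surj (n : ℕ) : Function.Surjective (cc (Y := Y) P n) := by
  intro a
  obtain ⟨b, rfl⟩ := (iso_bij P n).2 a
  obtain ⟨o, rfl⟩ := hι_surj (KK Y P) n b
  exact ⟨o, rfl⟩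

lemma cc_ee (n : ℕ) (o : OO Y P n) : cc P n o = 0 ↔ ee P n o = 0 := by
  have h1 : cc P n o = 0 ↔ ((KK Y P).homologyι n).unop.hom o = 0 := by
    rw [cc_eq]
    constructor
    · intro h; apply (iso_bij P n).1; rw [h]; exact (map_zero _).symm
    · intro h; rw [h]; exact map_zero _
  rw [h1]
  cases n with
  | zero =>
    constructor
    · intro h
      have : o = 0 := hι_inj (KK Y P) (h.trans (map_zero _).symm)
      rw [this]; simp
    · intro h
      have := extMk_zero_inj P (bb P 0 o) (bb_cocycle P 0 o) h
      have : o = 0 := bb_inj P 0 (this.trans (map_zero _).symm)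
      rw [this]; exact map_zero _
  | succ p =>
    refine (hι_ex (KK Y P) (p+1) p rfl o).trans ?_
    refine Iff.trans ?_ (P.extMk_eq_zero_iff (bb P (p+1) o) (p+1+1) rfl (bb_cocycle P (p+1) o) p rfl).symm
    constructor
    · rintro ⟨y, rfl⟩
      exact ⟨y, (pO_from (KK Y P) (p+1) p y).symm⟩
    · rintro ⟨y, hy⟩
      exact ⟨y, bb_inj P (p+1) ((pO_from (KK Y P) (p+1) p y).trans hy)⟩

variable (X Y) in
lemma exists_kk (n : ℕ) (P : ProjectiveResolution X) :
    ∃ κ : oldE X Y n ≃ₗ[R] EX X Y n, ∀ o, κ (cc P n o) = ee P n o := by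
  have hk : LinearMap.ker (cc (Y := Y) P n) = LinearMap.ker (ee P n) := by
    ext o; exact cc_ee P n o
  refine ⟨(LinearMap.quotKerEquivOfSurjective _ (cc_surj P n)).symm ≪≫ₗ
    Submodule.quotEquivOfEq _ _ hk ≪≫ₗ LinearMap.quotKerEquivOfSurjective _ (ee_surj P n), ?_⟩
  intro o
  have : (LinearMap.quotKerEquivOfSurjective _ (cc_surj (Y := Y) P n)).symm (cc P n o) =
      Submodule.Quotient.mk o := by
    rw [LinearEquiv.symm_apply_eq]; rfl
  simp only [LinearEquiv.trans_apply, this]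
  rfl

noncomputable def kap (X Y : ModuleCat.{u} R) (n : ℕ) : oldE X Y n ≃ₗ[R] EX X Y n :=
  (exists_kk X Y n (projectiveResolution X)).choose

lemma kap_cc (n : ℕ) (o) : kap X Y n (cc (projectiveResolution X) n o) = ee _ n o :=
  (exists_kk X Y n (projectiveResolution X)).choose_spec o

lemma extMk_congr {n : ℕ} {f f' : P.complex.X n ⟶ Y} (h : f = f')
    (hf : P.complex.d (n+1) n ≫ f = 0) (hf' : P.complex.d (n+1) n ≫ f' = 0) :
    P.extMk f (n+1) rfl hf = P.extMk f' (n+1) rfl hf' := by subst h; rfl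

lemma kap_nat {X X' : ModuleCat.{u} R} (g : X' ⟶ X) (n : ℕ) (z : oldE X Y n) :
    kap X' Y n ((((Ext R (ModuleCat.{u} R) n).map g.op).app Y).hom z) = pre g.hom (kap X Y n z) := by
  obtain ⟨o, rfl⟩ := cc_surj (projectiveResolution X) n z
  rw [kap_cc]
  let φ := ProjectiveResolution.lift g (projectiveResolution X') (projectiveResolution X)
  have hc := ProjectiveResolution.lift_commutes_zero g (projectiveResolution X') (projectiveResolution X)
  let F := ((linearYoneda R (ModuleCat.{u} R)).obj Y).rightOp
  let o' : OO Y (projectiveResolution X') n :=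
    (HomologicalComplex.opcyclesMap ((F.mapHomologicalComplex _).map φ) n).unop.hom o
  have e1 : (((Ext R (ModuleCat.{u} R) n).map g.op).app Y).hom (cc (projectiveResolution X) n o)
      = cc (projectiveResolution X') n o' := by
    have h := ProjectiveResolution.isoLeftDerivedObj_hom_naturality g _ _ φ hc F n
    have h2 := HomologicalComplex.homologyι_naturality ((F.mapHomologicalComplex _).map φ) n
    have h' := congrArg (fun f => f.unop.hom (((KK Y (projectiveResolution X)).homologyι n).unop.hom o)) h
    have h2' := congrArg (fun f => f.unop.hom o) h2
    refine Eq.trans h' ?_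
    exact congrArg (((projectiveResolution X').isoLeftDerivedObj F n).hom.unop.hom) h2'
  rw [e1, kap_cc]
  have e2 : bb (projectiveResolution X') n o' = φ.f n ≫ bb (projectiveResolution X) n o := by
    have := HomologicalComplex.p_opcyclesMap ((F.mapHomologicalComplex _).map φ) n
    exact congrArg (fun f => f.unop.hom o) this
  refine Eq.symm ((ProjectiveResolution.mk₀_comp_extMk (bb (projectiveResolution X) n o) (n+1) rfl (bb_cocycle _ n o)
      ⟨φ, hc⟩).trans ?_)
  exact extMk_congr _ e2.symm _ (bb_cocycle _ n o')

end
end GGo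

namespace GGo
open Opposite Limits

section
variable {R : Type u} [CommRing R]

/-- the direct system computing local cohomology -/
noncomputable abbrev LG (J : Ideal R) (d : ℕ) (Y : ModuleCat.{u} R) : (ℕᵒᵖ)ᵒᵖ ⥤ ModuleCat.{u} R :=
  localCohomology.diagram (localCohomology.idealPowersDiagram J) d ⋙
    (evaluation (ModuleCat.{u} R) (ModuleCat.{u} R)).obj Y

noncomputable abbrev Qk (J : Ideal R) (k : (ℕᵒᵖ)ᵒᵖ) : ModuleCat.{u} R :=
  (localCohomology.ringModIdeals (localCohomology.idealPowersDiagram J)).obj (unop k)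

lemma lcoh_colim (J : Ideal R) (d : ℕ) (Y : ModuleCat.{u} R) :
    ∃ c : Cocone (LG J d Y), c.pt = (localCohomology J d).obj Y ∧ Nonempty (IsColimit c) := by
  haveI : HasColimit (localCohomology.diagram (localCohomology.idealPowersDiagram J) d) :=
    localCohomology.hasColimitDiagram.{u, 0} _ _
  exact ⟨((evaluation _ _).obj Y).mapCocone (colimit.cocone (localCohomology.diagram (localCohomology.idealPowersDiagram J) d)),
   rfl, ⟨isColimitOfPreserves _ (colimit.isColimit _)⟩⟩

lemma colim_rep {F : (ℕᵒᵖ)ᵒᵖ ⥤ ModuleCat.{u} R} {c : Cocone F} (hc : IsColimit c) (x : c.pt) :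
    ∃ k, ∃ y : F.obj k, (c.ι.app k).hom y = x := by
  haveI : PreservesFilteredColimitsOfSize.{0,0} (forget (ModuleCat.{u} R)) :=
    preservesFilteredColimitsOfSize_shrink.{0,u,0,u} _
  haveI : PreservesColimit F (forget (ModuleCat.{u} R)) := inferInstance
  exact Concrete.isColimit_exists_rep F hc x

/-- elements of `Ext(X,Y)` are killed by whatever kills `X` -/
lemma pre_kill {X Y : ModuleCat.{u} R} {n : ℕ} (r : R) (h : ∀ a : X, r • a = 0) (e : EX X Y n) :
    r • e = 0 := by
  have h1 : (r • LinearMap.id : X →ₗ[R] X) = 0 := LinearMap.ext fun a => h a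
  have h2 := pre_smul r (LinearMap.id : X →ₗ[R] X) e
  rw [h1, pre_id, pre_zero] at h2
  exact h2.symm

lemma Qk_kill (J : Ideal R) (k : (ℕᵒᵖ)ᵒᵖ) (r : R) (hr : r ∈ J) : ∀ a : Qk J k, r ^ (unop (unop k)) • a = 0 := by
  intro a
  obtain ⟨b, rfl⟩ := Ideal.Quotient.mk_surjective (I := J ^ (unop (unop k))) a
  refine (Ideal.Quotient.eq_zero_iff_mem (I := J ^ (unop (unop k))) (a := r ^ (unop (unop k)) * b)).2 ?_
  exact Ideal.mul_mem_right _ _ (Ideal.pow_mem_pow hr _)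

lemma lcoh_tors (J : Ideal R) (d : ℕ) (Y : ModuleCat.{u} R) (r : R) (hr : r ∈ J)
    (h : (localCohomology J d).obj Y) : ∃ n : ℕ, r ^ n • h = 0 := by
  obtain ⟨c, hc, ⟨hl⟩⟩ := lcoh_colim J d Y
  revert h
  rw [← hc]
  intro h
  obtain ⟨k, y, rfl⟩ := colim_rep hl h
  refine ⟨unop (unop k), ?_⟩
  rw [← map_smul]
  have : r ^ (unop (unop k)) • y = 0 := by
    apply (kap (Qk J k) Y d).injective
    refine (map_smul (kap (Qk J k) Y d) _ _).trans ?_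
    exact (pre_kill _ (Qk_kill J k r hr) _).trans (map_zero (kap (Qk J k) Y d)).symm
  rw [this]; exact map_zero _

end

section
variable {R : Type u} [CommRing R] [IsNoetherianRing R]

lemma lcoh_equiv (J : Ideal R) (d : ℕ) (Y H : ModuleCat.{u} R)
    (ht : ∀ r ∈ J, ∀ h : H, ∃ n : ℕ, r^n • h = 0)
    (θ : ∀ X : ModuleCat.{u} R, (X →ₗ[R] H) →ₗ[R] EX X Y d)
    (hn : ∀ (X X' : ModuleCat.{u} R) (g : X' →ₗ[R] X) (f : X →ₗ[R] H), θ X' (f ∘ₗ g) = pre g (θ X f))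
    (hb : ∀ X : ModuleCat.{u} R, (∀ r ∈ J, ∃ n : ℕ, ∀ a : X, r^n • a = 0) → Function.Bijective (θ X)) :
    Nonempty ((localCohomology J d).obj Y ≃ₗ[R] H) := by
  obtain ⟨c, hc, ⟨hl⟩⟩ := lcoh_colim J d Y
  rw [← hc]
  have hbk : ∀ k, Function.Bijective (θ (Qk J k)) := fun k => hb _ fun r hr => ⟨_, Qk_kill J k r hr⟩
  let T : ∀ k, (Qk J k →ₗ[R] H) ≃ₗ[R] EX (Qk J k) Y d := fun k => LinearEquiv.ofBijective _ (hbk k)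
  let one : ∀ k, Qk J k := fun k => (Ideal.Quotient.mk (J ^ (unop (unop k))) 1 : R ⧸ J ^ (unop (unop k)))
  have hone : ∀ k (f g : Qk J k →ₗ[R] H), f (one k) = g (one k) → f = g := by
    intro k f g h
    refine LinearMap.ext fun a => ?_
    obtain ⟨b, rfl⟩ := Ideal.Quotient.mk_surjective (I := J ^ (unop (unop k))) a
    have e : (Ideal.Quotient.mk (J ^ (unop (unop k))) b : Qk J k) = b • one k := by
      change _ = Ideal.Quotient.mk (J ^ (unop (unop k))) (b * 1)
      rw [mul_one]
    rw [e, map_smul, map_smul, h]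
  let j : ∀ k, (LG J d Y).obj k →ₗ[R] H := fun k =>
    (show oldE (Qk J k) Y d →ₗ[R] H from
      (LinearMap.applyₗ (one k)) ∘ₗ (T k).symm.toLinearMap ∘ₗ (kap (Qk J k) Y d).toLinearMap)
  have hjk : ∀ k z, j k z = (T k).symm (kap (Qk J k) Y d z) (one k) := fun _ _ => rfl
  have jinj : ∀ k z, j k z = 0 → z = 0 := by
    intro k z hz
    have h1 : (T k).symm (kap (Qk J k) Y d z) = 0 := hone k _ _ (hz.trans (by simp))
    have h2 : kap (Qk J k) Y d z = 0 := by simpa using h1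
    exact (kap (Qk J k) Y d).injective (h2.trans (map_zero _).symm)
  have jnat : ∀ k k' (w : k ⟶ k') z, j k' (((LG J d Y).map w).hom z) = j k z := by
    intro k k' w z
    let g : Qk J k' ⟶ Qk J k := (localCohomology.ringModIdeals (localCohomology.idealPowersDiagram J)).map w.unop
    have h1 : kap (Qk J k') Y d (((LG J d Y).map w).hom z) = pre g.hom (kap (Qk J k) Y d z) := kap_nat g d z
    have h2 : (T k').symm (pre g.hom (kap (Qk J k) Y d z)) = ((T k).symm (kap (Qk J k) Y d z)) ∘ₗ g.hom := by
      rw [LinearEquiv.symm_apply_eq]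
      refine Eq.trans ?_ (hn _ _ _ _).symm
      congr 1
      exact ((T k).apply_symm_apply _).symm
    rw [hjk, hjk, h1, h2]
    rfl
  let s : Cocone (LG J d Y) :=
    { pt := H
      ι := { app := fun k => ModuleCat.ofHom (j k)
             naturality := by
              intro k k' w
              refine ModuleCat.hom_ext (LinearMap.ext fun z => ?_)
              exact jnat k k' w z } }
  have hd : ∀ k z, (hl.desc s).hom ((c.ι.app k).hom z) = j k z := by
    intro k z
    exact congrArg (fun f => f.hom z) (hl.fac s k)
  refine ⟨LinearEquiv.ofBijective (hl.desc s).hom ⟨?_, ?_⟩⟩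
  · refine (injective_iff_map_eq_zero _).2 fun x hx => ?_
    obtain ⟨k, y, rfl⟩ := colim_rep hl x
    rw [hd] at hx
    rw [jinj k y hx]; exact map_zero _
  · intro h
    have hJ : J ≤ Ideal.radical (LinearMap.ker (LinearMap.toSpanSingleton R H h) : Ideal R) := by
      intro r hr
      obtain ⟨n, hn⟩ := ht r hr h
      exact ⟨n, hn⟩
    obtain ⟨k, hk⟩ := Ideal.exists_pow_le_of_le_radical_of_fg hJ (IsNoetherian.noetherian J)
    let f : Qk J (op (op k)) →ₗ[R] H := Submodule.liftQ (J ^ k) (LinearMap.toSpanSingleton R H h) hk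
    refine ⟨(c.ι.app (op (op k))).hom ((kap (Qk J (op (op k))) Y d).symm (T (op (op k)) f)), ?_⟩
    refine (hd _ _).trans ((hjk _ _).trans ?_)
    have e : (kap (Qk J (op (op k))) Y d) ((kap (Qk J (op (op k))) Y d).symm (T (op (op k)) f)) = T _ f :=
      LinearEquiv.apply_symm_apply _ _
    rw [e, LinearEquiv.symm_apply_apply]
    exact (Submodule.liftQ_apply _ _ _).trans (one_smul R h)
end
end GGo

namespace GGo
section
variable {R : Type u} [CommRing R]

lemma resDim_eq_iff {P : ModuleCat.{u} R → Prop} {N : ModuleCat.{u} R} {n : ℕ} :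
    Paper.ResDim R P N = (n : ℕ∞) ↔
      (Paper.ResDimLE R P n N ∧ ∀ s, s < n → ¬ Paper.ResDimLE R P s N) := by
  constructor
  · intro h
    have hne : {n : ℕ∞ | ∃ k : ℕ, (k : ℕ∞) = n ∧ Paper.ResDimLE R P k N}.Nonempty := by
      by_contra hne
      rw [Set.not_nonempty_iff_eq_empty] at hne
      unfold Paper.ResDim at h
      rw [hne, sInf_empty] at h
      exact ENat.coe_ne_top n h.symm
    have hm := csInf_mem hne
    change Paper.ResDim R P N ∈ _ at hm
    rw [h] at hm
    obtain ⟨k, hk, hk2⟩ := hm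
    have : k = n := by exact_mod_cast hk
    subst this
    refine ⟨hk2, fun s hs hs2 => ?_⟩
    have h3 : Paper.ResDim R P N ≤ s := sInf_le ⟨s, rfl, hs2⟩
    rw [h] at h3
    have : k ≤ s := by exact_mod_cast h3
    omega
  · rintro ⟨h1, h2⟩
    refine le_antisymm (sInf_le ⟨n, rfl, h1⟩) (le_sInf ?_)
    rintro _ ⟨k, rfl, hk⟩
    by_contra hc
    push Not at hc
    exact h2 k (by exact_mod_cast hc) hk

lemma GprojDim_eq_iff {N : ModuleCat.{u} R} {n : ℕ} : Paper.GprojDim R N = (n : ℕ∞) ↔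
    ((GP R).LE n N ∧ ∀ s, s < n → ¬ (GP R).LE s N) := by
  have : (fun N : ModuleCat.{u} R => Paper.IsGorensteinProjective R N) = (GP R).G :=
    funext fun N => propext GP_iff
  unfold Paper.GprojDim
  rw [this]
  exact resDim_eq_iff

lemma GflatDim_eq_iff [IsNoetherianRing R] {N : ModuleCat.{u} R} {n : ℕ} :
    Paper.GflatDim R N = (n : ℕ∞) ↔
    ((GF R).LE n N ∧ ∀ s, s < n → ¬ (GF R).LE s N) := by
  have : (fun N : ModuleCat.{u} R => Paper.IsGorensteinFlat R N) = (GF R).G :=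
    funext fun N => propext GF_iff
  unfold Paper.GflatDim
  rw [this]
  exact resDim_eq_iff

lemma GD.min_iso {D : GD R} {A B : ModuleCat.{u} R} {n : ℕ} (e : A ≃ₗ[R] B)
    (h : D.LE n A ∧ ∀ s, s < n → ¬ D.LE s A) : D.LE n B ∧ ∀ s, s < n → ¬ D.LE s B :=
  ⟨GD.LE_iso e h.1, fun s hs hb => h.2 s hs (GD.LE_iso e.symm hb)⟩

end

lemma main_back {R : Type u} [CommRing R] [IsNoetherianRing R] [IsLocalRing R]
    (hR : Paper.IsCohenMacaulayRing R)
    (M : Type u) [AddCommGroup M] [Module R M] [Module.Finite R M]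
    [Nontrivial M] (d g : ℕ) (hdim : Paper.moduleDim R M = (d : WithBot ℕ∞))
    (hg : (GP R).LE g (ModuleCat.of R M)) {D : GD R}
    (hL : D.LE (g + d) (Paper.lcoh R (maximalIdeal R) d M) ∧
      ∀ s, s < g + d → ¬ D.LE s (Paper.lcoh R (maximalIdeal R) d M)) :
    Paper.IsCohenMacaulayModule R M := by
  obtain ⟨z, hz, hr, N, hN⟩ := CM_ring hR
  have h1 := TC hL.1 (fun x hx h => lcoh_tors (maximalIdeal R) d (ModuleCat.of R M) x hx h) hz
    hr.toIsWeaklyRegular hN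
  have h2 : g + d ≤ z.length := by
    by_contra hc
    exact hL.2 _ (by omega) h1
  obtain ⟨rs, hl, hm, hrr⟩ := AB_reg hz hr hg
  exact CM_of hdim (by omega) hm hrr

end GGo

open Paper IsLocalRing

theorem isCohenMacaulay_iff_GflatDim_localCohomology
    (R : Type u) [CommRing R] [IsNoetherianRing R] [IsLocalRing R]
    (hR : IsCohenMacaulayRing R)
    (M : Type u) [AddCommGroup M] [Module R M] [Module.Finite R M]
    (hM : Nontrivial M) (d : ℕ) (hdim : moduleDim R M = (d : WithBot ℕ∞))
    (hfin : GprojDim R M ≠ ⊤) :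
    ((IsCohenMacaulayModule R M ↔
        GflatDim R (lcoh R (maximalIdeal R) d M) = GprojDim R M + d) ∧
     (GflatDim R (lcoh R (maximalIdeal R) d M) = GprojDim R M + d ↔
        GprojDim R (lcoh R (maximalIdeal R) d M) = GprojDim R M + d)) := by
  obtain ⟨g, hg⟩ := ENat.ne_top_iff_exists.1 hfin
  have hg' := GGo.GprojDim_eq_iff (N := ModuleCat.of R M).1 hg.symm
  have hsum : GprojDim R M + d = ((g + d : ℕ) : ℕ∞) := by rw [← hg]; simp
  rw [hsum, GGo.GprojDim_eq_iff, GGo.GflatDim_eq_iff]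
  have fwd : IsCohenMacaulayModule R M →
      ((GGo.GP R).LE (g + d) (lcoh R (maximalIdeal R) d M) ∧
        ∀ s, s < g + d → ¬ (GGo.GP R).LE s (lcoh R (maximalIdeal R) d M)) ∧
      ((GGo.GF R).LE (g + d) (lcoh R (maximalIdeal R) d M) ∧
        ∀ s, s < g + d → ¬ (GGo.GF R).LE s (lcoh R (maximalIdeal R) d M)) := by
    intro h
    obtain ⟨H, h1, h2, h3, θ, h4, h5⟩ := GGo.CM_tower hdim h hg'.1 hg'.2
    obtain ⟨e⟩ := GGo.lcoh_equiv (maximalIdeal R) d (ModuleCat.of R M) H h3 θ h4 h5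
    exact ⟨GGo.GD.min_iso e.symm h1, GGo.GD.min_iso e.symm h2⟩
  have bP := GGo.main_back hR M d g hdim hg'.1 (D := GGo.GP R)
  have bF := GGo.main_back hR M d g hdim hg'.1 (D := GGo.GF R)
  exact ⟨⟨fun h => (fwd h).2, bF⟩, ⟨fun h => (fwd (bF h)).1, fun h => (fwd (bP h)).2⟩⟩
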